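/- arXiv:1901.10043 — 2 statements merged into one kernel-verified Lean document; each statement's English description precedes it below -/
import Mathlib

section
/- Let (R, 𝔪) be a regular local ring of Krull dimension 2 with residue field k = R/𝔪, and let A be the localization of the polynomial ring k[x₁, x₂] at the maximal ideal (x₁, x₂). Then there exists an order isomorphism (an order-preserving bijection whose inverse is order-preserving) between the poset 𝒱(R) of normalized centered valuations on R and the poset 𝒱(A) of normalized centered valuations on A. -/
open IsLocalRing

/-- A centered valuation on a local ring `(R, 𝔪)`: a function `ν : R → ℝ ∪ {∞}`
(modelled as `EReal`, with all values `≥ 0`, hence never `⊥`) satisfying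
`ν(fg) = ν f + ν g`, `ν(f+g) ≥ min (ν f) (ν g)`, `ν 1 = 0`, `ν f ≥ 0` for all `f`,
`ν f > 0` for `f ∈ 𝔪`, and `ν f < ∞` for some `f ∈ 𝔪`. -/
structure CenteredValn (R : Type*) [CommRing R] [IsLocalRing R] where
  v : R → EReal
  map_mul : ∀ f g : R, v (f * g) = v f + v g
  add_ge : ∀ f g : R, min (v f) (v g) ≤ v (f + g)
  map_one : v 1 = 0
  nonneg : ∀ f : R, 0 ≤ v f
  pos : ∀ f : R, f ∈ maximalIdeal R → 0 < v f
  proper : ∃ f : R, f ∈ maximalIdeal R ∧ v f ≠ ⊤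

/-- A centered valuation is normalized if `inf {ν f : f ∈ 𝔪} = 1`. -/
def CenteredValn.Normalized {R : Type*} [CommRing R] [IsLocalRing R]
    (ν : CenteredValn R) : Prop :=
  sInf {x : EReal | ∃ f ∈ maximalIdeal R, ν.v f = x} = 1

/-- The multiplicity function `f ↦ sup {i ∈ ℕ : f ∈ 𝔪^i}` (so `0 ↦ ∞`). -/
noncomputable def multVal (R : Type*) [CommRing R] [IsLocalRing R] (f : R) : EReal :=
  sSup {x : EReal | ∃ i : ℕ, f ∈ maximalIdeal R ^ i ∧ x = (i : EReal)}


open scoped ENNReal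
set_option linter.unusedSectionVars false

namespace VT

/-- A two-dimensional regular-like local domain with parameters `z, w` and residue map `π`. -/
structure Good (R : Type*) [CommRing R] (k : Type*) [Field k] where
  z : R
  w : R
  π : R →+* k
  surj : Function.Surjective π
  unit : ∀ f, π f ≠ 0 → IsUnit f
  πz : π z = 0
  πw : π w = 0
  z_ne : z ≠ 0
  fin : ∀ f, f ≠ 0 → ∃ n, ¬ z ^ n ∣ f
  exp : ∀ f, ¬ z ∣ f → ∃ u d h, π u ≠ 0 ∧ f = u * w ^ d + z * h
  ndvd : ∀ d, ¬ z ∣ w ^ d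

section
variable {R : Type*} [CommRing R] [IsDomain R] {k : Type*} [Field k] (S : Good R k)

namespace Good

lemma dvd_unit_mul {x u f : R} (hu : S.π u ≠ 0) (h : x ∣ u * f) : x ∣ f :=
  ((S.unit u hu).dvd_mul_left).1 h

lemma prime_z : Prime S.z := by
  refine ⟨S.z_ne, ?_, ?_⟩
  · intro h
    have := h.map S.π
    rw [S.πz] at this
    exact not_isUnit_zero this
  · intro f g hfg
    by_contra! hcon
    obtain ⟨u, d, h, hu, rfl⟩ := S.exp f hcon.1
    obtain ⟨u', d', h', hu', rfl⟩ := S.exp g hcon.2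
    have h1 : S.z ∣ (u * u') * S.w ^ (d + d') := by
      have h2 : (u * u') * S.w ^ (d + d') = (u * S.w ^ d + S.z * h) * (u' * S.w ^ d' + S.z * h')
        - S.z * (h * (u' * S.w ^ d' + S.z * h') + u * S.w ^ d * h') := by ring
      rw [h2]
      exact dvd_sub hfg (dvd_mul_right _ _)
    exact S.ndvd _ (S.dvd_unit_mul (by simp [hu, hu']) h1)

lemma not_z_dvd_w : ¬ S.z ∣ S.w := by simpa using S.ndvd 1

lemma w_ne : S.w ≠ 0 := fun h => S.not_z_dvd_w (by simp [h])

lemma ker_exp {f : R} (hf : S.π f = 0) : ∃ x y, f = S.z * x + S.w * y := by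
  by_cases h : S.z ∣ f
  · obtain ⟨x, rfl⟩ := h
    exact ⟨x, 0, by ring⟩
  · obtain ⟨u, d, h', hu, rfl⟩ := S.exp f h
    cases d with
    | zero => simp [S.πz, hu] at hf
    | succ d => exact ⟨h', u * S.w ^ d, by ring⟩

/-- monomial ideal attached to a set of exponents -/
def I (U : ℕ → ℕ → Prop) : Ideal R :=
  Ideal.span {m | ∃ i j, U i j ∧ m = S.z ^ i * S.w ^ j}

lemma mono_mem {U : ℕ → ℕ → Prop} {i j : ℕ} (h : U i j) : S.z ^ i * S.w ^ j ∈ S.I U :=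
  Ideal.subset_span ⟨i, j, h, rfl⟩

lemma I_mono {U V : ℕ → ℕ → Prop} (h : ∀ i j, U i j → V i j) : S.I U ≤ S.I V := by
  apply Ideal.span_mono
  rintro _ ⟨i, j, hU, rfl⟩
  exact ⟨i, j, h i j hU, rfl⟩

lemma I_mul {U V W : ℕ → ℕ → Prop}
    (h : ∀ i j i' j', U i j → V i' j' → W (i + i') (j + j')) {f g : R}
    (hf : f ∈ S.I U) (hg : g ∈ S.I V) : f * g ∈ S.I W := by
  have h1 : f * g ∈ S.I U * S.I V := Ideal.mul_mem_mul hf hg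
  rw [I, I, Ideal.span_mul_span'] at h1
  refine Ideal.span_mono ?_ h1
  rintro _ ⟨_, ⟨i, j, hU, rfl⟩, _, ⟨i', j', hV, rfl⟩, rfl⟩
  exact ⟨_, _, h _ _ _ _ hU hV, by ring⟩

def Up (U : ℕ → ℕ → Prop) : Prop := ∀ i j i' j', i ≤ i' → j ≤ j' → U i j → U i' j'

lemma mem_I {U : ℕ → ℕ → Prop} (hU : Up U) {u : R} {i j : ℕ} (hu : S.π u ≠ 0)
    (h : u * (S.z ^ i * S.w ^ j) ∈ S.I U) : U i j := by
  by_contra hcon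
  have h1 : S.I U ≤ Ideal.span {S.z ^ (i + 1), S.w ^ (j + 1)} := by
    rw [I, Ideal.span_le]
    rintro _ ⟨i', j', hU', rfl⟩
    by_cases hi : i < i'
    · obtain ⟨r, rfl⟩ := Nat.exists_eq_add_of_lt hi
      refine Ideal.mem_span_pair.2 ⟨S.z ^ r * S.w ^ j', 0, by ring⟩
    by_cases hj : j < j'
    · obtain ⟨r, rfl⟩ := Nat.exists_eq_add_of_lt hj
      refine Ideal.mem_span_pair.2 ⟨0, S.z ^ i' * S.w ^ r, by ring⟩
    exact absurd (hU _ _ _ _ (not_lt.1 hi) (not_lt.1 hj) hU') hcon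
  obtain ⟨a, b, hab⟩ := Ideal.mem_span_pair.1 (h1 h)
  have h2 : S.z ^ i ∣ S.w ^ (j + 1) * b := by
    have : S.w ^ (j + 1) * b = S.z ^ i * (u * S.w ^ j - a * S.z) := by
      linear_combination hab
    exact ⟨_, this⟩
  have h3 : S.z ^ i ∣ b := S.prime_z.pow_dvd_of_dvd_mul_left i (S.ndvd _) h2
  obtain ⟨b', rfl⟩ := h3
  have h4 : S.z ^ i * (S.z * a) = S.z ^ i * ((u - S.w * b') * S.w ^ j) := by
    linear_combination hab
  have h5 := mul_left_cancel₀ (pow_ne_zero i S.z_ne) h4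
  exact S.ndvd j (S.dvd_unit_mul (u := u - S.w * b') (by simpa [S.πw] using hu) ⟨a, h5.symm⟩)

/-- weights -/
noncomputable def wt (c t : ℝ≥0∞) (i j : ℕ) : ℝ≥0∞ := i * c + j * t

lemma wt_add (c t : ℝ≥0∞) (i j i' j' : ℕ) : wt c t (i + i') (j + j') = wt c t i j + wt c t i' j' := by
  simp only [wt]; push_cast; ring

lemma wt_le (c t : ℝ≥0∞) {i j i' j' : ℕ} (hi : i ≤ i') (hj : j ≤ j') : wt c t i j ≤ wt c t i' j' := by
  unfold wt; gcongr

def LeadU (c t : ℝ≥0∞) (i j : ℕ) : ℕ → ℕ → Prop :=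
  fun i' j' => wt c t i j < wt c t i' j' ∨ (wt c t i j ≤ wt c t i' j' ∧ i < i')

lemma up_LeadU (c t : ℝ≥0∞) (i j : ℕ) : Up (LeadU c t i j) := by
  rintro i1 j1 i2 j2 hi hj (h | ⟨h, h'⟩)
  · exact Or.inl (h.trans_le (wt_le c t hi hj))
  · exact Or.inr ⟨h.trans (wt_le c t hi hj), h'.trans_le hi⟩

lemma up_ge (c t r : ℝ≥0∞) : Up (fun i j => r ≤ wt c t i j) :=
  fun _ _ _ _ hi hj h => h.trans (wt_le c t hi hj)

lemma up_gt (c t r : ℝ≥0∞) : Up (fun i j => r < wt c t i j) :=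
  fun _ _ _ _ hi hj h => h.trans_le (wt_le c t hi hj)

/-- `u z^i w^j` is the leading term of `f` -/
def Lead (c t : ℝ≥0∞) (f u : R) (i j : ℕ) : Prop :=
  S.π u ≠ 0 ∧ f - u * (S.z ^ i * S.w ^ j) ∈ S.I (LeadU c t i j)

lemma lead_exists {c t : ℝ≥0∞} (hc : c ≠ ⊤) (N : ℕ) (f : R) :
    f ∈ S.I (fun i j => N * c ≤ wt c t i j) ∨
      ∃ u i j, S.Lead c t f u i j ∧ wt c t i j < N * c := by
  induction N generalizing f with
  | zero =>
    left
    have : S.z ^ 0 * S.w ^ 0 ∈ S.I (fun i j => ((0 : ℕ) : ℝ≥0∞) * c ≤ wt c t i j) :=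
      S.mono_mem (by simp)
    have h1 := Ideal.mul_mem_left _ f this
    simpa using h1
  | succ N ih =>
    have hz : S.z ∈ S.I (fun i j => i = 1 ∧ j = 0) := by
      have := S.mono_mem (U := fun i j => i = 1 ∧ j = 0) (i := 1) (j := 0) ⟨rfl, rfl⟩
      simpa using this
    have hw1 : ∀ i j, wt c t (1 + i) (0 + j) = c + wt c t i j := by
      intro i j; rw [wt_add]; simp [wt]
    -- multiplying by z
    have hmul : ∀ h : R, h ∈ S.I (fun i j => N * c ≤ wt c t i j) →
        S.z * h ∈ S.I (fun i j => ((N + 1 : ℕ) : ℝ≥0∞) * c ≤ wt c t i j) := by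
      intro h hh
      refine S.I_mul ?_ hz hh
      rintro _ _ i j ⟨rfl, rfl⟩ h2
      show _ ≤ _
      rw [hw1]
      push_cast
      rw [add_mul, one_mul, add_comm]
      gcongr
    have hmulL : ∀ h u i j, S.Lead c t h u i j → S.Lead c t (S.z * h) u (1 + i) j := by
      rintro h u i j ⟨hu, hh⟩
      refine ⟨hu, ?_⟩
      have h1 : S.z * h - u * (S.z ^ (1 + i) * S.w ^ j) = S.z * (h - u * (S.z ^ i * S.w ^ j)) := by
        ring
      rw [h1]
      refine S.I_mul ?_ hz hh
      have hw2 := hw1 i j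
      rw [zero_add] at hw2
      rintro _ _ i' j' ⟨rfl, rfl⟩ (h2 | ⟨h2, h3⟩)
      · left
        rw [hw1, hw2]
        exact (ENNReal.add_lt_add_iff_left hc).2 h2
      · right
        rw [hw1, hw2]
        exact ⟨by gcongr, by omega⟩
    have hwL : ∀ i j, wt c t i j < N * c → wt c t (1 + i) j < ((N + 1 : ℕ) : ℝ≥0∞) * c := by
      intro i j h
      have hw2 := hw1 i j
      rw [zero_add] at hw2
      rw [hw2]
      push_cast
      rw [add_mul, one_mul, add_comm]
      exact (ENNReal.add_lt_add_iff_right hc).2 h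
    by_cases hzf : S.z ∣ f
    · obtain ⟨h, rfl⟩ := hzf
      rcases ih h with hh | ⟨u, i, j, hL, hlt⟩
      · exact Or.inl (hmul h hh)
      · exact Or.inr ⟨u, 1 + i, j, hmulL _ _ _ _ hL, hwL _ _ hlt⟩
    · obtain ⟨u, d, h, hu, rfl⟩ := S.exp f hzf
      rcases ih h with hh | ⟨u', i, j, hL, hlt⟩
      · have hh' := hmul h hh
        by_cases hd : ((N + 1 : ℕ) : ℝ≥0∞) * c ≤ wt c t 0 d
        · left
          refine Ideal.add_mem _ (Ideal.mul_mem_left _ _ ?_) hh'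
          have := S.mono_mem (U := fun i j => ((N + 1 : ℕ) : ℝ≥0∞) * c ≤ wt c t i j) hd
          simpa using this
        · right
          refine ⟨u, 0, d, ⟨hu, ?_⟩, not_le.1 hd⟩
          have : u * S.w ^ d + S.z * h - u * (S.z ^ 0 * S.w ^ d) = S.z * h := by ring
          rw [this]
          exact S.I_mono (fun i j hij => Or.inl ((not_le.1 hd).trans_le hij)) hh'
      · have hL' := hmulL _ _ _ _ hL
        have hlt' := hwL _ _ hlt
        right
        by_cases hd : wt c t 0 d ≤ wt c t (1 + i) j
        · refine ⟨u, 0, d, ⟨hu, ?_⟩, hd.trans_lt hlt'⟩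
          have : u * S.w ^ d + S.z * h - u * (S.z ^ 0 * S.w ^ d) =
            (S.z * h - u' * (S.z ^ (1 + i) * S.w ^ j)) + u' * (S.z ^ (1 + i) * S.w ^ j) := by ring
          rw [this]
          refine Ideal.add_mem _ (S.I_mono ?_ hL'.2) (Ideal.mul_mem_left _ _ (S.mono_mem ?_))
          · rintro i' j' (h1 | ⟨h1, h2⟩)
            · exact Or.inl (hd.trans_lt h1)
            · exact Or.inr ⟨hd.trans h1, by omega⟩
          · exact Or.inr ⟨hd, by omega⟩
        · refine ⟨u', 1 + i, j, ⟨hL'.1, ?_⟩, hlt'⟩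
          have : u * S.w ^ d + S.z * h - u' * (S.z ^ (1 + i) * S.w ^ j) =
            u * (S.z ^ 0 * S.w ^ d) + (S.z * h - u' * (S.z ^ (1 + i) * S.w ^ j)) := by ring
          rw [this]
          refine Ideal.add_mem _ (Ideal.mul_mem_left _ _ (S.mono_mem ?_)) hL'.2
          exact Or.inl (not_le.1 hd)

/-- underlying function of the monomial valuation -/
noncomputable def mon (c t : ℝ≥0∞) (f : R) : ℝ≥0∞ := sSup {r | f ∈ S.I (fun i j => r ≤ wt c t i j)}

lemma le_mon {c t r : ℝ≥0∞} {f : R} (h : f ∈ S.I (fun i j => r ≤ wt c t i j)) : r ≤ S.mon c t f :=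
  le_sSup h

lemma mon_of_lead {c t : ℝ≥0∞} {f u : R} {i j : ℕ} (h : S.Lead c t f u i j) :
    S.mon c t f = wt c t i j := by
  apply le_antisymm
  · refine sSup_le fun r hr => ?_
    by_contra hlt
    rw [not_le] at hlt
    have h1 : u * (S.z ^ i * S.w ^ j) ∈ S.I (LeadU c t i j) := by
      have : u * (S.z ^ i * S.w ^ j) = f - (f - u * (S.z ^ i * S.w ^ j)) := by ring
      rw [this]
      exact Ideal.sub_mem _ (S.I_mono (fun i j hij => Or.inl (hlt.trans_le hij)) hr) h.2
    rcases S.mem_I (up_LeadU c t i j) h.1 h1 with h2 | h2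
    · exact lt_irrefl _ h2
    · exact lt_irrefl _ h2.2
  · apply S.le_mon
    have : f = (f - u * (S.z ^ i * S.w ^ j)) + u * (S.z ^ i * S.w ^ j) := by ring
    rw [this]
    refine Ideal.add_mem _ (S.I_mono ?_ h.2) (Ideal.mul_mem_left _ _ (S.mono_mem le_rfl))
    rintro i' j' (h1 | h1)
    · exact h1.le
    · exact h1.1

lemma mon_cases {c t : ℝ≥0∞} (hc0 : c ≠ 0) (hc : c ≠ ⊤) (f : R) :
    S.mon c t f = ⊤ ∨ ∃ u i j, S.Lead c t f u i j ∧ wt c t i j ≠ ⊤ := by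
  by_cases h : ∃ u i j, S.Lead c t f u i j ∧ wt c t i j ≠ ⊤
  · exact Or.inr h
  left
  have h1 : ∀ N : ℕ, (N : ℝ≥0∞) * c ≤ S.mon c t f := by
    intro N
    rcases S.lead_exists (t := t) hc N f with h2 | ⟨u, i, j, hL, hlt⟩
    · exact S.le_mon h2
    · exact absurd ⟨u, i, j, hL, hlt.ne_top⟩ h
  by_contra hne
  obtain ⟨N, hN⟩ := ENNReal.exists_nat_mul_gt hc0 hne
  exact absurd (h1 N) (not_le.2 hN)

lemma mem_of_lt_mon {c t r : ℝ≥0∞} {f : R} (h : r < S.mon c t f) :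
    f ∈ S.I (fun i j => r ≤ wt c t i j) := by
  obtain ⟨s, hs, hrs⟩ := lt_sSup_iff.1 h
  exact S.I_mono (fun i j hij => hrs.le.trans hij) hs

lemma mon_add (c t : ℝ≥0∞) (f g : R) : min (S.mon c t f) (S.mon c t g) ≤ S.mon c t (f + g) := by
  refine le_of_forall_lt fun r hr => ?_
  obtain ⟨s, hs1, hs2⟩ := exists_between hr
  refine hs1.trans_le (S.le_mon ?_)
  exact Ideal.add_mem _ (S.mem_of_lt_mon (hs2.trans_le (min_le_left _ _)))
    (S.mem_of_lt_mon (hs2.trans_le (min_le_right _ _)))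

lemma mon_mul_top {c t : ℝ≥0∞} {f : R} (h : S.mon c t f = ⊤) (g : R) : S.mon c t (f * g) = ⊤ := by
  refine ENNReal.eq_top_of_forall_nnreal_le fun r => S.le_mon (Ideal.mul_mem_right _ _ ?_)
  apply S.mem_of_lt_mon
  rw [h]; exact ENNReal.coe_lt_top

lemma lead_mul {c t : ℝ≥0∞} {f g u u' : R} {i j i' j' : ℕ} (h : S.Lead c t f u i j)
    (h' : S.Lead c t g u' i' j') (hfin : wt c t i j ≠ ⊤) (hfin' : wt c t i' j' ≠ ⊤) :
    S.Lead c t (f * g) (u * u') (i + i') (j + j') := by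
  refine ⟨by simpa using ⟨h.1, h'.1⟩, ?_⟩
  set m := u * (S.z ^ i * S.w ^ j) with hm
  set m' := u' * (S.z ^ i' * S.w ^ j') with hm'
  have e1 : f * g - u * u' * (S.z ^ (i + i') * S.w ^ (j + j')) =
    m * (g - m') + (f - m) * m' + (f - m) * (g - m') := by rw [hm, hm']; ring
  rw [e1]
  have hmI : m ∈ S.I (fun x y => x = i ∧ y = j) := Ideal.mul_mem_left _ _ (S.mono_mem ⟨rfl, rfl⟩)
  have hmI' : m' ∈ S.I (fun x y => x = i' ∧ y = j') := Ideal.mul_mem_left _ _ (S.mono_mem ⟨rfl, rfl⟩)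
  refine Ideal.add_mem _ (Ideal.add_mem _ (S.I_mul ?_ hmI h'.2) (S.I_mul ?_ h.2 hmI'))
    (S.I_mul ?_ h.2 h'.2)
  · rintro _ _ x y ⟨rfl, rfl⟩ (h1 | h1)
    · left; rw [wt_add, wt_add]; exact (ENNReal.add_lt_add_iff_left hfin).2 h1
    · right; rw [wt_add, wt_add]; exact ⟨by gcongr; exact h1.1, by omega⟩
  · rintro x y _ _ (h1 | h1) ⟨rfl, rfl⟩
    · left; rw [wt_add, wt_add]; exact (ENNReal.add_lt_add_iff_right hfin').2 h1
    · right; rw [wt_add, wt_add]; exact ⟨by gcongr; exact h1.1, by omega⟩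
  · rintro x y x' y' h1 h2
    have h2' : wt c t i' j' ≤ wt c t x' y' := by rcases h2 with h2 | h2; exacts [h2.le, h2.1]
    rcases h1 with h1 | h1
    · left; rw [wt_add, wt_add]; exact ENNReal.add_lt_add_of_lt_of_le hfin' h1 h2'
    · rcases h2 with h2 | h2
      · left; rw [wt_add, wt_add]; exact ENNReal.add_lt_add_of_le_of_lt hfin h1.1 h2
      · right; rw [wt_add, wt_add]; exact ⟨by gcongr; exact h1.1, by omega⟩

lemma mon_mul {c t : ℝ≥0∞} (hc0 : c ≠ 0) (hc : c ≠ ⊤) (f g : R) :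
    S.mon c t (f * g) = S.mon c t f + S.mon c t g := by
  rcases S.mon_cases (t := t) hc0 hc f with h | ⟨u, i, j, hL, hfin⟩
  · rw [h, top_add, S.mon_mul_top h]
  rcases S.mon_cases (t := t) hc0 hc g with h | ⟨u', i', j', hL', hfin'⟩
  · rw [h, add_top, mul_comm, S.mon_mul_top h]
  rw [S.mon_of_lead hL, S.mon_of_lead hL', S.mon_of_lead (S.lead_mul hL hL' hfin hfin'), wt_add]

lemma mon_unit (c t : ℝ≥0∞) {u : R} (hu : S.π u ≠ 0) (i j : ℕ) :
    S.mon c t (u * (S.z ^ i * S.w ^ j)) = wt c t i j :=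
  S.mon_of_lead (u := u) ⟨hu, by simp⟩

lemma mon_monom (c t : ℝ≥0∞) (i j : ℕ) :
    S.mon c t (S.z ^ i * S.w ^ j) = wt c t i j := by
  have := S.mon_unit c t (u := 1) (by simp) i j
  simpa using this

/-- nonzero elements have finite value if `t` is finite -/
lemma mon_ne_top {c t : ℝ≥0∞} (hc0 : c ≠ 0) (hc : c ≠ ⊤) (ht : t ≠ ⊤) {f : R} (hf : f ≠ 0) :
    S.mon c t f ≠ ⊤ := by
  -- write `f = z^m (u w^d + z h)`
  have hex := S.fin f hf
  classical
  let m := Nat.find hex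
  have hm : ¬ S.z ^ m ∣ f := Nat.find_spec hex
  have hm0 : m ≠ 0 := by
    intro h0; rw [h0] at hm; simp at hm
  obtain ⟨m', hm'⟩ := Nat.exists_eq_succ_of_ne_zero hm0
  have h1 : S.z ^ m' ∣ f := by
    have := Nat.find_min hex (m := m') (by show m' < m; omega)
    exact not_not.1 this
  obtain ⟨g, rfl⟩ := h1
  have hg : ¬ S.z ∣ g := by
    rintro ⟨x, rfl⟩
    exact hm ⟨x, by rw [hm', Nat.succ_eq_add_one]; ring⟩
  obtain ⟨u, d, h, hu, rfl⟩ := S.exp g hg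
  intro htop
  obtain ⟨r, hr⟩ : ∃ r : ℝ≥0∞, r = wt c t m' d + 1 := ⟨_, rfl⟩
  have hwfin : wt c t m' d ≠ ⊤ := by
    unfold wt
    exact ENNReal.add_ne_top.2 ⟨ENNReal.mul_ne_top (by simp) hc, ENNReal.mul_ne_top (by simp) ht⟩
  have hmem := S.mem_of_lt_mon (c := c) (t := t) (r := r) (f := S.z ^ m' * (u * S.w ^ d + S.z * h))
    (by rw [htop, hr]; exact lt_top_iff_ne_top.2 (ENNReal.add_ne_top.2 ⟨hwfin, by simp⟩))
  have hmem2 : u * (S.z ^ m' * S.w ^ d) ∈ S.I (fun i j => r ≤ wt c t i j ∨ m' < i) := by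
    have : u * (S.z ^ m' * S.w ^ d) = S.z ^ m' * (u * S.w ^ d + S.z * h) -
      h * (S.z ^ (m' + 1) * S.w ^ 0) := by ring
    rw [this]
    refine Ideal.sub_mem _ (S.I_mono (fun i j hij => Or.inl hij) hmem)
      (Ideal.mul_mem_left _ _ (S.mono_mem (Or.inr (by omega))))
  have hup : Up (fun i j => r ≤ wt c t i j ∨ m' < i) := by
    rintro i j i' j' hi hj (h1 | h1)
    · exact Or.inl (h1.trans (wt_le c t hi hj))
    · exact Or.inr (by omega)
  rcases S.mem_I hup hu hmem2 with h1 | h1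
  · rw [hr] at h1
    exact absurd h1 (not_le.2 (ENNReal.lt_add_right hwfin (by simp)))
  · omega

end Good

/-- centered valuation with finite value on `z` -/
@[ext]
structure CVal {R : Type*} [CommRing R] {k : Type*} [Field k] (S : Good R k) where
  v : R → ℝ≥0∞
  map_mul : ∀ f g, v (f * g) = v f + v g
  add_ge : ∀ f g, min (v f) (v g) ≤ v (f + g)
  map_one : v 1 = 0
  pos : ∀ f, S.π f = 0 → v f ≠ 0
  zfin : v S.z ≠ ⊤

namespace CVal
variable {S} (ν : CVal S)

lemma unit {u : R} (hu : S.π u ≠ 0) : ν.v u = 0 := by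
  obtain ⟨x, hx⟩ := (S.unit u hu).exists_right_inv
  have h := ν.map_mul u x
  rw [hx, ν.map_one] at h
  exact (add_eq_zero.1 h.symm).1

lemma map_zero : ν.v 0 = ⊤ := by
  have h := ν.map_mul 0 0
  rw [mul_zero] at h
  by_contra hne
  exact ν.pos 0 (_root_.map_zero _) (by
    have : ν.v 0 + 0 = ν.v 0 + ν.v 0 := by rw [add_zero]; exact h
    exact ((ENNReal.add_right_inj hne).1 this).symm)

lemma map_pow (f : R) (n : ℕ) : ν.v (f ^ n) = n * ν.v f := by
  induction n with
  | zero => simp [ν.map_one]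
  | succ n ih => rw [pow_succ, ν.map_mul, ih]; push_cast; ring

lemma monom (i j : ℕ) : ν.v (S.z ^ i * S.w ^ j) = Good.wt (ν.v S.z) (ν.v S.w) i j := by
  rw [ν.map_mul, ν.map_pow, ν.map_pow]; rfl

lemma neg (f : R) : ν.v (-f) = ν.v f := by
  have : ν.v (-1) = 0 := ν.unit (by simp)
  rw [← neg_one_mul, ν.map_mul, this, zero_add]

lemma mul_ge (f g : R) : ν.v g ≤ ν.v (f * g) := by rw [ν.map_mul]; exact le_add_self

lemma le_of_mem {r : ℝ≥0∞} {U : ℕ → ℕ → Prop} (hU : ∀ i j, U i j → r ≤ Good.wt (ν.v S.z) (ν.v S.w) i j)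
    {f : R} (hf : f ∈ S.I U) : r ≤ ν.v f := by
  refine Submodule.span_induction ?_ ?_ ?_ ?_ hf
  · rintro _ ⟨i, j, h, rfl⟩
    rw [ν.monom]; exact hU _ _ h
  · rw [ν.map_zero]; exact le_top
  · intro x y _ _ hx hy
    exact (le_min hx hy).trans (ν.add_ge x y)
  · intro a x _ hx
    exact hx.trans (ν.mul_ge a x)

lemma lt_of_mem {r : ℝ≥0∞} (hr : r ≠ ⊤) {U : ℕ → ℕ → Prop}
    (hU : ∀ i j, U i j → r < Good.wt (ν.v S.z) (ν.v S.w) i j)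
    {f : R} (hf : f ∈ S.I U) : r < ν.v f := by
  refine Submodule.span_induction ?_ ?_ ?_ ?_ hf
  · rintro _ ⟨i, j, h, rfl⟩
    rw [ν.monom]; exact hU _ _ h
  · rw [ν.map_zero]; exact lt_top_iff_ne_top.2 hr
  · intro x y _ _ hx hy
    exact (lt_min hx hy).trans_le (ν.add_ge x y)
  · intro a x _ hx
    exact hx.trans_le (ν.mul_ge a x)

lemma add_eq {f g : R} (h : ν.v f < ν.v g) : ν.v (f + g) = ν.v f := by
  apply le_antisymm
  · by_contra hlt
    rw [not_le] at hlt
    have h1 := ν.add_ge (f + g) (-g)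
    rw [ν.neg, add_neg_cancel_right] at h1
    exact absurd h1 (not_le.2 (lt_min hlt h))
  · exact (le_min le_rfl h.le).trans (ν.add_ge f g)

lemma mon_le (f : R) : S.mon (ν.v S.z) (ν.v S.w) f ≤ ν.v f :=
  sSup_le fun _ hr => ν.le_of_mem (fun _ _ h => h) hr

lemma mon_le' {c t : ℝ≥0∞} (hc : c ≤ ν.v S.z) (ht : t ≤ ν.v S.w) (f : R) : S.mon c t f ≤ ν.v f :=
  sSup_le fun _ hr => ν.le_of_mem (fun _ _ h => h.trans (by unfold Good.wt; gcongr)) hr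

lemma z0 : ν.v S.z ≠ 0 := ν.pos _ S.πz
lemma w0 : ν.v S.w ≠ 0 := ν.pos _ S.πw

end CVal

/-- monomial valuation -/
noncomputable def Mono (c t : ℝ≥0∞) (hc0 : c ≠ 0) (hc : c ≠ ⊤) (ht : t ≠ 0) : CVal S where
  v := S.mon c t
  map_mul := S.mon_mul hc0 hc
  add_ge := S.mon_add c t
  map_one := by
    have := S.mon_monom c t 0 0
    simpa [Good.wt] using this
  pos := by
    intro f hf h0
    obtain ⟨x, y, rfl⟩ := S.ker_exp hf
    have h1 : min c t ≤ S.mon c t (S.z * x + S.w * y) := by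
      apply S.le_mon
      refine Ideal.add_mem _ (Ideal.mul_mem_right _ _ ?_) (Ideal.mul_mem_right _ _ ?_)
      · have := S.mono_mem (U := fun i j => min c t ≤ Good.wt c t i j) (i := 1) (j := 0)
          (by simp [Good.wt])
        simpa using this
      · have := S.mono_mem (U := fun i j => min c t ≤ Good.wt c t i j) (i := 0) (j := 1)
          (by simp [Good.wt])
        simpa using this
    rw [h0] at h1
    have := lt_min (pos_iff_ne_zero.2 hc0) (pos_iff_ne_zero.2 ht)
    exact absurd h1 (not_le.2 this)
  zfin := by
    have := S.mon_monom c t 1 0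
    simp [Good.wt] at this
    rw [this]; exact hc

lemma Mono_z (c t : ℝ≥0∞) (hc0 : c ≠ 0) (hc : c ≠ ⊤) (ht : t ≠ 0) :
    (Mono S c t hc0 hc ht).v S.z = c := by
  have := S.mon_monom c t 1 0
  simp [Good.wt] at this
  exact this

lemma Mono_w (c t : ℝ≥0∞) (hc0 : c ≠ 0) (hc : c ≠ ⊤) (ht : t ≠ 0) :
    (Mono S c t hc0 hc ht).v S.w = t := by
  have := S.mon_monom c t 0 1
  simp [Good.wt] at this
  exact this

end
end VT

open scoped ENNReal
set_option linter.unusedSectionVars false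

namespace VT
open Polynomial

/-- data of a toric step: slope `a / b` and a closed point of the torus orbit -/
@[ext]
structure Dat (k : Type*) [Field k] where
  a : ℕ
  b : ℕ
  φ : k[X]
  ha : 0 < a
  hb : 0 < b
  cop : Nat.Coprime a b
  monic : φ.Monic
  irr : Irreducible φ
  neX : φ ≠ X

section
variable {R : Type*} [CommRing R] [IsDomain R] {k : Type*} [Field k] (S : Good R k) (D : Dat k)

namespace Good

/-- integer weights -/
def Ge (D : Dat k) (N : ℕ) : ℕ → ℕ → Prop := fun i j => N ≤ D.b * i + D.a * j

lemma up_Ge (N : ℕ) : Up (Ge D N) := by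
  intro i j i' j' hi hj h
  unfold Ge at *
  have := Nat.mul_le_mul_left D.b hi
  have := Nat.mul_le_mul_left D.a hj
  omega

lemma Ge_mul {N M : ℕ} {f g : R} (hf : f ∈ S.I (Ge D N)) (hg : g ∈ S.I (Ge D M)) :
    f * g ∈ S.I (Ge D (N + M)) := by
  refine S.I_mul ?_ hf hg
  intro i j i' j' h1 h2
  unfold Ge at *
  rw [mul_add, mul_add]; omega

lemma Ge_anti {N M : ℕ} (h : N ≤ M) : S.I (Ge D M) ≤ S.I (Ge D N) :=
  S.I_mono (fun i j hij => by unfold Ge at *; omega)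

lemma Ge_zero (f : R) : f ∈ S.I (Ge D 0) := by
  have := Ideal.mul_mem_left _ f (S.mono_mem (U := Ge D 0) (i := 0) (j := 0) (by simp [Ge]))
  simpa using this

lemma Ge_one {f : R} (hf : S.π f = 0) : f ∈ S.I (Ge D 1) := by
  obtain ⟨x, y, rfl⟩ := S.ker_exp hf
  have h1 := S.mono_mem (U := Ge D 1) (i := 1) (j := 0) (by simp [Ge, Nat.one_le_iff_ne_zero, D.hb.ne'])
  have h2 := S.mono_mem (U := Ge D 1) (i := 0) (j := 1) (by simp [Ge, Nat.one_le_iff_ne_zero, D.ha.ne'])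
  refine Ideal.add_mem _ (Ideal.mul_mem_right _ _ ?_) (Ideal.mul_mem_right _ _ ?_)
  · simpa using h1
  · simpa using h2

/-- homogenization: `z^{an} q(w^b/z^a)` -/
noncomputable def H (n : ℕ) (q : R[X]) : R :=
  ∑ l ∈ Finset.range (n + 1), q.coeff l * (S.z ^ (D.a * (n - l)) * S.w ^ (D.b * l))

noncomputable def uu : FractionRing R :=
  algebraMap R (FractionRing R) S.w ^ D.b / algebraMap R (FractionRing R) S.z ^ D.a

lemma zK : algebraMap R (FractionRing R) S.z ≠ 0 := by
  simpa using S.z_ne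
lemma wK : algebraMap R (FractionRing R) S.w ≠ 0 := by
  simpa using S.w_ne

lemma H_eq {n : ℕ} {q : R[X]} (hq : q.natDegree ≤ n) :
    algebraMap R (FractionRing R) (S.H D n q) =
      algebraMap R (FractionRing R) S.z ^ (D.a * n) * aeval (S.uu D) q := by
  rw [aeval_eq_sum_range' (Nat.lt_succ_of_le hq), H, map_sum, Finset.mul_sum]
  refine Finset.sum_congr rfl fun l hl => ?_
  have hl' : l ≤ n := by simpa [Nat.lt_succ_iff] using hl
  obtain ⟨m, rfl⟩ := Nat.exists_eq_add_of_le hl'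
  have hz := S.zK
  simp only [map_mul, map_pow, uu, Algebra.smul_def, div_pow, Nat.add_sub_cancel_left]
  field_simp
  ring

lemma H_mul {n m : ℕ} {q q' : R[X]} (hq : q.natDegree ≤ n) (hq' : q'.natDegree ≤ m) :
    S.H D n q * S.H D m q' = S.H D (n + m) (q * q') := by
  apply IsFractionRing.injective R (FractionRing R)
  rw [map_mul, S.H_eq D hq, S.H_eq D hq',
    S.H_eq D (natDegree_mul_le.trans (add_le_add hq hq')), map_mul]
  ring

lemma H_add (n : ℕ) (q q' : R[X]) : S.H D n (q + q') = S.H D n q + S.H D n q' := by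
  simp [H, add_mul, Finset.sum_add_distrib]

lemma H_C_mul (n : ℕ) (r : R) (q : R[X]) : S.H D n (C r * q) = r * S.H D n q := by
  simp [H, Finset.mul_sum, mul_assoc]

lemma H_mem (n : ℕ) (q : R[X]) : S.H D n q ∈ S.I (Ge D (D.a * D.b * n)) := by
  refine Ideal.sum_mem _ fun l hl => Ideal.mul_mem_left _ _ (S.mono_mem ?_)
  have hl' : l ≤ n := by simpa [Nat.lt_succ_iff] using hl
  obtain ⟨m, rfl⟩ := Nat.exists_eq_add_of_le hl'
  unfold Ge
  rw [Nat.add_sub_cancel_left]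
  apply le_of_eq; ring

lemma H_X_pow {n l : ℕ} (hl : l ≤ n) :
    S.H D n (X ^ l) = S.z ^ (D.a * (n - l)) * S.w ^ (D.b * l) := by
  rw [H, Finset.sum_eq_single l]
  · simp
  · intro b _ hb; simp [coeff_X_pow, hb]
  · intro h; simp at h; omega

/-- `Q` is the initial form of `f` in degree `n` -/
def Rho (n : ℕ) (f : R) (Q : k[X]) : Prop :=
  ∃ q : R[X], q.map S.π = Q ∧ q.natDegree ≤ n ∧ f - S.H D n q ∈ S.I (Ge D (D.a * D.b * n + 1))

variable {S D}

lemma Rho.deg {n : ℕ} {f : R} {Q : k[X]} (h : S.Rho D n f Q) : Q.natDegree ≤ n := by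
  obtain ⟨q, rfl, hq, -⟩ := h
  exact natDegree_map_le.trans hq

lemma Rho.mem {n : ℕ} {f : R} {Q : k[X]} (h : S.Rho D n f Q) : f ∈ S.I (Ge D (D.a * D.b * n)) := by
  obtain ⟨q, rfl, hq, h⟩ := h
  have := Ideal.add_mem _ (S.Ge_anti D (Nat.le_succ _) h) (S.H_mem D n q)
  simpa using this

lemma Rho.add {n : ℕ} {f g : R} {Q P : k[X]} (h : S.Rho D n f Q) (h' : S.Rho D n g P) :
    S.Rho D n (f + g) (Q + P) := by
  obtain ⟨q, rfl, hq, h⟩ := h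
  obtain ⟨q', rfl, hq', h'⟩ := h'
  refine ⟨q + q', by simp, (natDegree_add_le _ _).trans (max_le hq hq'), ?_⟩
  rw [H_add]
  have := Ideal.add_mem _ h h'
  convert this using 1; ring

lemma Rho.smul {n : ℕ} {f : R} {Q : k[X]} (r : R) (h : S.Rho D n f Q) :
    S.Rho D n (r * f) (C (S.π r) * Q) := by
  obtain ⟨q, rfl, hq, h⟩ := h
  refine ⟨C r * q, by simp, (natDegree_C_mul_le _ _).trans hq, ?_⟩
  rw [H_C_mul]
  have := Ideal.mul_mem_left _ r h
  convert this using 1; ring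

lemma Rho.neg {n : ℕ} {f : R} {Q : k[X]} (h : S.Rho D n f Q) : S.Rho D n (-f) (-Q) := by
  have := h.smul (-1); simpa using this

lemma Rho.sub {n : ℕ} {f g : R} {Q P : k[X]} (h : S.Rho D n f Q) (h' : S.Rho D n g P) :
    S.Rho D n (f - g) (Q - P) := by
  rw [sub_eq_add_neg, sub_eq_add_neg]; exact h.add h'.neg

lemma Rho.mul {n m : ℕ} {f g : R} {Q P : k[X]} (h : S.Rho D n f Q) (h' : S.Rho D m g P) :
    S.Rho D (n + m) (f * g) (Q * P) := by
  have hg := h'.mem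
  obtain ⟨q, rfl, hq, h⟩ := h
  obtain ⟨q', rfl, hq', h'⟩ := h'
  refine ⟨q * q', by simp, natDegree_mul_le.trans (add_le_add hq hq'), ?_⟩
  rw [← S.H_mul D hq hq']
  have h1 := S.Ge_mul D h hg
  have h2 := S.Ge_mul D (S.H_mem D n q) h'
  have := Ideal.add_mem _ (S.Ge_anti D (N := D.a * D.b * (n + m) + 1) (by rw [mul_add]; omega) h1)
    (S.Ge_anti D (N := D.a * D.b * (n + m) + 1) (by rw [mul_add]; omega) h2)
  convert this using 1; ring

lemma Rho_H {n : ℕ} {q : R[X]} (hq : q.natDegree ≤ n) : S.Rho D n (S.H D n q) (q.map S.π) :=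
  ⟨q, rfl, hq, by simp⟩

lemma Rho_zero_of_mem {n : ℕ} {f : R} (h : f ∈ S.I (Ge D (D.a * D.b * n + 1))) : S.Rho D n f 0 :=
  ⟨0, by simp, by simp, by simpa [H] using h⟩

lemma Rho_monom {n l : ℕ} (hl : l ≤ n) :
    S.Rho D n (S.z ^ (D.a * (n - l)) * S.w ^ (D.b * l)) (X ^ l) := by
  have := Rho_H (S := S) (D := D) (n := n) (q := X ^ l) (by simpa using hl)
  rw [S.H_X_pow D hl] at this
  simpa using this

lemma Rho_z (n : ℕ) : S.Rho D n (S.z ^ (D.a * n)) 1 := by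
  simpa using Rho_monom (S := S) (D := D) (Nat.zero_le n)

lemma Rho_w (n : ℕ) : S.Rho D n (S.w ^ (D.b * n)) (X ^ n) := by
  simpa using Rho_monom (S := S) (D := D) (le_refl n)

lemma Rho_const (f : R) : S.Rho D 0 f (C (S.π f)) := by
  have := Rho_H (S := S) (D := D) (n := 0) (q := C f) (by simp)
  simpa [H] using this

lemma Rho_exists {n : ℕ} {f : R} (hf : f ∈ S.I (Ge D (D.a * D.b * n))) : ∃ Q, S.Rho D n f Q := by
  refine Submodule.span_induction ?_ ?_ ?_ ?_ hf
  · rintro _ ⟨i, j, h, rfl⟩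
    unfold Ge at h
    rcases h.lt_or_eq with h | h
    · exact ⟨0, Rho_zero_of_mem (S.mono_mem h)⟩
    · have hai : D.a ∣ i := by
        refine D.cop.dvd_of_dvd_mul_left ((Nat.dvd_add_left (dvd_mul_right D.a j)).1 ?_)
        rw [← h, mul_assoc]; exact dvd_mul_right _ _
      have hbj : D.b ∣ j := by
        refine D.cop.symm.dvd_of_dvd_mul_left ((Nat.dvd_add_right (dvd_mul_right D.b i)).1 ?_)
        rw [← h, mul_comm D.a, mul_assoc]; exact dvd_mul_right _ _
      obtain ⟨i, rfl⟩ := hai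
      obtain ⟨j, rfl⟩ := hbj
      have hn : n = i + j := by
        have : D.a * D.b * n = D.a * D.b * (i + j) := by rw [h]; ring
        exact Nat.eq_of_mul_eq_mul_left (Nat.mul_pos D.ha D.hb) this
      have := Rho_monom (S := S) (D := D) (n := n) (l := j) (by omega)
      rw [hn, Nat.add_sub_cancel] at this
      rw [hn]
      exact ⟨_, this⟩
  · exact ⟨0, Rho_zero_of_mem (Ideal.zero_mem _)⟩
  · rintro x y _ _ ⟨Q, hQ⟩ ⟨P, hP⟩
    exact ⟨_, hQ.add hP⟩
  · rintro r x _ ⟨Q, hQ⟩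
    exact ⟨_, hQ.smul r⟩

/-- the monomials of the initial form belong to any monomial ideal containing `f` -/
lemma Rho.coefV {n : ℕ} {f : R} {Q : k[X]} (h : S.Rho D n f Q) {V : ℕ → ℕ → Prop} (hV : Up V)
    (hf : f ∈ S.I V) {l : ℕ} (hl : Q.coeff l ≠ 0) :
    V (D.a * (n - l)) (D.b * l) ∨ D.a * D.b * n + 1 ≤ D.a * D.b * n := by
  have hln : l ≤ n := (le_natDegree_of_ne_zero hl).trans h.deg
  obtain ⟨q, rfl, hq, h⟩ := h
  rw [coeff_map] at hl
  have hwt : ∀ l', l' ≤ n → D.b * (D.a * (n - l')) + D.a * (D.b * l') = D.a * D.b * n := by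
    intro l' hl'
    obtain ⟨m, rfl⟩ := Nat.exists_eq_add_of_le hl'
    rw [Nat.add_sub_cancel_left]; ring
  set U : ℕ → ℕ → Prop := fun i j => V i j ∨ Ge D (D.a * D.b * n + 1) i j ∨
    (D.a * D.b * n ≤ D.b * i + D.a * j ∧ ¬ (i = D.a * (n - l) ∧ j = D.b * l)) with hU
  have hUp : Up U := by
    rintro i j i' j' hi hj (h1 | h1 | ⟨h1, h2⟩)
    · exact Or.inl (hV _ _ _ _ hi hj h1)
    · exact Or.inr (Or.inl (up_Ge D _ _ _ _ _ hi hj h1))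
    · right
      have e1 := Nat.mul_le_mul_left D.b hi
      have e2 := Nat.mul_le_mul_left D.a hj
      by_cases h3 : i = i' ∧ j = j'
      · right; rw [← h3.1, ← h3.2]; exact ⟨h1, h2⟩
      · left
        unfold Ge
        rcases hi.lt_or_eq with hi | hi
        · have := Nat.mul_lt_mul_of_pos_left hi D.hb
          omega
        · rcases hj.lt_or_eq with hj | hj
          · have := Nat.mul_lt_mul_of_pos_left hj D.ha
            omega
          · exact absurd ⟨hi, hj⟩ h3
  have hmem : q.coeff l * (S.z ^ (D.a * (n - l)) * S.w ^ (D.b * l)) ∈ S.I U := by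
    have hsplit : S.H D n q = q.coeff l * (S.z ^ (D.a * (n - l)) * S.w ^ (D.b * l)) +
        ∑ l' ∈ (Finset.range (n + 1)).erase l,
          q.coeff l' * (S.z ^ (D.a * (n - l')) * S.w ^ (D.b * l')) := by
      exact (Finset.add_sum_erase (Finset.range (n + 1))
        (fun l' => q.coeff l' * (S.z ^ (D.a * (n - l')) * S.w ^ (D.b * l')))
        (Finset.mem_range.2 (by omega))).symm
    have e1 : q.coeff l * (S.z ^ (D.a * (n - l)) * S.w ^ (D.b * l)) =
        f - (f - S.H D n q) - ∑ l' ∈ (Finset.range (n + 1)).erase l,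
          q.coeff l' * (S.z ^ (D.a * (n - l')) * S.w ^ (D.b * l')) := by
      rw [hsplit]; ring
    rw [e1]
    refine Ideal.sub_mem _ (Ideal.sub_mem _ (S.I_mono (fun i j hij => Or.inl hij) hf)
      (S.I_mono (fun i j hij => Or.inr (Or.inl hij)) h)) (Ideal.sum_mem _ fun l' hl' => ?_)
    refine Ideal.mul_mem_left _ _ (S.mono_mem (Or.inr (Or.inr ?_)))
    simp only [Finset.mem_erase, Finset.mem_range] at hl'
    refine ⟨(hwt l' (by omega)).ge, fun hcon => hl'.1 ?_⟩
    exact Nat.eq_of_mul_eq_mul_left D.hb hcon.2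
  rcases S.mem_I hUp hl hmem with h1 | h1 | h1
  · exact Or.inl h1
  · right
    unfold Ge at h1
    rw [hwt l hln] at h1
    exact h1
  · exact absurd ⟨rfl, rfl⟩ h1.2

lemma Rho.coef {n : ℕ} {f : R} {Q : k[X]} (h : S.Rho D n f Q) {V : ℕ → ℕ → Prop} (hV : Up V)
    (hf : f ∈ S.I V) {l : ℕ} (hl : Q.coeff l ≠ 0) : V (D.a * (n - l)) (D.b * l) := by
  rcases h.coefV hV hf hl with h | h
  · exact h
  · omega

lemma Rho.eq_zero {n : ℕ} {f : R} {Q : k[X]} (h : S.Rho D n f Q)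
    (hf : f ∈ S.I (Ge D (D.a * D.b * n + 1))) : Q = 0 := by
  ext l
  by_contra hl
  rw [coeff_zero] at hl
  have hln : l ≤ n := (le_natDegree_of_ne_zero hl).trans h.deg
  have h1 := h.coef (up_Ge D _) hf hl
  obtain ⟨m, rfl⟩ := Nat.exists_eq_add_of_le hln
  unfold Ge at h1
  rw [Nat.add_sub_cancel_left] at h1
  have : D.b * (D.a * m) + D.a * (D.b * l) = D.a * D.b * (l + m) := by ring
  omega

lemma Rho.unique {n : ℕ} {f : R} {Q P : k[X]} (h : S.Rho D n f Q) (h' : S.Rho D n f P) : Q = P := by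
  have h1 := h.sub h'
  rw [sub_self] at h1
  exact sub_eq_zero.1 (h1.eq_zero (Ideal.zero_mem _))

lemma Rho.mem_of_zero {n : ℕ} {f : R} (h : S.Rho D n f 0) : f ∈ S.I (Ge D (D.a * D.b * n + 1)) := by
  obtain ⟨q, hq0, hq, h⟩ := h
  have h1 : S.H D n q ∈ S.I (Ge D (D.a * D.b * n + 1)) := by
    refine Ideal.sum_mem _ fun l hl => ?_
    have hl' : l ≤ n := by simpa [Nat.lt_succ_iff] using hl
    have hc : S.π (q.coeff l) = 0 := by
      have := congrArg (fun p => p.coeff l) hq0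
      simpa using this
    have h2 := S.Ge_mul D (S.Ge_one D hc) (S.mono_mem (U := Ge D (D.a * D.b * n))
      (i := D.a * (n - l)) (j := D.b * l) (by
        obtain ⟨m, rfl⟩ := Nat.exists_eq_add_of_le hl'
        unfold Ge
        rw [Nat.add_sub_cancel_left]; apply le_of_eq; ring))
    rwa [add_comm 1] at h2
  have := Ideal.add_mem _ h h1
  simpa using this

lemma Rho.ne_zero {n : ℕ} {f : R} {Q : k[X]} (h : S.Rho D n f Q) (hQ : Q ≠ 0) : f ≠ 0 := by
  rintro rfl
  exact hQ (h.eq_zero (Ideal.zero_mem _))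

variable (S) in
lemma lift_poly (Q : k[X]) : ∃ q : R[X], q.map S.π = Q ∧ q.natDegree = Q.natDegree := by
  have h : Q ∈ Polynomial.lifts S.π := by
    rw [Polynomial.mem_lifts]
    exact Polynomial.map_surjective _ S.surj Q
  obtain ⟨q, hq, hd⟩ := Polynomial.exists_degree_eq_of_mem_lifts h
  exact ⟨q, hq, natDegree_eq_of_degree_eq hd⟩

lemma Rho_lift {Q : k[X]} {n : ℕ} (hQ : Q.natDegree ≤ n) : ∃ f, S.Rho D n f Q := by
  obtain ⟨q, rfl, hd⟩ := S.lift_poly Q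
  exact ⟨_, Rho_H (hd.trans_le hQ)⟩

/-- monomial valuation of an element with nonzero initial form -/
lemma Rho.mon_le {n : ℕ} {f : R} {Q : k[X]} (h : S.Rho D n f Q) (hQ : Q ≠ 0) {c t : ℝ≥0∞}
    (hct : D.b * t = D.a * c) : S.mon c t f ≤ (D.a * n : ℕ) * c := by
  refine sSup_le fun r hr => ?_
  obtain ⟨l, hl⟩ : ∃ l, Q.coeff l ≠ 0 := by
    by_contra! hcon
    exact hQ (by ext l; simpa using hcon l)
  have hln : l ≤ n := (le_natDegree_of_ne_zero hl).trans h.deg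
  refine (h.coef (up_ge c t r) hr hl).trans (le_of_eq ?_)
  obtain ⟨m, rfl⟩ := Nat.exists_eq_add_of_le hln
  rw [Nat.add_sub_cancel_left]
  unfold wt
  push_cast
  calc (D.a * m * c + D.b * l * t : ℝ≥0∞) = D.a * m * c + l * (D.b * t) := by ring
    _ = _ := by rw [hct]; ring

end Good
end
end VT

open scoped ENNReal
set_option linter.unusedSectionVars false

namespace VT
open Polynomial

section
variable {k : Type*} [Field k] (D : Dat k)

namespace Dat

instance : Fact (Irreducible D.φ) := ⟨D.irr⟩

lemma bez : ∃ i j, D.b * i = D.a * j + 1 := by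
  rcases Nat.lt_or_ge 1 D.a with h | h
  · obtain ⟨m, -, hm⟩ := Nat.exists_mul_mod_eq_one_of_coprime D.cop.symm h
    refine ⟨m, D.b * m / D.a, ?_⟩
    have := Nat.div_add_mod (D.b * m) D.a
    omega
  · have ha : D.a = 1 := le_antisymm h D.ha
    refine ⟨1, D.b - 1, ?_⟩
    have := D.hb
    rw [ha]; omega

noncomputable def i : ℕ := D.bez.choose
noncomputable def j : ℕ := D.bez.choose_spec.choose
lemma hij : D.b * D.i = D.a * D.j + 1 := D.bez.choose_spec.choose_spec

lemma prime : Prime D.φ := D.irr.prime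

lemma ndvd_X_pow (n : ℕ) : ¬ D.φ ∣ X ^ n := by
  intro h
  have h1 := D.prime.dvd_of_dvd_pow h
  have h2 : Associated D.φ X := D.irr.associated_of_dvd irreducible_X h1
  exact D.neX (eq_of_monic_of_associated D.monic monic_X h2)

lemma ndvd_one : ¬ D.φ ∣ 1 := by simpa using D.ndvd_X_pow 0

lemma ndvd_mul {P Q : k[X]} (hP : ¬ D.φ ∣ P) (hQ : ¬ D.φ ∣ Q) : ¬ D.φ ∣ P * Q := fun h =>
  (D.prime.dvd_or_dvd h).elim hP hQ

lemma mk_ne {P : k[X]} (hP : ¬ D.φ ∣ P) : AdjoinRoot.mk D.φ P ≠ 0 := by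
  rwa [Ne, AdjoinRoot.mk_eq_zero]

lemma φ0 : D.φ.coeff 0 ≠ 0 := by
  intro h
  have h1 : X ∣ D.φ := X_dvd_iff.2 h
  have h2 : Associated X D.φ := irreducible_X.associated_of_dvd D.irr h1
  exact D.neX (eq_of_monic_of_associated D.monic monic_X h2.symm)

end Dat
end

section
variable {R : Type*} [CommRing R] [IsDomain R] {k : Type*} [Field k] (S : Good R k) (D : Dat k)


/-- `F = f/g` with initial forms `Q`, `P` -/
structure Rep (F : FractionRing R) (n : ℕ) (f g : R) (Q P : k[X]) : Prop where
  num : S.Rho D n f Q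
  den : S.Rho D n g P
  nd : ¬ D.φ ∣ P
  eq : F * (algebraMap R (FractionRing R)) g = (algebraMap R (FractionRing R)) f

variable {S D}
namespace Rep
variable {F F' : FractionRing R} {n n' : ℕ} {f f' g g' : R} {Q Q' P P' : k[X]}

lemma P_ne (h : Rep S D F n f g Q P) : P ≠ 0 := by rintro rfl; exact h.nd (dvd_zero _)

lemma g_ne (h : Rep S D F n f g Q P) : g ≠ 0 := h.den.ne_zero h.P_ne

lemma cross (h : Rep S D F n f g Q P) (h' : Rep S D F n' f' g' Q' P') : f * g' = f' * g := by
  apply IsFractionRing.injective R (FractionRing R)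
  rw [map_mul, map_mul, ← h.eq, ← h'.eq]; ring

lemma crossQ (h : Rep S D F n f g Q P) (h' : Rep S D F n' f' g' Q' P') : Q * P' = Q' * P := by
  have h1 := h.num.mul h'.den
  have h2 := h'.num.mul h.den
  rw [h.cross h', add_comm n n'] at h1
  exact h1.unique h2

lemma add (h : Rep S D F n f g Q P) (h' : Rep S D F' n' f' g' Q' P') :
    Rep S D (F + F') (n + n') (f * g' + g * f') (g * g') (Q * P' + P * Q') (P * P') where
  num := (h.num.mul h'.den).add (h.den.mul h'.num)
  den := h.den.mul h'.den
  nd := D.ndvd_mul h.nd h'.nd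
  eq := by simp only [map_add, map_mul, ← h.eq, ← h'.eq]; ring

lemma mul (h : Rep S D F n f g Q P) (h' : Rep S D F' n' f' g' Q' P') :
    Rep S D (F * F') (n + n') (f * f') (g * g') (Q * Q') (P * P') where
  num := h.num.mul h'.num
  den := h.den.mul h'.den
  nd := D.ndvd_mul h.nd h'.nd
  eq := by simp only [map_mul, ← h.eq, ← h'.eq]; ring

lemma neg (h : Rep S D F n f g Q P) : Rep S D (-F) n (-f) g (-Q) P where
  num := h.num.neg
  den := h.den
  nd := h.nd
  eq := by simp only [map_neg, ← h.eq]; ring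

lemma inv (h : Rep S D F n f g Q P) (hQ : ¬ D.φ ∣ Q) : Rep S D F⁻¹ n g f P Q where
  num := h.den
  den := h.num
  nd := hQ
  eq := by
    have hF : F ≠ 0 := by
      rintro rfl
      have h1 := h.eq
      rw [zero_mul] at h1
      have h2 : f = 0 := by simpa using h1.symm
      exact h.num.ne_zero (by rintro rfl; exact hQ (dvd_zero _)) h2
    rw [← h.eq, inv_mul_cancel_left₀ hF]

end Rep

variable (S D) in
lemma Rep_of (f : R) : Rep S D ((algebraMap R (FractionRing R)) f) 0 f 1 (C (S.π f)) 1 where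
  num := Good.Rho_const f
  den := by simpa using Good.Rho_const (S := S) (D := D) (1 : R)
  nd := D.ndvd_one
  eq := by simp

variable (S D)

def StepR : Subring (FractionRing R) where
  carrier := {F | ∃ n f g Q P, Rep S D F n f g Q P}
  mul_mem' := by
    rintro F F' ⟨n, f, g, Q, P, h⟩ ⟨n', f', g', Q', P', h'⟩
    exact ⟨_, _, _, _, _, h.mul h'⟩
  one_mem' := ⟨_, _, _, _, _, by simpa using Rep_of S D 1⟩
  add_mem' := by
    rintro F F' ⟨n, f, g, Q, P, h⟩ ⟨n', f', g', Q', P', h'⟩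
    exact ⟨_, _, _, _, _, h.add h'⟩
  zero_mem' := ⟨_, _, _, _, _, by simpa using Rep_of S D 0⟩
  neg_mem' := by
    rintro F ⟨n, f, g, Q, P, h⟩
    exact ⟨_, _, _, _, _, h.neg⟩

lemma StepR_rep (F : StepR S D) : ∃ n f g Q P, Rep S D (F : FractionRing R) n f g Q P := F.2

noncomputable def piFun (F : StepR S D) : AdjoinRoot D.φ :=
  AdjoinRoot.mk D.φ (StepR_rep S D F).choose_spec.choose_spec.choose_spec.choose /
    AdjoinRoot.mk D.φ (StepR_rep S D F).choose_spec.choose_spec.choose_spec.choose_spec.choose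

variable {S D}

lemma piFun_rep {F : StepR S D} {n : ℕ} {f g : R} {Q P : k[X]}
    (h : Rep S D (F : FractionRing R) n f g Q P) :
    piFun S D F = AdjoinRoot.mk D.φ Q / AdjoinRoot.mk D.φ P := by
  have h' := (StepR_rep S D F).choose_spec.choose_spec.choose_spec.choose_spec.choose_spec
  unfold piFun
  rw [div_eq_div_iff (D.mk_ne h'.nd) (D.mk_ne h.nd), ← map_mul, ← map_mul, h'.crossQ h]

variable (S D)

noncomputable def stepπ : StepR S D →+* AdjoinRoot D.φ where
  toFun := piFun S D
  map_one' := by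
    have e : (1 : StepR S D) = ⟨algebraMap R (FractionRing R) 1, _, _, _, _, _, Rep_of S D 1⟩ :=
      Subtype.ext (map_one _).symm
    rw [e, piFun_rep (F := ⟨_, _, _, _, _, _, Rep_of S D 1⟩) (Rep_of S D 1)]; simp
  map_zero' := by
    have e : (0 : StepR S D) = ⟨algebraMap R (FractionRing R) 0, _, _, _, _, _, Rep_of S D 0⟩ :=
      Subtype.ext (map_zero _).symm
    rw [e, piFun_rep (F := ⟨_, _, _, _, _, _, Rep_of S D 0⟩) (Rep_of S D 0)]; simp
  map_mul' := by
    intro F F'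
    obtain ⟨n, f, g, Q, P, h⟩ := StepR_rep S D F
    obtain ⟨n', f', g', Q', P', h'⟩ := StepR_rep S D F'
    rw [piFun_rep h, piFun_rep h', piFun_rep (F := F * F') (h.mul h')]
    simp only [map_mul]
    rw [div_mul_div_comm]
  map_add' := by
    intro F F'
    obtain ⟨n, f, g, Q, P, h⟩ := StepR_rep S D F
    obtain ⟨n', f', g', Q', P', h'⟩ := StepR_rep S D F'
    rw [piFun_rep h, piFun_rep h', piFun_rep (F := F + F') (h.add h'),
      div_add_div _ _ (D.mk_ne h.nd) (D.mk_ne h'.nd)]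
    simp only [map_mul, map_add]

variable {S D}

lemma stepπ_rep {F : StepR S D} {n : ℕ} {f g : R} {Q P : k[X]}
    (h : Rep S D (F : FractionRing R) n f g Q P) :
    stepπ S D F = AdjoinRoot.mk D.φ Q / AdjoinRoot.mk D.φ P := piFun_rep h

lemma stepπ_ne {F : StepR S D} {n : ℕ} {f g : R} {Q P : k[X]}
    (h : Rep S D (F : FractionRing R) n f g Q P) : stepπ S D F ≠ 0 ↔ ¬ D.φ ∣ Q := by
  rw [stepπ_rep h, Ne, div_eq_zero_iff, AdjoinRoot.mk_eq_zero, AdjoinRoot.mk_eq_zero]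
  have := h.nd
  tauto

variable (S D)

noncomputable def stepι : R →+* StepR S D :=
  (algebraMap R (FractionRing R)).codRestrict (StepR S D) (fun f => ⟨_, _, _, _, _, Rep_of S D f⟩)

@[simp] lemma stepι_coe (f : R) : ((stepι S D f : StepR S D) : FractionRing R) = (algebraMap R (FractionRing R)) f := rfl

lemma stepπ_ι {f : R} (hf : S.π f = 0) : stepπ S D (stepι S D f) = 0 := by
  rw [stepπ_rep (F := stepι S D f) (Rep_of S D f), hf]; simp

/-- quotient `f / z^{an}` -/
lemma rep_quo {n : ℕ} {f : R} {Q : k[X]} (h : S.Rho D n f Q) :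
    Rep S D ((algebraMap R (FractionRing R)) f / (algebraMap R (FractionRing R)) S.z ^ (D.a * n)) n f (S.z ^ (D.a * n)) Q 1 where
  num := h
  den := Good.Rho_z n
  nd := D.ndvd_one
  eq := by
    rw [map_pow, div_mul_cancel₀ _ (pow_ne_zero _ S.zK)]

lemma rep_z : Rep S D ((algebraMap R (FractionRing R)) S.z ^ D.i / (algebraMap R (FractionRing R)) S.w ^ D.j) D.j
    (S.z ^ D.i * S.w ^ ((D.b - 1) * D.j)) (S.w ^ (D.b * D.j)) 0 (X ^ D.j) where
  num := by
    apply Good.Rho_zero_of_mem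
    apply S.mono_mem
    unfold Good.Ge
    have h := D.hij
    obtain ⟨b', hb'⟩ := Nat.exists_eq_succ_of_ne_zero D.hb.ne'
    rw [h]
    rw [hb', Nat.succ_eq_add_one, Nat.add_sub_cancel]
    apply le_of_eq; ring
  den := Good.Rho_w D.j
  nd := D.ndvd_X_pow _
  eq := by
    obtain ⟨b', hb'⟩ := Nat.exists_eq_succ_of_ne_zero D.hb.ne'
    rw [hb', Nat.succ_eq_add_one, Nat.add_sub_cancel]
    have := S.wK
    simp only [map_mul, map_pow]
    field_simp
    ring

noncomputable def stepz : StepR S D := ⟨_, _, _, _, _, _, rep_z S D⟩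

noncomputable def lphi : R[X] := (S.lift_poly D.φ).choose
lemma lphi_map : (lphi S D).map S.π = D.φ := (S.lift_poly D.φ).choose_spec.1
lemma lphi_deg : (lphi S D).natDegree = D.φ.natDegree := (S.lift_poly D.φ).choose_spec.2

/-- homogenized lift of `φ` -/
noncomputable def Hφ : R := S.H D D.φ.natDegree (lphi S D)

lemma Rho_φ : S.Rho D D.φ.natDegree (Hφ S D) D.φ := by
  have := Good.Rho_H (S := S) (D := D) (lphi_deg S D).le
  rwa [lphi_map] at this

noncomputable def stepw : StepR S D := ⟨_, _, _, _, _, _, rep_quo S D (Rho_φ S D)⟩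

lemma rep_w : Rep S D (stepw S D : FractionRing R) D.φ.natDegree (Hφ S D)
    (S.z ^ (D.a * D.φ.natDegree)) D.φ 1 := rep_quo S D (Rho_φ S D)

variable {S D}

lemma Rep.zdvd {F : StepR S D} {n : ℕ} {f g : R} {P : k[X]}
    (h : Rep S D (F : FractionRing R) n f g 0 P) : stepz S D ∣ F := by
  have hij := D.hij
  obtain ⟨a', ha'⟩ := Nat.exists_eq_succ_of_ne_zero D.ha.ne'
  have hz := S.zK
  have hw := S.wK
  have hmem : f * (S.z ^ ((D.a - 1) * D.i) * S.w ^ D.j) ∈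
      S.I (Good.Ge D (D.a * D.b * (n + D.i))) := by
    have h1 := S.Ge_mul D h.num.mem_of_zero (S.mono_mem
      (U := Good.Ge D (D.b * ((D.a - 1) * D.i) + D.a * D.j)) (i := (D.a - 1) * D.i) (j := D.j) le_rfl)
    refine S.Ge_anti D ?_ h1
    have : D.b * ((D.a - 1) * D.i) + D.b * D.i = D.a * D.b * D.i := by
      rw [ha', Nat.succ_eq_add_one, Nat.add_sub_cancel]; ring
    rw [mul_add]; omega
  obtain ⟨Q, hQ⟩ := Good.Rho_exists hmem
  have hrep : Rep S D ((F : FractionRing R) * ((algebraMap R (FractionRing R)) S.w ^ D.j / (algebraMap R (FractionRing R)) S.z ^ D.i)) (n + D.i)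
      (f * (S.z ^ ((D.a - 1) * D.i) * S.w ^ D.j)) (g * S.z ^ (D.a * D.i)) Q (P * 1) :=
    { num := hQ
      den := h.den.mul (Good.Rho_z D.i)
      nd := D.ndvd_mul h.nd D.ndvd_one
      eq := by
        have e : S.z ^ (D.a * D.i) = S.z ^ ((D.a - 1) * D.i) * S.z ^ D.i := by
          rw [ha', Nat.succ_eq_add_one, Nat.add_sub_cancel]; ring
        rw [e]
        simp only [map_mul, ← h.eq, map_pow]
        field_simp }
  refine ⟨⟨_, _, _, _, _, _, hrep⟩, ?_⟩
  apply Subtype.ext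
  show (F : FractionRing R) = ((algebraMap R (FractionRing R)) S.z ^ D.i / (algebraMap R (FractionRing R)) S.w ^ D.j) * (F * ((algebraMap R (FractionRing R)) S.w ^ D.j / (algebraMap R (FractionRing R)) S.z ^ D.i))
  field_simp

lemma Rep.of_zdvd {F : StepR S D} {n : ℕ} {f g : R} {Q P : k[X]}
    (h : Rep S D (F : FractionRing R) n f g Q P) (hd : stepz S D ∣ F) : Q = 0 := by
  obtain ⟨G, rfl⟩ := hd
  obtain ⟨n', f', g', Q', P', h'⟩ := StepR_rep S D G
  have h1 := h.crossQ ((rep_z S D).mul h')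
  rw [zero_mul, zero_mul] at h1
  exact (mul_eq_zero.1 h1).resolve_right (mul_ne_zero (pow_ne_zero _ X_ne_zero) h'.P_ne)

lemma Rep.exp {F : StepR S D} {n : ℕ} {f g : R} {q P : k[X]} {e : ℕ} (hq : ¬ D.φ ∣ q)
    (h : Rep S D (F : FractionRing R) n f g (D.φ ^ e * q) P) :
    ∃ u h', stepπ S D u ≠ 0 ∧ F = u * stepw S D ^ e + stepz S D * h' := by
  have hq0 : q ≠ 0 := by rintro rfl; exact hq (dvd_zero _)
  have hdeg : q.natDegree ≤ n := by
    refine le_trans ?_ h.num.deg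
    rw [natDegree_mul (pow_ne_zero _ D.irr.ne_zero) hq0]; omega
  obtain ⟨x, hx⟩ := Good.Rho_lift (S := S) (D := D) hdeg
  have hU : Rep S D ((algebraMap R (FractionRing R)) x / (algebraMap R (FractionRing R)) g) n x g q P :=
    { num := hx
      den := h.den
      nd := h.nd
      eq := div_mul_cancel₀ _ (by simpa using h.g_ne) }
  let U : StepR S D := ⟨_, _, _, _, _, _, hU⟩
  have hpow : ∀ e : ℕ, ∃ g1, Rep S D ((stepw S D ^ e : StepR S D) : FractionRing R)
      (D.φ.natDegree * e) (Hφ S D ^ e) g1 (D.φ ^ e) 1 := by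
    intro e
    induction e with
    | zero =>
      refine ⟨1, ?_⟩
      have := Rep_of S D 1
      simpa using this
    | succ e ih =>
      obtain ⟨g1, ih⟩ := ih
      have := ih.mul (rep_w S D)
      refine ⟨g1 * S.z ^ (D.a * D.φ.natDegree), ?_⟩
      rw [pow_succ, pow_succ, pow_succ, mul_add, mul_one]
      rw [mul_one] at this
      exact this
  obtain ⟨g1, hp⟩ := hpow e
  have hUe : Rep S D ((U * stepw S D ^ e : StepR S D) : FractionRing R) _ _ _ _ _ := hU.mul hp
  have hsub : Rep S D ((F + -(U * stepw S D ^ e) : StepR S D) : FractionRing R) _ _ _ _ _ :=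
    h.add hUe.neg
  have e0 : D.φ ^ e * q * (P * 1) + P * -(q * D.φ ^ e) = 0 := by ring
  rw [e0] at hsub
  obtain ⟨h', hh'⟩ := hsub.zdvd
  refine ⟨U, h', (stepπ_ne (F := U) hU).2 hq, ?_⟩
  rw [← hh']; ring

variable (S D)

lemma step_fin (F : StepR S D) (hF : F ≠ 0) : ∃ n, ¬ stepz S D ^ n ∣ F := by
  by_contra! hcon
  obtain ⟨n, f, g, Q, P, h⟩ := StepR_rep S D F
  have hf : f ≠ 0 := by
    rintro rfl
    apply hF
    have h1 := h.eq
    rw [map_zero] at h1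
    have h2 : (F : FractionRing R) = 0 := (mul_eq_zero.1 h1).resolve_right (by simpa using h.g_ne)
    exact Subtype.ext h2
  obtain ⟨b, hb⟩ : ∃ b : ℝ≥0∞, b = (D.b : ℝ≥0∞) := ⟨_, rfl⟩
  obtain ⟨a, ha⟩ : ∃ a : ℝ≥0∞, a = (D.a : ℝ≥0∞) := ⟨_, rfl⟩
  have hb0 : b ≠ 0 := by simpa [hb] using D.hb.ne'
  have hbt : b ≠ ⊤ := by simp [hb]
  have hat : a ≠ ⊤ := by simp [ha]
  have hfin := S.mon_ne_top (t := a) hb0 hbt hat hf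
  obtain ⟨N, hN⟩ := ENNReal.exists_nat_gt hfin
  obtain ⟨G, hG⟩ := hcon N
  obtain ⟨n', f', g', Q', P', h'⟩ := StepR_rep S D G
  -- weights of elements with nonzero initial form
  have hle : ∀ {m : ℕ} {x : R} {A : k[X]}, S.Rho D m x A → ((D.a * D.b * m : ℕ) : ℝ≥0∞) ≤ S.mon b a x := by
    intro m x A hx
    apply S.le_mon
    refine S.I_mono ?_ hx.mem
    intro i j hij
    unfold Good.Ge at hij
    have : ((D.a * D.b * m : ℕ) : ℝ≥0∞) ≤ ((D.b * i + D.a * j : ℕ) : ℝ≥0∞) := by exact_mod_cast hij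
    refine this.trans (le_of_eq ?_)
    unfold Good.wt; rw [hb, ha]; push_cast; ring
  have heq : ∀ {m : ℕ} {x : R} {A : k[X]}, S.Rho D m x A → A ≠ 0 →
      S.mon b a x = ((D.a * D.b * m : ℕ) : ℝ≥0∞) := by
    intro m x A hx hA
    refine le_antisymm ((hx.mon_le hA (by rw [hb, ha, mul_comm])).trans (le_of_eq ?_)) (hle hx)
    rw [hb]; push_cast; ring
  -- the relation
  have hrel : f * (g' * S.w ^ (D.b * D.j * N)) =
      (f' * g) * (S.z ^ D.i * S.w ^ ((D.b - 1) * D.j)) ^ N := by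
    apply IsFractionRing.injective R (FractionRing R)
    have e1 := h.eq
    rw [hG] at e1
    have e2 := (rep_z S D).eq
    have e3 := h'.eq
    simp only [map_mul, ← e1, ← e3]
    rw [map_pow, map_pow, ← e2, map_pow]
    push_cast
    rw [show ((stepz S D : StepR S D) : FractionRing R) = (algebraMap R (FractionRing R)) S.z ^ D.i / (algebraMap R (FractionRing R)) S.w ^ D.j from rfl]
    ring
  have hmon := congrArg (S.mon b a) hrel
  have hpow : ∀ (x : R) (m : ℕ), S.mon b a (x ^ m) = m * S.mon b a x :=
    fun x m => (Mono S b a hb0 hbt (by simpa [ha] using D.ha.ne')).map_pow x m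
  have hw' : S.mon b a S.w = a := Mono_w S b a hb0 hbt (by simpa [ha] using D.ha.ne')
  simp only [S.mon_mul hb0 hbt, hpow, hw'] at hmon
  rw [heq h'.den h'.P_ne, heq h.den h.P_ne,
    show S.mon b a S.z = b from Mono_z S b a hb0 hbt (by simpa [ha] using D.ha.ne')] at hmon
  have h3 := hle h'.num
  have hkey : (D.i : ℝ≥0∞) * b + ((D.b - 1) * D.j : ℕ) * a = ((D.b * D.j * D.a + 1 : ℕ) : ℝ≥0∞) := by
    rw [hb, ha]
    norm_cast
    have hij := D.hij
    obtain ⟨b', hb'⟩ := Nat.exists_eq_succ_of_ne_zero D.hb.ne'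
    rw [mul_comm D.i, hij]
    rw [hb', Nat.succ_eq_add_one, Nat.add_sub_cancel]; ring
  rw [hkey] at hmon
  have hX : S.mon b a f + (((D.a * D.b * n' + D.b * D.j * N * D.a : ℕ)) : ℝ≥0∞) =
      S.mon b a f' + ((D.a * D.b * n + N * (D.b * D.j * D.a + 1) : ℕ) : ℝ≥0∞) := by
    push_cast at hmon ⊢
    rw [← ha, ← hb] at hmon ⊢
    rw [← add_assoc, ← add_assoc] at *
    exact hmon
  have hY : (N : ℝ≥0∞) + (((D.a * D.b * n' + D.b * D.j * N * D.a : ℕ)) : ℝ≥0∞) ≤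
      S.mon b a f + (((D.a * D.b * n' + D.b * D.j * N * D.a : ℕ)) : ℝ≥0∞) := by
    rw [hX]
    calc (N : ℝ≥0∞) + (((D.a * D.b * n' + D.b * D.j * N * D.a : ℕ)) : ℝ≥0∞)
        ≤ ((D.a * D.b * n' : ℕ) : ℝ≥0∞) + ((D.a * D.b * n + N * (D.b * D.j * D.a + 1) : ℕ) : ℝ≥0∞) := by
          norm_cast
          have : N * (D.b * D.j * D.a + 1) = D.b * D.j * N * D.a + N := by ring
          omega
      _ ≤ _ := by gcongr
  have hZ := (ENNReal.add_le_add_iff_right (ENNReal.natCast_ne_top _)).1 hY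
  exact absurd hN (not_lt.2 hZ)

/-- The toric step -/
noncomputable def step : Good (StepR S D) (AdjoinRoot D.φ) where
  z := stepz S D
  w := stepw S D
  π := stepπ S D
  surj := by
    intro y
    obtain ⟨Q, rfl⟩ := AdjoinRoot.mk_surjective y
    obtain ⟨f, hf⟩ := Good.Rho_lift (S := S) (D := D) (le_refl Q.natDegree)
    refine ⟨⟨_, _, _, _, _, _, rep_quo S D hf⟩, ?_⟩
    rw [stepπ_rep (rep_quo S D hf)]; simp
  unit := by
    intro F hF
    obtain ⟨n, f, g, Q, P, h⟩ := StepR_rep S D F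
    have hQ := (stepπ_ne h).1 hF
    have hinv := h.inv hQ
    refine IsUnit.of_mul_eq_one ⟨_, _, _, _, _, _, hinv⟩ ?_
    apply Subtype.ext
    show (F : FractionRing R) * (F : FractionRing R)⁻¹ = 1
    apply mul_inv_cancel₀
    intro h0
    apply hF
    have : F = 0 := Subtype.ext h0
    rw [this, map_zero]
  πz := by rw [stepπ_rep (rep_z S D)]; simp
  πw := by rw [stepπ_rep (rep_w S D)]; simp
  z_ne := by
    intro h
    have := congrArg (fun x : StepR S D => (x : FractionRing R)) h
    have hne : (algebraMap R (FractionRing R)) S.z ^ D.i / (algebraMap R (FractionRing R)) S.w ^ D.j ≠ 0 :=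
      div_ne_zero (pow_ne_zero _ S.zK) (pow_ne_zero _ S.wK)
    exact hne this
  fin := step_fin S D
  exp := by
    intro F hF
    obtain ⟨n, f, g, Q, P, h⟩ := StepR_rep S D F
    have hQ : Q ≠ 0 := by
      rintro rfl
      exact hF h.zdvd
    obtain ⟨e, q, hq, rfl⟩ := (FiniteMultiplicity.of_prime_left D.prime hQ).exists_eq_pow_mul_and_not_dvd.imp
      (fun q hq => hq) |> fun ⟨q, hq⟩ => (⟨_, q, hq.2, hq.1⟩ : ∃ e q, ¬ D.φ ∣ q ∧ Q = D.φ ^ e * q)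
    obtain ⟨u, h', hu, he⟩ := h.exp hq
    exact ⟨u, e, h', hu, he⟩
  ndvd := by
    intro d hd
    obtain ⟨n, f, g, Q, P, h⟩ := StepR_rep S D (stepw S D ^ d)
    have hQ0 := h.of_zdvd hd
    have hpow : ∀ e : ℕ, ∃ n f g P, Rep S D ((stepw S D ^ e : StepR S D) : FractionRing R)
        n f g (D.φ ^ e) P := by
      intro e
      induction e with
      | zero => exact ⟨_, _, _, _, by simpa using Rep_of S D 1⟩
      | succ e ih =>
        obtain ⟨n, f, g, P, ih⟩ := ih
        rw [pow_succ, pow_succ]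
        exact ⟨_, _, _, _, ih.mul (rep_w S D)⟩
    obtain ⟨n', f', g', P', h'⟩ := hpow d
    exact pow_ne_zero d D.irr.ne_zero (h'.of_zdvd hd)

lemma step_mono : ∃ u : StepR S D, (step S D).π u ≠ 0 ∧
    stepι S D S.z = (step S D).z ^ D.b * u ^ D.j ∧ stepι S D S.w = (step S D).z ^ D.a * u ^ D.i := by
  have hX : S.Rho D 1 (S.w ^ (D.b * 1)) (X ^ 1) := Good.Rho_w 1
  have hr := rep_quo S D hX
  refine ⟨⟨_, _, _, _, _, _, hr⟩, (stepπ_ne (F := ⟨_, _, _, _, _, _, hr⟩) hr).2 (D.ndvd_X_pow 1), ?_, ?_⟩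
  all_goals
    apply Subtype.ext
    have hz := S.zK
    have hw := S.wK
    have hij := D.hij
  · show (algebraMap R (FractionRing R)) S.z = ((algebraMap R (FractionRing R)) S.z ^ D.i / (algebraMap R (FractionRing R)) S.w ^ D.j) ^ D.b *
      ((algebraMap R (FractionRing R)) (S.w ^ (D.b * 1)) / (algebraMap R (FractionRing R)) S.z ^ (D.a * 1)) ^ D.j
    rw [map_pow, mul_one, mul_one, div_pow, div_pow, ← pow_mul, ← pow_mul, ← pow_mul, ← pow_mul,
      mul_comm D.i, hij, mul_comm D.j, div_mul_div_comm, eq_div_iff (by positivity), pow_succ]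
    ring
  · show (algebraMap R (FractionRing R)) S.w = ((algebraMap R (FractionRing R)) S.z ^ D.i / (algebraMap R (FractionRing R)) S.w ^ D.j) ^ D.a *
      ((algebraMap R (FractionRing R)) (S.w ^ (D.b * 1)) / (algebraMap R (FractionRing R)) S.z ^ (D.a * 1)) ^ D.i
    rw [map_pow, mul_one, mul_one, div_pow, div_pow, ← pow_mul, ← pow_mul, ← pow_mul, ← pow_mul,
      hij, mul_comm D.i, mul_comm D.j, div_mul_div_comm, eq_div_iff (by positivity), pow_succ]
    ring

/-- quotient `f / z^{an}` as an element of the step ring -/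
noncomputable def quo {n : ℕ} {f : R} {Q : k[X]} (h : S.Rho D n f Q) : StepR S D :=
  ⟨_, _, _, _, _, _, rep_quo S D h⟩

lemma quo_rep {n : ℕ} {f : R} {Q : k[X]} (h : S.Rho D n f Q) :
    Rep S D (quo S D h : FractionRing R) n f (S.z ^ (D.a * n)) Q 1 := rep_quo S D h

lemma quo_eq {n : ℕ} {f : R} {Q : k[X]} (h : S.Rho D n f Q) :
    stepι S D f = stepι S D S.z ^ (D.a * n) * quo S D h := by
  apply Subtype.ext
  show (algebraMap R (FractionRing R)) f = (algebraMap R (FractionRing R)) S.z ^ (D.a * n) * ((algebraMap R (FractionRing R)) f / (algebraMap R (FractionRing R)) S.z ^ (D.a * n))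
  rw [mul_div_cancel₀ _ (pow_ne_zero _ S.zK)]

end
end VT

open scoped ENNReal
set_option linter.unusedSectionVars false

namespace VT
open Polynomial

section
variable {R : Type*} [CommRing R] [IsDomain R] {k : Type*} [Field k] {S : Good R k}

def Slope (ν : CVal S) (D : Dat k) : Prop := (D.b : ℝ≥0∞) * ν.v S.w = D.a * ν.v S.z

def PosP (ν : CVal S) (D : Dat k) (Q : k[X]) : Prop :=
  ∃ n f, S.Rho D n f Q ∧ ((D.a * n : ℕ) : ℝ≥0∞) * ν.v S.z < ν.v f

structure Class (ν : CVal S) (D : Dat k) : Prop where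
  slope : Slope ν D
  iff : ∀ Q, D.φ ∣ Q ↔ PosP ν D Q

lemma Dat.b0 (D : Dat k) : (D.b : ℝ≥0∞) ≠ 0 := by simpa using D.hb.ne'
lemma Dat.a0 (D : Dat k) : (D.a : ℝ≥0∞) ≠ 0 := by simpa using D.ha.ne'

lemma CVal.nz (ν : CVal S) (n : ℕ) : (n : ℝ≥0∞) * ν.v S.z ≠ ⊤ :=
  ENNReal.mul_ne_top (ENNReal.natCast_ne_top _) ν.zfin

variable {ν : CVal S} {D : Dat k}

namespace Slope

lemma w_top (h : Slope ν D) : ν.v S.w ≠ ⊤ := by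
  intro ht
  unfold Slope at h
  rw [ht, ENNReal.mul_top D.b0] at h
  exact ν.nz _ h.symm

lemma ge_of_mem (h : Slope ν D) {N : ℕ} {f : R} (hf : f ∈ S.I (Good.Ge D N)) :
    (N : ℝ≥0∞) * ν.v S.z ≤ D.b * ν.v f := by
  have h1 : ((N : ℝ≥0∞) * ν.v S.z) / D.b ≤ ν.v f := by
    refine ν.le_of_mem ?_ hf
    intro i j hij
    unfold Good.Ge at hij
    apply ENNReal.div_le_of_le_mul
    have e : Good.wt (ν.v S.z) (ν.v S.w) i j * D.b = ((D.b * i + D.a * j : ℕ) : ℝ≥0∞) * ν.v S.z := by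
      unfold Good.wt
      push_cast
      rw [add_mul, add_mul, mul_assoc (j : ℝ≥0∞), mul_comm (ν.v S.w), h]
      ring
    rw [e]
    gcongr
  rw [ENNReal.div_le_iff D.b0 (ENNReal.natCast_ne_top _)] at h1
  rwa [mul_comm (D.b : ℝ≥0∞)]

lemma gt_of_mem (h : Slope ν D) {N : ℕ} {f : R} (hf : f ∈ S.I (Good.Ge D (N + 1))) :
    (N : ℝ≥0∞) * ν.v S.z < D.b * ν.v f := by
  refine lt_of_lt_of_le ?_ (h.ge_of_mem hf)
  push_cast
  rw [add_mul, one_mul]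
  exact ENNReal.lt_add_right (ν.nz _) ν.z0

lemma bmul (n : ℕ) : ((D.a * D.b * n : ℕ) : ℝ≥0∞) * ν.v S.z =
    D.b * (((D.a * n : ℕ) : ℝ≥0∞) * ν.v S.z) := by push_cast; ring

lemma rho_le (h : Slope ν D) {n : ℕ} {f : R} {Q : k[X]} (hf : S.Rho D n f Q) :
    ((D.a * n : ℕ) : ℝ≥0∞) * ν.v S.z ≤ ν.v f := by
  have := h.ge_of_mem hf.mem
  rwa [bmul, ENNReal.mul_le_mul_iff_right D.b0 (ENNReal.natCast_ne_top _)] at this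

lemma rho_lt (h : Slope ν D) {n : ℕ} {f : R} (hf : S.Rho D n f 0) :
    ((D.a * n : ℕ) : ℝ≥0∞) * ν.v S.z < ν.v f := by
  have := h.gt_of_mem hf.mem_of_zero
  rwa [bmul, ENNReal.mul_lt_mul_iff_right D.b0 (ENNReal.natCast_ne_top _)] at this

lemma split (n m : ℕ) : ((D.a * (n + m) : ℕ) : ℝ≥0∞) * ν.v S.z =
    ((D.a * n : ℕ) : ℝ≥0∞) * ν.v S.z + ((D.a * m : ℕ) : ℝ≥0∞) * ν.v S.z := by push_cast; ring

/-- two elements with the same initial form -/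
lemma same (h : Slope ν D) {n : ℕ} {f g : R} {Q : k[X]} (hf : S.Rho D n f Q) (hg : S.Rho D n g Q)
    (hlt : ((D.a * n : ℕ) : ℝ≥0∞) * ν.v S.z < ν.v f) :
    ((D.a * n : ℕ) : ℝ≥0∞) * ν.v S.z < ν.v g := by
  have h1 := hg.sub hf
  rw [sub_self] at h1
  have h2 := h.rho_lt h1
  have h3 := ν.add_ge (g - f) f
  rw [sub_add_cancel] at h3
  exact (lt_min h2 hlt).trans_le h3

lemma up_iff {n m : ℕ} {f : R} :
    ((D.a * (n + m) : ℕ) : ℝ≥0∞) * ν.v S.z < ν.v (f * S.z ^ (D.a * m)) ↔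
      ((D.a * n : ℕ) : ℝ≥0∞) * ν.v S.z < ν.v f := by
  rw [split, ν.map_mul, ν.map_pow, ENNReal.add_lt_add_iff_right (ν.nz _)]

lemma pos_iff (h : Slope ν D) {n : ℕ} {f : R} {Q : k[X]} (hf : S.Rho D n f Q) :
    PosP ν D Q ↔ ((D.a * n : ℕ) : ℝ≥0∞) * ν.v S.z < ν.v f := by
  refine ⟨?_, fun hlt => ⟨n, f, hf, hlt⟩⟩
  rintro ⟨n', f', hf', hlt⟩
  have h1 := hf.mul (Good.Rho_z (S := S) (D := D) n')
  have h2 := hf'.mul (Good.Rho_z (S := S) (D := D) n)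
  rw [add_comm n' n] at h2
  rw [← up_iff (m := n')]
  rw [← up_iff (m := n), add_comm n' n] at hlt
  exact h.same h2 h1 hlt

lemma pos_add (h : Slope ν D) {P Q : k[X]} (hP : PosP ν D P) (hQ : PosP ν D Q) :
    PosP ν D (P + Q) := by
  obtain ⟨f, hf⟩ := Good.Rho_lift (S := S) (D := D) (le_max_left P.natDegree Q.natDegree)
  obtain ⟨g, hg⟩ := Good.Rho_lift (S := S) (D := D) (le_max_right P.natDegree Q.natDegree)
  rw [h.pos_iff hf] at hP
  rw [h.pos_iff hg] at hQ
  exact ⟨_, _, hf.add hg, (lt_min hP hQ).trans_le (ν.add_ge _ _)⟩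

lemma pos_mul (h : Slope ν D) {P : k[X]} (Q : k[X]) (hP : PosP ν D P) :
    PosP ν D (P * Q) := by
  obtain ⟨n, f, hf, hlt⟩ := hP
  obtain ⟨g, hg⟩ := Good.Rho_lift (S := S) (D := D) (le_refl Q.natDegree)
  refine ⟨_, _, hf.mul hg, ?_⟩
  rw [split, ν.map_mul]
  exact ENNReal.add_lt_add_of_lt_of_le (ν.nz _) hlt (h.rho_le hg)

lemma pos_of_mul (h : Slope ν D) {P Q : k[X]} (hPQ : PosP ν D (P * Q)) :
    PosP ν D P ∨ PosP ν D Q := by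
  obtain ⟨f, hf⟩ := Good.Rho_lift (S := S) (D := D) (le_refl P.natDegree)
  obtain ⟨g, hg⟩ := Good.Rho_lift (S := S) (D := D) (le_refl Q.natDegree)
  rw [h.pos_iff hf, h.pos_iff hg]
  rw [h.pos_iff (hf.mul hg), split, ν.map_mul] at hPQ
  by_contra! hcon
  exact absurd hPQ (not_lt.2 (add_le_add hcon.1 hcon.2))

lemma not_pos_one (h : Slope ν D) : ¬ PosP ν D 1 := by
  rw [h.pos_iff (Good.Rho_z 0), ν.map_pow]
  exact lt_irrefl _

lemma not_pos_X (h : Slope ν D) : ¬ PosP ν D X := by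
  have := Good.Rho_w (S := S) (D := D) 1
  rw [pow_one] at this
  rw [h.pos_iff this, ν.map_pow, mul_one, mul_one, h]
  exact lt_irrefl _

lemma pos_zero (h : Slope ν D) : PosP ν D 0 := by
  have : S.Rho D 0 0 0 := Good.Rho_zero_of_mem (Ideal.zero_mem _)
  exact ⟨0, 0, this, h.rho_lt this⟩

lemma cls (h : Slope ν D) (hp : PosP ν D D.φ) : Class ν D := by
  refine ⟨h, fun Q => ⟨?_, ?_⟩⟩
  · rintro ⟨q, rfl⟩
    exact h.pos_mul q hp
  · intro hQ
    by_contra hnd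
    obtain ⟨α, β, hab⟩ := (D.irr.coprime_iff_not_dvd.2 hnd)
    apply h.not_pos_one
    rw [← hab, mul_comm α, mul_comm β]
    exact h.pos_add (h.pos_mul _ hp) (h.pos_mul _ hQ)

end Slope

lemma Class.pos_iff (h : Class ν D) {n : ℕ} {f : R} {Q : k[X]} (hf : S.Rho D n f Q) :
    D.φ ∣ Q ↔ ((D.a * n : ℕ) : ℝ≥0∞) * ν.v S.z < ν.v f := by
  rw [h.iff, h.slope.pos_iff hf]

lemma Class.val_of_ndvd (h : Class ν D) {n : ℕ} {f : R} {Q : k[X]} (hf : S.Rho D n f Q)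
    (hQ : ¬ D.φ ∣ Q) : ν.v f = ((D.a * n : ℕ) : ℝ≥0∞) * ν.v S.z := by
  rw [h.pos_iff hf, not_lt] at hQ
  exact le_antisymm hQ (h.slope.rho_le hf)

lemma Class.phi (h : Class ν D) :
    ((D.a * D.φ.natDegree : ℕ) : ℝ≥0∞) * ν.v S.z < ν.v (Hφ S D) :=
  (h.pos_iff (Rho_φ S D)).1 dvd_rfl

lemma Slope.cls_of_phi (h : Slope ν D)
    (hp : ((D.a * D.φ.natDegree : ℕ) : ℝ≥0∞) * ν.v S.z < ν.v (Hφ S D)) : Class ν D :=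
  h.cls ⟨_, _, Rho_φ S D, hp⟩

lemma Class.not_mono (h : Class ν D) : ν.v ≠ S.mon (ν.v S.z) (ν.v S.w) := by
  intro he
  have h1 := h.phi
  have h2 := (Rho_φ S D).mon_le D.irr.ne_zero h.slope
  rw [← he] at h2
  exact absurd h1 (not_lt.2 h2)

lemma Rho_congr {D D' : Dat k} (ha : D.a = D'.a) (hb : D.b = D'.b) {n : ℕ} {f : R} {Q : k[X]} :
    S.Rho D n f Q ↔ S.Rho D' n f Q := by
  unfold Good.Rho Good.H Good.Ge
  rw [ha, hb]

lemma PosP_congr {D D' : Dat k} (ha : D.a = D'.a) (hb : D.b = D'.b) {Q : k[X]} :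
    PosP ν D Q ↔ PosP ν D' Q := by
  unfold PosP
  simp only [Rho_congr ha hb, ha]

lemma Class.unique {D D' : Dat k} (h : Class ν D) (h' : Class ν D') : D = D' := by
  have h1 := h.slope
  have h2 := h'.slope
  have ht := h.slope.w_top
  have hz := ν.zfin
  have hz0 := ν.z0
  have e : D.a * D'.b = D'.a * D.b := by
    have : ((D.a * D'.b : ℕ) : ℝ≥0∞) * ν.v S.z = ((D'.a * D.b : ℕ) : ℝ≥0∞) * ν.v S.z := by
      push_cast
      calc (D.a : ℝ≥0∞) * D'.b * ν.v S.z = D'.b * (D.a * ν.v S.z) := by ring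
        _ = D.b * (D'.b * ν.v S.w) := by rw [← h1]; ring
        _ = _ := by rw [h2]; ring
    rw [ENNReal.mul_left_inj hz0 hz] at this
    exact_mod_cast this
  have hb : D.b = D'.b := by
    apply Nat.dvd_antisymm
    · exact D.cop.symm.dvd_of_dvd_mul_left (Dvd.intro_left _ e.symm)
    · exact D'.cop.symm.dvd_of_dvd_mul_left (Dvd.intro_left _ e)
  have ha : D.a = D'.a := by
    rw [hb] at e
    exact Nat.eq_of_mul_eq_mul_right D'.hb e
  have hφ : D.φ = D'.φ := by
    apply eq_of_monic_of_associated D.monic D'.monic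
    apply associated_of_dvd_dvd
    · rw [h.iff, PosP_congr ha hb, ← h'.iff]
    · rw [h'.iff, ← PosP_congr ha hb, ← h.iff]
  exact Dat.ext ha hb hφ

end
end VT

open scoped ENNReal
set_option linter.unusedSectionVars false

namespace VT
open Polynomial

section
variable {R : Type*} [CommRing R] [IsDomain R] {k : Type*} [Field k] {S : Good R k}

lemma exact_mon (S : Good R k) (D : Dat k) {W : ℕ} {f : R} (hf : f ∉ S.I (Good.Ge D (W + 1))) :
    S.mon (D.b : ℝ≥0∞) (D.a : ℝ≥0∞) f ≤ W := by
  by_contra hlt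
  rw [not_le] at hlt
  obtain ⟨r, hr1, hr2⟩ := exists_between hlt
  apply hf
  refine S.I_mono ?_ (S.mem_of_lt_mon hr2)
  intro i j hij
  have h1 := hr1.trans_le hij
  have h2 : ((W : ℕ) : ℝ≥0∞) < ((D.b * i + D.a * j : ℕ) : ℝ≥0∞) := by
    refine h1.trans_le (le_of_eq ?_)
    unfold Good.wt; push_cast; ring
  unfold Good.Ge
  exact_mod_cast h2

lemma mon_ge (S : Good R k) (D : Dat k) {W : ℕ} {f : R} (hf : f ∈ S.I (Good.Ge D W)) :
    W ≤ S.mon (D.b : ℝ≥0∞) (D.a : ℝ≥0∞) f := by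
  apply S.le_mon
  refine S.I_mono ?_ hf
  intro i j hij
  unfold Good.Ge at hij
  have h2 : ((W : ℕ) : ℝ≥0∞) ≤ ((D.b * i + D.a * j : ℕ) : ℝ≥0∞) := by exact_mod_cast hij
  refine h2.trans (le_of_eq ?_)
  unfold Good.wt; push_cast; ring

lemma exact_exists (S : Good R k) (D : Dat k) {f : R} (hf : f ≠ 0) :
    ∃ W, f ∈ S.I (Good.Ge D W) ∧ f ∉ S.I (Good.Ge D (W + 1)) := by
  have hex : ∃ N, f ∉ S.I (Good.Ge D N) := by
    obtain ⟨N, hN⟩ := ENNReal.exists_nat_gt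
      (S.mon_ne_top D.b0 (ENNReal.natCast_ne_top _) (ENNReal.natCast_ne_top D.a) hf)
    exact ⟨N, fun h => absurd hN (not_lt.2 (mon_ge S D h))⟩
  classical
  have h1 := Nat.find_spec hex
  have h0 : Nat.find hex ≠ 0 := by
    intro h
    rw [h] at h1
    exact h1 (S.Ge_zero D f)
  obtain ⟨W, hW⟩ := Nat.exists_eq_succ_of_ne_zero h0
  refine ⟨W, ?_, by rw [hW] at h1; exact h1⟩
  by_contra hcon
  exact Nat.find_min hex (m := W) (by omega) hcon

lemma norm_exists (S : Good R k) (D : Dat k) {W : ℕ} {f : R} (hf : f ∈ S.I (Good.Ge D W))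
    (hf' : f ∉ S.I (Good.Ge D (W + 1))) :
    ∃ p q n Q, q < D.b ∧ D.b * p + D.a * q + W = D.a * D.b * n ∧
      S.Rho D n (S.z ^ p * S.w ^ q * f) Q ∧ Q ≠ 0 := by
  obtain ⟨q, hq, s, hs⟩ : ∃ q, q < D.b ∧ ∃ s, D.a * q + W = D.b * s := by
    have hb := D.hb
    -- multiply by inverse of a mod b : a * j = -1 mod b
    have hij := D.hij
    refine ⟨(D.j * W) % D.b, Nat.mod_lt _ hb, ?_⟩
    have h1 := Nat.div_add_mod (D.j * W) D.b
    have hle : D.a * (D.j * W / D.b) ≤ D.i * W := by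
      have h2 : D.b * (D.a * (D.j * W / D.b)) ≤ D.b * (D.i * W) := by
        calc D.b * (D.a * (D.j * W / D.b)) = D.a * (D.b * (D.j * W / D.b)) := by ring
          _ ≤ D.a * (D.j * W) := Nat.mul_le_mul_left _ (Nat.mul_div_le _ _)
          _ ≤ (D.a * D.j + 1) * W := by rw [add_mul]; nlinarith
          _ = _ := by rw [← hij]; ring
      exact Nat.le_of_mul_le_mul_left h2 hb
    refine ⟨D.i * W - D.a * (D.j * W / D.b), ?_⟩
    zify [hle]
    zify at h1 hij
    linear_combination (D.a : ℤ) * h1 - (W : ℤ) * hij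
  obtain ⟨a', ha'⟩ := Nat.exists_eq_succ_of_ne_zero D.ha.ne'
  have hW : D.b * (a' * s) + D.a * q + W = D.a * D.b * s := by
    rw [add_assoc, hs, ha', Nat.succ_eq_add_one]; ring
  have hm : S.z ^ (a' * s) * S.w ^ q * f ∈ S.I (Good.Ge D (D.a * D.b * s)) := by
    rw [← hW]
    exact S.Ge_mul D (S.mono_mem (by unfold Good.Ge; exact le_rfl)) hf
  obtain ⟨Q, hQ⟩ := Good.Rho_exists hm
  refine ⟨a' * s, q, s, Q, hq, hW, hQ, ?_⟩
  rintro rfl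
  have h1 := mon_ge S D hQ.mem_of_zero
  rw [S.mon_mul D.b0 (ENNReal.natCast_ne_top _), S.mon_monom, ← hW] at h1
  have h2 : ((D.b * (a' * s) + D.a * q + W + 1 : ℕ) : ℝ≥0∞) ≤ ((D.b * (a' * s) + D.a * q + W : ℕ) : ℝ≥0∞) := by
    refine (h1.trans (add_le_add_right (exact_mon S D hf') _)).trans (le_of_eq ?_)
    unfold Good.wt; push_cast; ring
  have h3 : D.b * (a' * s) + D.a * q + W + 1 ≤ D.b * (a' * s) + D.a * q + W := by exact_mod_cast h2
  omega

/-- value of the normalised element -/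
lemma Slope.norm_val {ν : CVal S} {D : Dat k} (h : Slope ν D) {p q n W : ℕ} (f : R)
    (hW : D.b * p + D.a * q + W = D.a * D.b * n) :
    D.b * ν.v (S.z ^ p * S.w ^ q * f) + W * ν.v S.z =
      D.b * (((D.a * n : ℕ) : ℝ≥0∞) * ν.v S.z) + D.b * ν.v f := by
  rw [← Slope.bmul, ← hW, ν.map_mul, ν.monom]
  unfold Good.wt
  push_cast
  rw [mul_add, mul_add, ← mul_assoc _ (q : ℝ≥0∞), mul_comm _ (q : ℝ≥0∞), mul_assoc (q : ℝ≥0∞), h]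
  ring

lemma slope_exists (ν : CVal S) (hne : ν.v ≠ S.mon (ν.v S.z) (ν.v S.w)) :
    ∃ a b : ℕ, 0 < a ∧ 0 < b ∧ Nat.Coprime a b ∧ (b : ℝ≥0∞) * ν.v S.w = a * ν.v S.z := by
  obtain ⟨f, hf⟩ : ∃ f, S.mon (ν.v S.z) (ν.v S.w) f < ν.v f := by
    by_contra! hcon
    exact hne (funext fun f => le_antisymm (hcon f) (ν.mon_le f))
  rcases S.mon_cases (t := ν.v S.w) ν.z0 ν.zfin f with htop | ⟨u, i, j, hL, hfin⟩
  · rw [htop] at hf; exact absurd hf not_top_lt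
  rw [S.mon_of_lead hL] at hf
  obtain ⟨i', j', hi, heq⟩ : ∃ i' j', i < i' ∧
      Good.wt (ν.v S.z) (ν.v S.w) i j = Good.wt (ν.v S.z) (ν.v S.w) i' j' := by
    by_contra! hcon
    have h1 := ν.lt_of_mem hfin (U := Good.LeadU (ν.v S.z) (ν.v S.w) i j) (by
      rintro i' j' (h | ⟨h, h'⟩)
      · exact h
      · exact lt_of_le_of_ne h (hcon i' j' h')) hL.2
    have h2 : ν.v (u * (S.z ^ i * S.w ^ j)) = Good.wt (ν.v S.z) (ν.v S.w) i j := by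
      rw [ν.map_mul, ν.unit hL.1, zero_add, ν.monom]
    rw [← h2] at h1
    have h3 := ν.add_eq h1
    rw [add_sub_cancel, h2] at h3
    rw [h3] at hf
    exact lt_irrefl _ hf
  have ht : ν.v S.w ≠ ⊤ := by
    intro ht
    have hj : ∀ {i j : ℕ}, Good.wt (ν.v S.z) (ν.v S.w) i j ≠ ⊤ → j = 0 := by
      intro i j h
      by_contra hj
      apply h
      unfold Good.wt
      rw [ht, ENNReal.mul_top (by simpa using hj), add_top]
    have h1 := hj hfin
    have h2 := hj (heq ▸ hfin)
    subst h1 h2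
    unfold Good.wt at heq
    simp only [Nat.cast_zero, zero_mul, add_zero] at heq
    rw [ENNReal.mul_left_inj ν.z0 ν.zfin] at heq
    have : i = i' := by exact_mod_cast heq
    omega
  -- transfer to real numbers
  have hc0 : 0 < (ν.v S.z).toReal := ENNReal.toReal_pos ν.z0 ν.zfin
  have ht0 : 0 < (ν.v S.w).toReal := ENNReal.toReal_pos ν.w0 ht
  have hr := congrArg ENNReal.toReal heq
  unfold Good.wt at hr
  rw [ENNReal.toReal_add (ν.nz _) (ENNReal.mul_ne_top (ENNReal.natCast_ne_top _) ht),
    ENNReal.toReal_add (ν.nz _) (ENNReal.mul_ne_top (ENNReal.natCast_ne_top _) ht)] at hr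
  simp only [ENNReal.toReal_mul, ENNReal.toReal_natCast] at hr
  have hi' : (i : ℝ) < i' := by exact_mod_cast hi
  have hj : (j' : ℝ) < j := by
    by_contra hcon
    rw [not_lt] at hcon
    nlinarith
  have hj' : j' < j := by exact_mod_cast hj
  obtain ⟨x, hx⟩ := Nat.exists_eq_add_of_lt hi
  obtain ⟨y, hy⟩ := Nat.exists_eq_add_of_lt hj'
  have hxy : ((y + 1 : ℕ) : ℝ) * (ν.v S.w).toReal = ((x + 1 : ℕ) : ℝ) * (ν.v S.z).toReal := by
    rw [hx, hy] at hr
    push_cast at hr ⊢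
    linarith
  obtain ⟨a, b, hcop, ha, hb⟩ := Nat.exists_coprime (x + 1) (y + 1)
  have hg : 0 < Nat.gcd (x + 1) (y + 1) := Nat.gcd_pos_of_pos_left _ (Nat.succ_pos _)
  generalize Nat.gcd (x + 1) (y + 1) = g at ha hb hg
  refine ⟨a, b, ?_, ?_, hcop, ?_⟩
  · rcases Nat.eq_zero_or_pos a with rfl | h
    · simp at ha
    · exact h
  · rcases Nat.eq_zero_or_pos b with rfl | h
    · simp at hb
    · exact h
  · rw [ha, hb] at hxy
    push_cast at hxy
    have hg' : (g : ℝ) ≠ 0 := by exact_mod_cast hg.ne'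
    have h5 : (b : ℝ) * (ν.v S.w).toReal = a * (ν.v S.z).toReal := by
      apply mul_left_cancel₀ hg'
      linarith
    rw [← ENNReal.toReal_eq_toReal_iff' (ENNReal.mul_ne_top (ENNReal.natCast_ne_top _) ht) (ν.nz _)]
    simpa using h5

lemma class_exists (ν : CVal S) (hne : ν.v ≠ S.mon (ν.v S.z) (ν.v S.w)) : ∃ D, Class ν D := by
  obtain ⟨a, b, ha, hb, hcop, hsl⟩ := slope_exists ν hne
  have hne1 : (X - C 1 : k[X]) ≠ X := by
    intro h
    have := congrArg (fun p => coeff p 0) h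
    simp at this
  let D0 : Dat k := ⟨a, b, X - C 1, ha, hb, hcop, monic_X_sub_C 1, irreducible_X_sub_C 1, hne1⟩
  have hs : Slope ν D0 := hsl
  obtain ⟨f, hf⟩ : ∃ f, S.mon (ν.v S.z) (ν.v S.w) f < ν.v f := by
    by_contra! hcon
    exact hne (funext fun f => le_antisymm (hcon f) (ν.mon_le f))
  have hf0 : f ≠ 0 := by
    rintro rfl
    have := (Mono S _ _ ν.z0 ν.zfin ν.w0).map_zero
    rw [show S.mon (ν.v S.z) (ν.v S.w) 0 = ⊤ from this] at hf
    exact absurd hf not_top_lt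
  obtain ⟨W, hW1, hW2⟩ := exact_exists S D0 hf0
  obtain ⟨p, q, n, Q, -, hW, hQ, hQ0⟩ := norm_exists S D0 hW1 hW2
  have hpos : PosP ν D0 Q := by
    refine ⟨n, _, hQ, ?_⟩
    have h1 := hs.norm_val f hW
    have hsm : Slope (Mono S _ _ ν.z0 ν.zfin ν.w0) D0 := by
      unfold Slope; rw [Mono_z, Mono_w]; exact hsl
    have h2 := hsm.ge_of_mem hW1
    rw [Mono_z] at h2
    have h3 : (W : ℝ≥0∞) * ν.v S.z < D0.b * ν.v f := by
      refine lt_of_le_of_lt h2 ?_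
      exact (ENNReal.mul_lt_mul_iff_right D0.b0 (ENNReal.natCast_ne_top _)).2 hf
    rw [← ENNReal.mul_lt_mul_iff_right D0.b0 (ENNReal.natCast_ne_top _)]
    by_contra hcon
    rw [not_lt] at hcon
    have h4 : (D0.b : ℝ≥0∞) * (((D0.a * n : ℕ) : ℝ≥0∞) * ν.v S.z) ≠ ⊤ :=
      ENNReal.mul_ne_top (ENNReal.natCast_ne_top _) (ν.nz _)
    have h5 : (D0.b : ℝ≥0∞) * (((D0.a * n : ℕ) : ℝ≥0∞) * ν.v S.z) + (W : ℝ≥0∞) * ν.v S.z <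
        (D0.b : ℝ≥0∞) * (((D0.a * n : ℕ) : ℝ≥0∞) * ν.v S.z) + D0.b * ν.v f :=
      (ENNReal.add_lt_add_iff_left h4).2 h3
    rw [← h1] at h5
    exact absurd h5 (not_lt.2 (add_le_add_left hcon _))
  have key : ∀ Q : k[X], Q ≠ 0 → PosP ν D0 Q → ∃ p, Irreducible p ∧ PosP ν D0 p := by
    intro Q
    refine WfDvdMonoid.induction_on_irreducible Q (fun h => absurd rfl h) ?_ ?_
    · intro u hu _ hp
      obtain ⟨x, hx⟩ := hu.exists_right_inv
      have := hs.pos_mul x hp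
      rw [hx] at this
      exact absurd this hs.not_pos_one
    · intro a i ha hi ih _ hp
      rcases hs.pos_of_mul hp with h | h
      · exact ⟨i, hi, h⟩
      · exact ih ha h
  obtain ⟨p, hp, hpp⟩ := key Q hQ0 hpos
  have hφ := hs.pos_mul (C p.leadingCoeff⁻¹) hpp
  have hlc : p.leadingCoeff⁻¹ ≠ 0 := inv_ne_zero (leadingCoeff_ne_zero.2 hp.ne_zero)
  have hirr : Irreducible (p * C p.leadingCoeff⁻¹) := by
    have hu : IsUnit (C p.leadingCoeff⁻¹) := isUnit_C.2 (isUnit_iff_ne_zero.2 hlc)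
    exact (irreducible_mul_isUnit hu).2 hp
  have hX : p * C p.leadingCoeff⁻¹ ≠ X := by
    intro h
    rw [h] at hφ
    exact hs.not_pos_X hφ
  let D : Dat k := ⟨a, b, p * C p.leadingCoeff⁻¹, ha, hb, hcop,
    monic_mul_leadingCoeff_inv hp.ne_zero, hirr, hX⟩
  have hs' : Slope ν D := hsl
  refine ⟨D, hs'.cls ?_⟩
  exact (PosP_congr (ν := ν) (D := D0) (D' := D) rfl rfl).1 hφ

end
end VT

open scoped ENNReal
set_option linter.unusedSectionVars false

namespace VT
open Polynomial

section
variable {R : Type*} [CommRing R] [IsDomain R] {k : Type*} [Field k] {S : Good R k}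
  {ν : CVal S} {D : Dat k}

noncomputable def pushFun (ν : CVal S) (D : Dat k) (F : StepR S D) : ℝ≥0∞ :=
  ν.v (StepR_rep S D F).choose_spec.choose -
    ((D.a * (StepR_rep S D F).choose : ℕ) : ℝ≥0∞) * ν.v S.z

lemma pushFun_rep (h : Class ν D) {F : StepR S D} {n : ℕ} {f g : R} {Q P : k[X]}
    (hr : Rep S D (F : FractionRing R) n f g Q P) :
    pushFun ν D F + ((D.a * n : ℕ) : ℝ≥0∞) * ν.v S.z = ν.v f := by
  have h' := (StepR_rep S D F).choose_spec.choose_spec.choose_spec.choose_spec.choose_spec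
  unfold pushFun
  generalize (StepR_rep S D F).choose_spec.choose_spec.choose_spec.choose_spec.choose = P' at h'
  generalize (StepR_rep S D F).choose_spec.choose_spec.choose_spec.choose = Q' at h'
  generalize (StepR_rep S D F).choose_spec.choose_spec.choose = g' at h'
  generalize (StepR_rep S D F).choose_spec.choose = f' at h' ⊢
  generalize (StepR_rep S D F).choose = n' at h' ⊢
  have e := congrArg ν.v (hr.cross h')
  rw [ν.map_mul, ν.map_mul, h.val_of_ndvd h'.den h'.nd, h.val_of_ndvd hr.den hr.nd] at e
  have hle := h.slope.rho_le h'.num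
  have e2 : ν.v f' - ((D.a * n' : ℕ) : ℝ≥0∞) * ν.v S.z + ((D.a * n : ℕ) : ℝ≥0∞) * ν.v S.z +
      ((D.a * n' : ℕ) : ℝ≥0∞) * ν.v S.z = ν.v f + ((D.a * n' : ℕ) : ℝ≥0∞) * ν.v S.z := by
    rw [e, add_right_comm, tsub_add_cancel_of_le hle]
  exact (ENNReal.add_left_inj (ν.nz _)).1 e2

noncomputable def push (ν : CVal S) (D : Dat k) (h : Class ν D) : CVal (step S D) where
  v := pushFun ν D
  map_mul := by
    intro F F'
    obtain ⟨n, f, g, Q, P, hr⟩ := StepR_rep S D F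
    obtain ⟨n', f', g', Q', P', hr'⟩ := StepR_rep S D F'
    have h1 := pushFun_rep h (F := F * F') (hr.mul hr')
    rw [ν.map_mul, ← pushFun_rep h hr, ← pushFun_rep h hr', Slope.split] at h1
    have h2 : pushFun ν D (F * F') + (((D.a * n : ℕ) : ℝ≥0∞) * ν.v S.z +
        ((D.a * n' : ℕ) : ℝ≥0∞) * ν.v S.z) = (pushFun ν D F + pushFun ν D F') +
        (((D.a * n : ℕ) : ℝ≥0∞) * ν.v S.z + ((D.a * n' : ℕ) : ℝ≥0∞) * ν.v S.z) := by
      rw [h1]; ring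
    exact (ENNReal.add_left_inj (ENNReal.add_ne_top.2 ⟨ν.nz _, ν.nz _⟩)).1 h2
  add_ge := by
    intro F F'
    obtain ⟨n, f, g, Q, P, hr⟩ := StepR_rep S D F
    obtain ⟨n', f', g', Q', P', hr'⟩ := StepR_rep S D F'
    have h1 := pushFun_rep h (F := F + F') (hr.add hr')
    have h2 := ν.add_ge (f * g') (g * f')
    rw [← h1, ν.map_mul, ν.map_mul, h.val_of_ndvd hr.den hr.nd, h.val_of_ndvd hr'.den hr'.nd,
      ← pushFun_rep h hr, ← pushFun_rep h hr', Slope.split, add_assoc,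
      add_comm (((D.a * n : ℕ) : ℝ≥0∞) * ν.v S.z) (_ + _), add_assoc,
      add_comm (((D.a * n' : ℕ) : ℝ≥0∞) * ν.v S.z) (((D.a * n : ℕ) : ℝ≥0∞) * ν.v S.z),
      min_add_add_right] at h2
    exact (ENNReal.add_le_add_iff_right (ENNReal.add_ne_top.2 ⟨ν.nz _, ν.nz _⟩)).1 h2
  map_one := by
    have h1 := pushFun_rep h (F := 1) (n := 0) (f := 1) (g := 1) (Q := C (S.π 1)) (P := 1)
      (by simpa using Rep_of S D 1)
    simpa [ν.map_one] using h1
  pos := by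
    intro F hF h0
    obtain ⟨n, f, g, Q, P, hr⟩ := StepR_rep S D F
    have h1 := pushFun_rep h hr
    have h2 : D.φ ∣ Q := by
      by_contra hcon
      exact (stepπ_ne hr).2 hcon hF
    rw [h.pos_iff hr.num, ← h1, h0, zero_add] at h2
    exact lt_irrefl _ h2
  zfin := by
    intro h0
    have h1 := pushFun_rep h (F := stepz S D) (rep_z S D)
    rw [show pushFun ν D (stepz S D) = ⊤ from h0, top_add, ν.monom] at h1
    unfold Good.wt at h1
    exact ENNReal.add_ne_top.2 ⟨ν.nz _, ENNReal.mul_ne_top (ENNReal.natCast_ne_top _) h.slope.w_top⟩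
      h1.symm

lemma push_rep (h : Class ν D) {F : StepR S D} {n : ℕ} {f g : R} {Q P : k[X]}
    (hr : Rep S D (F : FractionRing R) n f g Q P) :
    (push ν D h).v F + ((D.a * n : ℕ) : ℝ≥0∞) * ν.v S.z = ν.v f := pushFun_rep h hr

lemma push_ι (h : Class ν D) (f : R) : (push ν D h).v (stepι S D f) = ν.v f := by
  have := push_rep h (F := stepι S D f) (Rep_of S D f)
  simpa using this

noncomputable def pull (D : Dat k) (ν' : CVal (step S D)) : CVal S where
  v := fun f => ν'.v (stepι S D f)
  map_mul := by intro f g; rw [map_mul, ν'.map_mul]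
  add_ge := by intro f g; rw [map_add]; exact ν'.add_ge _ _
  map_one := by rw [map_one, ν'.map_one]
  pos := by
    intro f hf
    exact ν'.pos _ (stepπ_ι S D hf)
  zfin := by
    obtain ⟨u, hu, hz, hw⟩ := step_mono S D
    rw [hz, ν'.map_mul, ν'.map_pow, ν'.map_pow, ν'.unit hu, mul_zero, add_zero]
    exact ν'.nz _

lemma pull_v (ν' : CVal (step S D)) (f : R) : (pull D ν').v f = ν'.v (stepι S D f) := rfl

lemma pull_z (ν' : CVal (step S D)) : (pull D ν').v S.z = D.b * ν'.v (step S D).z := by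
  obtain ⟨u, hu, hz, hw⟩ := step_mono S D
  rw [pull_v, hz, ν'.map_mul, ν'.map_pow, ν'.map_pow, ν'.unit hu, mul_zero, add_zero]

lemma pull_w (ν' : CVal (step S D)) : (pull D ν').v S.w = D.a * ν'.v (step S D).z := by
  obtain ⟨u, hu, hz, hw⟩ := step_mono S D
  rw [pull_v, hw, ν'.map_mul, ν'.map_pow, ν'.map_pow, ν'.unit hu, mul_zero, add_zero]

lemma pull_class (ν' : CVal (step S D)) : Class (pull D ν') D := by
  have hs : Slope (pull D ν') D := by
    unfold Slope
    rw [pull_z, pull_w]; ring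
  apply hs.cls_of_phi
  have h1 := quo_eq S D (Rho_φ S D)
  have h2 : quo S D (Rho_φ S D) = (step S D).w := rfl
  rw [pull_v _ (Hφ S D), h1, ν'.map_mul, ν'.map_pow, h2]
  exact ENNReal.lt_add_right ((pull D ν').nz _) ν'.w0

lemma pull_push (h : Class ν D) : pull D (push ν D h) = ν := by
  apply CVal.ext
  funext f
  rw [pull_v, push_ι]

lemma push_pull (ν' : CVal (step S D)) (h : Class (pull D ν') D) : push (pull D ν') D h = ν' := by
  apply CVal.ext
  funext F
  obtain ⟨n, f, g, Q, P, hr⟩ := StepR_rep S D F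
  have h1 := push_rep h hr
  have h2 : stepι S D f = F * stepι S D g := Subtype.ext hr.eq.symm
  rw [pull_v _ f, h2, ν'.map_mul, ← pull_v _ g, h.val_of_ndvd hr.den hr.nd] at h1
  exact (ENNReal.add_left_inj ((pull D ν').nz _)).1 h1

lemma push_z (h : Class ν D) : ν.v S.z = D.b * (push ν D h).v (step S D).z := by
  rw [← pull_z, pull_push]

lemma push_mono {μ : CVal S} (h : Class ν D) (h' : Class μ D) (hz : μ.v S.z = ν.v S.z)
    (hle : ∀ f, μ.v f ≤ ν.v f) (F : StepR S D) : (push μ D h').v F ≤ (push ν D h).v F := by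
  obtain ⟨n, f, g, Q, P, hr⟩ := StepR_rep S D F
  have h1 := push_rep h hr
  have h2 := push_rep h' hr
  have h3 := hle f
  rw [← h1, ← h2, hz] at h3
  exact (ENNReal.add_le_add_iff_right (ν.nz _)).1 h3

/-- a class is inherited by larger valuations -/
lemma Class.of_le {μ : CVal S} (h : Class μ D) (hz : μ.v S.z = ν.v S.z)
    (hle : ∀ f, μ.v f ≤ ν.v f) : Class ν D := by
  have hlt : ((D.a * D.φ.natDegree : ℕ) : ℝ≥0∞) * ν.v S.z < ν.v (Hφ S D) := by
    rw [← hz]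
    exact h.phi.trans_le (hle _)
  have hw : μ.v S.w = ν.v S.w := by
    by_contra hne
    have hww : μ.v S.w < ν.v S.w := lt_of_le_of_ne (hle _) hne
    set d := D.φ.natDegree with hd
    set q := lphi S D with hq
    have hsum : Hφ S D = q.coeff 0 * S.z ^ (D.a * d) +
        ∑ l ∈ Finset.range d, q.coeff (l + 1) * (S.z ^ (D.a * (d - (l + 1))) * S.w ^ (D.b * (l + 1))) := by
      unfold Hφ Good.H
      rw [Finset.sum_range_succ', add_comm]
      simp [hd, hq]
    have hu : S.π (q.coeff 0) ≠ 0 := by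
      rw [← coeff_map, hq, lphi_map]
      exact D.φ0
    have h1 : ν.v (q.coeff 0 * S.z ^ (D.a * d)) = ((D.a * d : ℕ) : ℝ≥0∞) * ν.v S.z := by
      rw [ν.map_mul, ν.unit hu, zero_add, ν.map_pow]
    have h2 : ((D.a * d : ℕ) : ℝ≥0∞) * ν.v S.z <
        ν.v (∑ l ∈ Finset.range d, q.coeff (l + 1) * (S.z ^ (D.a * (d - (l + 1))) * S.w ^ (D.b * (l + 1)))) := by
      refine Finset.sum_induction _ (fun x => ((D.a * d : ℕ) : ℝ≥0∞) * ν.v S.z < ν.v x) ?_ ?_ ?_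
      · intro x y hx hy
        exact (lt_min hx hy).trans_le (ν.add_ge _ _)
      · rw [ν.map_zero]
        exact (ν.nz _).lt_top
      · intro l hl
        have hl' : l + 1 ≤ d := by have := Finset.mem_range.1 hl; omega
        refine lt_of_lt_of_le ?_ (ν.mul_ge _ _)
        rw [ν.monom]
        unfold Good.wt
        obtain ⟨m, hm⟩ := Nat.exists_eq_add_of_le hl'
        have hm' : d - (l + 1) = m := by omega
        rw [hm', hm, add_comm (l + 1) m, Slope.split, ENNReal.add_lt_add_iff_left (ν.nz _)]
        have e : ((D.a * (l + 1) : ℕ) : ℝ≥0∞) * ν.v S.z = ((D.b * (l + 1) : ℕ) : ℝ≥0∞) * μ.v S.w := by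
          have := h.slope
          unfold Slope at this
          push_cast
          rw [mul_comm (D.b : ℝ≥0∞), mul_assoc ((l : ℝ≥0∞) + 1), this, hz]; ring
        rw [e]
        refine (ENNReal.mul_lt_mul_iff_right ?_ (ENNReal.natCast_ne_top _)).2 hww
        have := D.hb
        have : D.b * (l + 1) ≠ 0 := by positivity
        exact_mod_cast this
    rw [← h1] at h2
    have h3 := ν.add_eq h2
    rw [← hsum, h1] at h3
    rw [h3] at hlt
    exact lt_irrefl _ hlt
  have hs : Slope ν D := by
    have := h.slope
    unfold Slope at this ⊢
    rwa [hz, hw] at this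
  exact hs.cls_of_phi hlt

end
end VT

open scoped ENNReal
set_option linter.unusedSectionVars false

namespace VT
open Polynomial

universe u v w x

lemma push_w {R : Type*} [CommRing R] [IsDomain R] {k : Type*} [Field k] {S : Good R k}
    {ν : CVal S} {D : Dat k} (h : Class ν D) : ν.v S.w = D.a * (push ν D h).v (step S D).z := by
  rw [← pull_w, pull_push]

noncomputable def Mo {R : Type*} [CommRing R] [IsDomain R] {R' : Type*} [CommRing R'] [IsDomain R']
    {k : Type*} [Field k] {S : Good R k} (S' : Good R' k) (ν : CVal S) : CVal S' :=
  Mono S' (ν.v S.z) (ν.v S.w) ν.z0 ν.zfin ν.w0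

open Classical in
noncomputable def e : ℕ → ∀ {R : Type u} [CommRing R] [IsDomain R] {R' : Type v} [CommRing R']
    [IsDomain R'] {k : Type w} [Field k] (S : Good R k) (S' : Good R' k), CVal S → CVal S'
  | 0, _, _, _, _, _, _, _, _, _, S', ν => Mo S' ν
  | n + 1, _, _, _, _, _, _, _, _, S, S', ν =>
    if h : ∃ D, Class ν D then
      pull h.choose (e n (step S h.choose) (step S' h.choose) (push ν h.choose h.choose_spec))
    else Mo S' ν

section
variable {R : Type u} [CommRing R] [IsDomain R] {R' : Type v} [CommRing R'] [IsDomain R']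
  {k : Type w} [Field k] {S : Good R k} {S' : Good R' k} {ν : CVal S} {D : Dat k}

lemma Mo_z : (Mo S' ν).v S'.z = ν.v S.z := Mono_z _ _ _ _ _ _
lemma Mo_w : (Mo S' ν).v S'.w = ν.v S.w := Mono_w _ _ _ _ _ _

lemma Mo_le {μ : CVal S'} (hz : ν.v S.z ≤ μ.v S'.z) (hw : ν.v S.w ≤ μ.v S'.w) (f : R') :
    (Mo S' ν).v f ≤ μ.v f := μ.mon_le' hz hw f

lemma Mo_self (h : ¬ ∃ D, Class ν D) : Mo S ν = ν := by
  apply CVal.ext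
  by_contra hne
  exact h (class_exists ν (fun h' => hne h'.symm))

lemma Mo_not_class : ¬ ∃ D, Class (Mo S' ν) D := by
  rintro ⟨D, h⟩
  apply h.not_mono
  rw [Mo_z, Mo_w]
  rfl

lemma Mo_congr {R'' : Type*} [CommRing R''] [IsDomain R''] {S'' : Good R'' k} {μ : CVal S''}
    (hz : ν.v S.z = μ.v S''.z) (hw : ν.v S.w = μ.v S''.w) : Mo S' ν = Mo S' μ := by
  apply CVal.ext
  show S'.mon _ _ = S'.mon _ _
  rw [hz, hw]

lemma e_zero : e 0 S S' ν = Mo S' ν := rfl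

lemma e_class (n : ℕ) (h : Class ν D) :
    e (n + 1) S S' ν = pull D (e n (step S D) (step S' D) (push ν D h)) := by
  have hex : ∃ D, Class ν D := ⟨D, h⟩
  rw [e, dif_pos hex]
  have key : ∀ D' (h' : Class ν D'), pull D' (e n (step S D') (step S' D') (push ν D' h')) =
      pull D (e n (step S D) (step S' D) (push ν D h)) := by
    intro D' h'
    obtain rfl := h.unique h'
    rfl
  exact key _ _

lemma e_not (n : ℕ) (h : ¬ ∃ D, Class ν D) : e n S S' ν = Mo S' ν := by
  cases n with
  | zero => rfl
  | succ n => rw [e, dif_neg h]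

end

lemma e_zw (n : ℕ) : ∀ {R : Type u} [CommRing R] [IsDomain R] {R' : Type v} [CommRing R']
    [IsDomain R'] {k : Type w} [Field k] (S : Good R k) (S' : Good R' k) (ν : CVal S),
    (e n S S' ν).v S'.z = ν.v S.z ∧ (e n S S' ν).v S'.w = ν.v S.w := by
  induction n with
  | zero => intros; exact ⟨Mo_z, Mo_w⟩
  | succ n ih =>
    intro R _ _ R' _ _ k _ S S' ν
    by_cases h : ∃ D, Class ν D
    · obtain ⟨D, h⟩ := h
      rw [e_class n h, pull_z, pull_w, (ih _ _ _).1, push_z h, push_w h]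
      exact ⟨rfl, rfl⟩
    · rw [e_not _ h]; exact ⟨Mo_z, Mo_w⟩

lemma e_step (n : ℕ) : ∀ {R : Type u} [CommRing R] [IsDomain R] {R' : Type v} [CommRing R']
    [IsDomain R'] {k : Type w} [Field k] (S : Good R k) (S' : Good R' k) (ν : CVal S) (f : R'),
    (e n S S' ν).v f ≤ (e (n + 1) S S' ν).v f := by
  induction n with
  | zero =>
    intro R _ _ R' _ _ k _ S S' ν f
    exact Mo_le (e_zw _ S S' ν).1.ge (e_zw _ S S' ν).2.ge f
  | succ n ih =>
    intro R _ _ R' _ _ k _ S S' ν f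
    by_cases h : ∃ D, Class ν D
    · obtain ⟨D, h⟩ := h
      rw [e_class n h, e_class (n + 1) h, pull_v, pull_v]
      exact ih _ _ _ _
    · rw [e_not _ h, e_not _ h]

lemma e_mono (n : ℕ) : ∀ {R : Type u} [CommRing R] [IsDomain R] {R' : Type v} [CommRing R']
    [IsDomain R'] {k : Type w} [Field k] (S : Good R k) (S' : Good R' k) (μ ν : CVal S)
    (_ : μ.v S.z = ν.v S.z) (_ : ∀ f, μ.v f ≤ ν.v f) (f : R'),
    (e n S S' μ).v f ≤ (e n S S' ν).v f := by
  induction n with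
  | zero =>
    intro R _ _ R' _ _ k _ S S' μ ν hz hle f
    exact Mo_le (hz.le.trans Mo_z.ge) ((hle _).trans Mo_w.ge) f
  | succ n ih =>
    intro R _ _ R' _ _ k _ S S' μ ν hz hle f
    by_cases h : ∃ D, Class μ D
    · obtain ⟨D, h⟩ := h
      have h' := h.of_le hz hle
      rw [e_class n h, e_class n h', pull_v, pull_v]
      refine ih _ _ _ _ ?_ (push_mono h' h hz hle) _
      rw [push_z h, push_z h'] at hz
      exact (ENNReal.mul_right_inj D.b0 (ENNReal.natCast_ne_top _)).1 hz
    · rw [e_not _ h]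
      exact Mo_le (hz.le.trans (e_zw _ S S' ν).1.ge) ((hle _).trans (e_zw _ S S' ν).2.ge) f

section
variable {R : Type u} [CommRing R] [IsDomain R] {R' : Type v} [CommRing R'] [IsDomain R']
  {k : Type w} [Field k] (S : Good R k) (S' : Good R' k) (ν : CVal S)

lemma e_monotone (f : R') : Monotone (fun n => (e n S S' ν).v f) :=
  monotone_nat_of_le_succ fun n => e_step n S S' ν f

noncomputable def E : CVal S' where
  v := fun f => ⨆ n, (e n S S' ν).v f
  map_mul := by
    intro f g
    rw [ENNReal.iSup_add_iSup_of_monotone (e_monotone S S' ν f) (e_monotone S S' ν g)]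
    simp only [(e _ S S' ν).map_mul]
  add_ge := by
    intro f g
    have h := iSup_inf_of_monotone (e_monotone S S' ν f) (e_monotone S S' ν g)
    refine (le_of_eq h.symm).trans ?_
    exact iSup_mono fun n => (e n S S' ν).add_ge f g
  map_one := by simp only [(e _ S S' ν).map_one, ciSup_const]
  pos := by
    intro f hf h0
    rw [ENNReal.iSup_eq_zero] at h0
    exact (e 0 S S' ν).pos f hf (h0 0)
  zfin := by
    simp only [(e_zw _ S S' ν).1, ciSup_const]
    exact ν.zfin

lemma E_v (f : R') : (E S S' ν).v f = ⨆ n, (e n S S' ν).v f := rfl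

lemma E_z : (E S S' ν).v S'.z = ν.v S.z := by
  simp only [E_v, (e_zw _ S S' ν).1, ciSup_const]

lemma E_w : (E S S' ν).v S'.w = ν.v S.w := by
  simp only [E_v, (e_zw _ S S' ν).2, ciSup_const]

variable {ν} in
lemma E_class {D : Dat k} (h : Class ν D) :
    E S S' ν = pull D (E (step S D) (step S' D) (push ν D h)) := by
  apply CVal.ext
  funext f
  rw [pull_v, E_v, E_v, ← (e_monotone S S' ν f).iSup_nat_add 1]
  simp only [e_class _ h, pull_v]

variable {ν} in
lemma E_not (h : ¬ ∃ D, Class ν D) : E S S' ν = Mo S' ν := by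
  apply CVal.ext
  funext f
  simp only [E_v, e_not _ h, ciSup_const]

lemma E_mono {μ : CVal S} (hz : μ.v S.z = ν.v S.z) (hle : ∀ f, μ.v f ≤ ν.v f) (f : R') :
    (E S S' μ).v f ≤ (E S S' ν).v f :=
  iSup_mono fun n => e_mono n S S' μ ν hz hle f

end

lemma e_E (n : ℕ) : ∀ {R : Type u} [CommRing R] [IsDomain R] {R' : Type v} [CommRing R']
    [IsDomain R'] {R'' : Type x} [CommRing R''] [IsDomain R'']
    {k : Type w} [Field k] (S : Good R k) (S' : Good R' k) (S'' : Good R'' k) (ν : CVal S),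
    e n S' S'' (E S S' ν) = e n S S'' ν := by
  induction n with
  | zero =>
    intro R _ _ R' _ _ R'' _ _ k _ S S' S'' ν
    exact Mo_congr (E_z S S' ν) (E_w S S' ν)
  | succ n ih =>
    intro R _ _ R' _ _ R'' _ _ k _ S S' S'' ν
    by_cases h : ∃ D, Class ν D
    · obtain ⟨D, h⟩ := h
      rw [E_class S S' h, e_class n (pull_class _), push_pull, ih, e_class n h]
    · rw [E_not S S' h, e_not _ Mo_not_class, e_not _ h]
      exact Mo_congr Mo_z Mo_w

lemma E_E {R : Type u} [CommRing R] [IsDomain R] {R' : Type v} [CommRing R']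
    [IsDomain R'] {R'' : Type x} [CommRing R''] [IsDomain R'']
    {k : Type w} [Field k] (S : Good R k) (S' : Good R' k) (S'' : Good R'' k) (ν : CVal S) :
    E S' S'' (E S S' ν) = E S S'' ν := by
  apply CVal.ext
  funext f
  simp only [E_v S' S'', E_v S S'', e_E]

lemma e_le (n : ℕ) : ∀ {R : Type u} [CommRing R] [IsDomain R]
    {k : Type w} [Field k] (S : Good R k) (ν : CVal S) (f : R),
    (e n S S ν).v f ≤ ν.v f := by
  induction n with
  | zero =>
    intro R _ _ k _ S ν f
    exact ν.mon_le f
  | succ n ih =>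
    intro R _ _ k _ S ν f
    by_cases h : ∃ D, Class ν D
    · obtain ⟨D, h⟩ := h
      rw [e_class n h, pull_v, ← push_ι h f]
      exact ih _ _ _
    · rw [e_not _ h]
      exact ν.mon_le f

end VT

open scoped ENNReal
set_option linter.unusedSectionVars false

namespace VT
open Polynomial

universe u v w x

section
variable {R : Type u} [CommRing R] [IsDomain R] {k : Type w} [Field k] {S : Good R k}

/-- one step of the degree reduction -/
lemma reduce (S : Good R k) (D : Dat k) {u h : R} (hu : S.π u ≠ 0) {d : ℕ} (hd : d ≠ 0) :
    ∃ W p q n Q, ∃ hQ : S.Rho D n (S.z ^ p * S.w ^ q * (u * S.w ^ d + S.z * h)) Q,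
      D.b * p + D.a * q + W = D.a * D.b * n ∧ 1 ≤ W ∧
      ∃ d' U h', (step S D).π U ≠ 0 ∧
        quo S D hQ = U * (step S D).w ^ d' + (step S D).z * h' ∧ (d' < d ∨ d' = d ∧ D.b = 1) := by
  have hf0 : u * S.w ^ d + S.z * h ≠ 0 := by
    intro h0
    apply S.ndvd d
    apply S.dvd_unit_mul hu
    exact ⟨-h, by linear_combination h0⟩
  obtain ⟨W, hW1, hW2⟩ := exact_exists S D hf0
  obtain ⟨p, q, n, Q, hqb, hW, hQ, hQ0⟩ := norm_exists S D hW1 hW2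
  have hWpos : 1 ≤ W := by
    by_contra hcon
    have : W = 0 := by omega
    rw [this] at hW2
    apply hW2
    apply S.Ge_one D
    rw [map_add, map_mul, map_mul, map_pow, S.πw, S.πz, zero_pow hd]; ring
  have hWd : W ≤ D.a * d := by
    have hup : Good.Up (fun i j => 1 ≤ i ∨ W ≤ D.b * i + D.a * j) := by
      rintro i j i' j' hi hj (h | h)
      · left; omega
      · right; exact Good.up_Ge D W i j i' j' hi hj h
    have hm : u * (S.z ^ 0 * S.w ^ d) ∈ S.I (fun i j => 1 ≤ i ∨ W ≤ D.b * i + D.a * j) := by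
      have h1 : u * S.w ^ d + S.z * h ∈ S.I (fun i j => 1 ≤ i ∨ W ≤ D.b * i + D.a * j) :=
        S.I_mono (fun i j hij => Or.inr hij) hW1
      have h2 : S.z * h ∈ S.I (fun i j => 1 ≤ i ∨ W ≤ D.b * i + D.a * j) := by
        refine Ideal.mul_mem_right _ _ ?_
        have := S.mono_mem (U := fun i j => 1 ≤ i ∨ W ≤ D.b * i + D.a * j) (i := 1) (j := 0)
          (Or.inl le_rfl)
        simpa using this
      have h3 := Ideal.sub_mem _ h1 h2
      convert h3 using 1
      ring
    rcases S.mem_I hup hu hm with h1 | h1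
    · omega
    · simpa using h1
  obtain ⟨d', q0, hq0, hQe⟩ : ∃ e q, ¬ D.φ ∣ q ∧ Q = D.φ ^ e * q := by
    obtain ⟨q, hq⟩ := (FiniteMultiplicity.of_prime_left D.prime hQ0).exists_eq_pow_mul_and_not_dvd
    exact ⟨_, q, hq.2, hq.1⟩
  have hq00 : q0 ≠ 0 := by rintro rfl; exact hq0 (dvd_zero _)
  have hrep := quo_rep S D hQ
  obtain ⟨F, hFe⟩ : ∃ F, F = quo S D hQ := ⟨_, rfl⟩
  rw [← hFe, hQe] at hrep
  obtain ⟨U, h', hU, hF⟩ := Rep.exp (F := F) hq0 hrep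
  rw [hFe] at hF
  refine ⟨W, p, q, n, Q, hQ, hW, hWpos, d', U, h', hU, hF, ?_⟩
  -- degree bound
  have hmem : S.z ^ p * S.w ^ q * (u * S.w ^ d + S.z * h) ∈ S.I (fun i j => p ≤ i ∧ q ≤ j) :=
    Ideal.mul_mem_right _ _ (S.mono_mem ⟨le_rfl, le_rfl⟩)
  have hup : Good.Up (fun i j => p ≤ i ∧ q ≤ j) := by
    rintro i j i' j' hi hj ⟨h1, h2⟩
    exact ⟨h1.trans hi, h2.trans hj⟩
  have hcoef := fun l (hl : Q.coeff l ≠ 0) => hQ.coef hup hmem hl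
  set l := Q.natDegree with hl
  have hln : l ≤ n := hQ.deg
  have h1 := (hcoef l (by rw [hl]; exact leadingCoeff_ne_zero.2 hQ0)).1
  have h2 : D.b * l ≤ q + d := by
    have h3 : D.a * (D.b * l) ≤ D.a * (q + d) := by
      have h4 : D.b * p ≤ D.b * (D.a * (n - l)) := Nat.mul_le_mul_left _ h1
      obtain ⟨m, hm⟩ := Nat.exists_eq_add_of_le hln
      rw [hm, Nat.add_sub_cancel_left] at h4
      rw [hm] at hW
      have e1 : D.a * D.b * (l + m) = D.a * (D.b * l) + D.b * (D.a * m) := by ring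
      have e2 : D.a * (q + d) = D.a * q + D.a * d := by ring
      omega
    exact Nat.le_of_mul_le_mul_left h3 D.ha
  have hφd : 1 ≤ D.φ.natDegree := D.irr.natDegree_pos
  have hdeg : l = d' * D.φ.natDegree + q0.natDegree := by
    rw [hl, hQe, natDegree_mul (pow_ne_zero _ D.irr.ne_zero) hq00, natDegree_pow]
  have hd'l : d' + q0.natDegree ≤ l := by
    rw [hdeg]; nlinarith
  have hb := D.hb
  by_cases hq : q = 0
  · subst hq
    have h5 : D.b * d' ≤ d := (Nat.mul_le_mul_left _ (by omega)).trans (by omega : D.b * l ≤ d)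
    rcases Nat.lt_or_ge d' d with h6 | h6
    · exact Or.inl h6
    · right
      have h7 : d' ≤ D.b * d' := Nat.le_mul_of_pos_left _ hb
      have h8 : d' = d := by omega
      refine ⟨h8, ?_⟩
      by_contra hb1
      have : 2 * d' ≤ D.b * d' := Nat.mul_le_mul_right _ (by omega)
      omega
  · left
    have hX : X ∣ Q := by
      rw [X_dvd_iff]
      by_contra h0
      have := (hcoef 0 h0).2
      omega
    have hX' : X ∣ q0 := by
      rw [hQe] at hX
      rcases prime_X.dvd_or_dvd hX with h6 | h6
      · have := prime_X.dvd_of_dvd_pow h6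
        rw [X_dvd_iff] at this
        exact absurd this D.φ0
      · exact h6
    have h6 : 1 ≤ q0.natDegree := by
      have := natDegree_le_of_dvd hX' hq00
      simpa using this
    have h7 : D.b * (d' + 1) ≤ q + d := (Nat.mul_le_mul_left _ (by omega)).trans h2
    have h8 : d' ≤ D.b * d' := Nat.le_mul_of_pos_left _ hb
    rw [mul_add] at h7
    omega

lemma reduce_val {ν : CVal S} {D : Dat k} (hc : Class ν D) {f : R} {W p q n : ℕ} {Q : k[X]}
    (hQ : S.Rho D n (S.z ^ p * S.w ^ q * f) Q) (hW : D.b * p + D.a * q + W = D.a * D.b * n) :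
    D.b * (push ν D hc).v (quo S D hQ) + W * ν.v S.z = D.b * ν.v f := by
  have h1 := hc.slope.norm_val f hW
  rw [← push_rep hc (quo_rep S D hQ), mul_add, add_right_comm, add_comm _ (_ * ν.v f)] at h1
  exact (ENNReal.add_left_inj (ENNReal.mul_ne_top (ENNReal.natCast_ne_top _) (ν.nz _))).1 h1

end

lemma E_ge_aux (d : ℕ) : ∀ (M : ℕ) {R : Type u} [CommRing R] [IsDomain R]
    {k : Type w} [Field k] (S : Good R k) (ν : CVal S) (u h : R), S.π u ≠ 0 →
    ν.v (u * S.w ^ d + S.z * h) ≤ (E S S ν).v (u * S.w ^ d + S.z * h) ∨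
    (M : ℝ≥0∞) * ν.v S.z ≤ (E S S ν).v (u * S.w ^ d + S.z * h) := by
  induction d using Nat.strong_induction_on with
  | _ d ihd =>
  intro M
  induction M with
  | zero => intros; right; simp
  | succ M ihM =>
    intro R _ _ k _ S ν u h hu
    by_cases hd : d = 0
    · left
      subst hd
      rw [ν.unit]
      · exact zero_le
      · simpa [S.πz] using hu
    by_cases hc : ∃ D, Class ν D
    swap
    · left
      rw [E_not S S hc, Mo_self hc]
    obtain ⟨D, hc⟩ := hc
    obtain ⟨W, p, q, n, Q, hQ, hW, hW1, d', U, h', hU, hF, hd'⟩ := reduce S D (h := h) hu hd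
    have e1 := reduce_val hc hQ hW
    have hcE : Class (E S S ν) D := by rw [E_class S S hc]; exact pull_class _
    have e2 := reduce_val hcE hQ hW
    have e3 : push (E S S ν) D hcE = E (step S D) (step S D) (push ν D hc) := by
      have key : ∀ (μ : CVal S) (hμ : Class μ D),
          μ = pull D (E (step S D) (step S D) (push ν D hc)) →
          push μ D hμ = E (step S D) (step S D) (push ν D hc) := by
        rintro μ hμ rfl
        exact push_pull _ _
      exact key _ _ (E_class S S hc)
    rw [e3, E_z] at e2
    have fin : (push ν D hc).v (quo S D hQ) ≤ (E (step S D) (step S D) (push ν D hc)).v (quo S D hQ) →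
        ν.v (u * S.w ^ d + S.z * h) ≤ (E S S ν).v (u * S.w ^ d + S.z * h) := by
      intro hle
      rw [← ENNReal.mul_le_mul_iff_right D.b0 (ENNReal.natCast_ne_top _), ← e1, ← e2]
      gcongr
    rcases hd' with hlt | ⟨rfl, hb⟩
    · left
      apply fin
      rw [hF]
      by_contra hcon
      have hM : ∀ M : ℕ, (M : ℝ≥0∞) * (push ν D hc).v (step S D).z ≤
          (E (step S D) (step S D) (push ν D hc)).v (U * (step S D).w ^ d' + (step S D).z * h') :=
        fun M => (ihd d' hlt M (step S D) (push ν D hc) U h' hU).resolve_left hcon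
      apply hcon
      refine le_trans le_top (top_le_iff.2 ?_).ge
      rw [← top_le_iff]
      refine le_of_forall_lt fun r hr => ?_
      obtain ⟨M, hM'⟩ := ENNReal.exists_nat_mul_gt (push ν D hc).z0 hr.ne
      exact hM'.trans_le (hM M)
    · rcases ihM (step S D) (push ν D hc) U h' hU with h1 | h1
      · left
        apply fin
        rw [hF]; exact h1
      · right
        rw [← hF] at h1
        have hz : ν.v S.z = (push ν D hc).v (step S D).z := by
          rw [push_z hc, hb]; simp
        rw [← hz] at h1
        rw [hb, Nat.cast_one, one_mul, one_mul] at e2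
        rw [← e2]
        push_cast
        rw [add_mul, one_mul]
        refine add_le_add h1 ?_
        calc ν.v S.z = (1 : ℕ) * ν.v S.z := by simp
          _ ≤ _ := by gcongr

lemma E_ge {R : Type u} [CommRing R] [IsDomain R] {k : Type w} [Field k] (S : Good R k)
    (ν : CVal S) {d : ℕ} {u h : R} (hu : S.π u ≠ 0) :
    ν.v (u * S.w ^ d + S.z * h) ≤ (E S S ν).v (u * S.w ^ d + S.z * h) := by
  by_contra hcon
  have hM : ∀ M : ℕ, (M : ℝ≥0∞) * ν.v S.z ≤ (E S S ν).v (u * S.w ^ d + S.z * h) :=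
    fun M => (E_ge_aux d M S ν u h hu).resolve_left hcon
  apply hcon
  refine le_trans le_top ?_
  refine le_of_forall_lt fun r hr => ?_
  obtain ⟨M, hM'⟩ := ENNReal.exists_nat_mul_gt ν.z0 hr.ne
  exact hM'.trans_le (hM M)

lemma E_self {R : Type u} [CommRing R] [IsDomain R] {k : Type w} [Field k] (S : Good R k)
    (ν : CVal S) : E S S ν = ν := by
  apply CVal.ext
  funext f
  apply le_antisymm
  · exact iSup_le fun n => e_le n S ν f
  · by_cases hf : f = 0
    · rw [hf, (E S S ν).map_zero]; exact le_top
    · obtain ⟨m, g, hg, rfl⟩ : ∃ m g, ¬ S.z ∣ g ∧ f = S.z ^ m * g := by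
        have hfin : FiniteMultiplicity S.z f := by
          obtain ⟨n, hn⟩ := S.fin f hf
          exact ⟨n, fun h => hn ((pow_dvd_pow _ (Nat.le_succ n)).trans h)⟩
        obtain ⟨g, hg⟩ := hfin.exists_eq_pow_mul_and_not_dvd
        exact ⟨_, g, hg.2, hg.1⟩
      obtain ⟨u, d, h, hu, rfl⟩ := S.exp g hg
      rw [ν.map_mul, (E S S ν).map_mul, ν.map_pow, (E S S ν).map_pow, E_z]
      exact add_le_add_right (E_ge S ν hu) _

lemma E_inv {R : Type u} [CommRing R] [IsDomain R] {R' : Type v} [CommRing R'] [IsDomain R']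
    {k : Type w} [Field k] (S : Good R k) (S' : Good R' k) (ν : CVal S) :
    E S' S (E S S' ν) = ν := by
  rw [E_E, E_self]

end VT

open scoped ENNReal
set_option linter.unusedSectionVars false

namespace VT
open Polynomial

universe u v w x

open IsLocalRing in
lemma mkGood_exp {R : Type*} [CommRing R] [IsDomain R] [IsNoetherianRing R] [IsLocalRing R]
    {k : Type*} [Field k] (π : R →+* k) (hπ : ∀ f, f ∈ maximalIdeal R ↔ π f = 0) {z w : R}
    (hm : maximalIdeal R = Ideal.span {z, w}) (f : R) (hf : ¬ z ∣ f) :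
    ∃ u d h, π u ≠ 0 ∧ f = u * w ^ d + z * h := by
  classical
  have hw : Ideal.span {w} ≠ ⊤ := by
    intro h
    rw [Ideal.span_singleton_eq_top] at h
    have : w ∈ maximalIdeal R := by rw [hm]; exact Ideal.subset_span (by simp)
    exact (mem_maximalIdeal w).1 this h
  have hK := Ideal.iInf_pow_smul_eq_bot_of_isLocalRing (M := R ⧸ Ideal.span {z})
    (Ideal.span {w}) hw
  have hne : ∃ d, ¬ ∃ u h, f = u * w ^ d + z * h := by
    by_contra! hcon
    apply hf
    rw [← Ideal.mem_span_singleton, ← Ideal.Quotient.eq_zero_iff_mem, ← Submodule.mem_bot R, ← hK,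
      Submodule.mem_iInf]
    intro i
    obtain ⟨u, h, hu⟩ := hcon i
    have h1 : Ideal.Quotient.mk (Ideal.span {z}) f
        = (w ^ i) • (Ideal.Quotient.mk (Ideal.span {z}) u) := by
      rw [Algebra.smul_def, Ideal.Quotient.algebraMap_eq, ← map_mul, Ideal.Quotient.eq,
        Ideal.mem_span_singleton]
      exact ⟨h, by rw [hu]; ring⟩
    rw [h1]
    exact Submodule.smul_mem_smul (Ideal.pow_mem_pow (Ideal.mem_span_singleton_self w) i) trivial
  have h0 : Nat.find hne ≠ 0 := by
    intro h
    exact (Nat.find_eq_zero hne).1 h ⟨f, 0, by ring⟩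
  obtain ⟨d, hd⟩ := Nat.exists_eq_succ_of_ne_zero h0
  have h1 := Nat.find_min hne (m := d) (by omega)
  have h2 := Nat.find_spec hne
  rw [hd] at h2
  rw [not_not] at h1
  obtain ⟨u, h, hu⟩ := h1
  refine ⟨u, d, h, fun h0 => h2 ?_, hu⟩
  rw [← hπ, hm, Ideal.mem_span_pair] at h0
  obtain ⟨x, y, rfl⟩ := h0
  exact ⟨y, h + x * w ^ d, by rw [hu, Nat.succ_eq_add_one, pow_succ]; ring⟩

open IsLocalRing in
def mkGood {R : Type*} [CommRing R] [IsDomain R] [IsNoetherianRing R] [IsLocalRing R]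
    {k : Type*} [Field k] (π : R →+* k) (hs : Function.Surjective π)
    (hπ : ∀ f, f ∈ maximalIdeal R ↔ π f = 0) (z w : R)
    (hm : maximalIdeal R = Ideal.span {z, w}) (hz0 : z ≠ 0) (hnd : ∀ d, ¬ z ∣ w ^ d) :
    Good R k where
  z := z
  w := w
  π := π
  surj := hs
  unit := fun f hf => by
    by_contra h
    exact hf ((hπ f).1 ((mem_maximalIdeal f).2 h))
  πz := (hπ z).1 (by rw [hm]; exact Ideal.subset_span (by simp))
  πw := (hπ w).1 (by rw [hm]; exact Ideal.subset_span (by simp))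
  z_ne := hz0
  fin := fun f hf => by
    have hz : z ∈ maximalIdeal R := by rw [hm]; exact Ideal.subset_span (by simp)
    have := FiniteMultiplicity.of_not_isUnit ((mem_maximalIdeal z).1 hz) hf
    obtain ⟨n, hn⟩ := this
    exact ⟨_, hn⟩
  exp := mkGood_exp π hπ hm
  ndvd := hnd

/-- A local ring with both orders of parameters. -/
structure Two (R : Type*) [CommRing R] [IsLocalRing R] (k : Type*) [Field k] where
  S : Good R k
  T : Good R k
  hz : T.z = S.w
  hw : T.w = S.z
  hπ : T.π = S.π
  hS : ∀ f, f ∈ IsLocalRing.maximalIdeal R ↔ S.π f = 0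

section
variable {R : Type*} [CommRing R] [IsDomain R] [IsLocalRing R] {k : Type*} [Field k] (W : Two R k)

lemma Two.mon_swap (c t : ℝ≥0∞) (f : R) : W.S.mon c t f = W.T.mon t c f := by
  unfold Good.mon
  congr 1
  ext r
  have : W.S.I (fun i j => r ≤ Good.wt c t i j) = W.T.I (fun i j => r ≤ Good.wt t c i j) := by
    unfold Good.I
    congr 1
    ext m
    simp only [Set.mem_ofPred_eq, W.hz, W.hw, Good.wt]
    constructor
    · rintro ⟨i, j, h, rfl⟩
      exact ⟨j, i, by rwa [add_comm], mul_comm _ _⟩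
    · rintro ⟨i, j, h, rfl⟩
      exact ⟨j, i, by rwa [add_comm], mul_comm _ _⟩
  simp only [Set.mem_ofPred_eq, this]

lemma Two.not_class (μ : CVal W.S) (ν : CVal W.T) (h1 : μ.v W.S.z = 1) (h2 : μ.v W.S.w = 1)
    (h3 : ν.v W.S.w = 1) (h4 : 1 < ν.v W.S.z) (hle : ∀ f, μ.v f ≤ ν.v f) :
    ¬ ∃ D, Class μ D := by
  rintro ⟨D, hD⟩
  have hs := hD.slope
  unfold Slope at hs
  rw [h1, h2, mul_one, mul_one, Nat.cast_inj] at hs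
  have hc := D.cop
  rw [hs, Nat.coprime_self] at hc
  have hb : D.b = 1 := hs.trans hc
  have hp := hD.phi.trans_le (hle _)
  rw [hc, h1, one_mul, mul_one] at hp
  apply hp.ne'
  set n := D.φ.natDegree with hn
  have hu : W.T.π ((lphi W.S D).coeff n) = 1 := by
    rw [W.hπ, ← coeff_map, lphi_map]; exact D.monic
  have e1 : ν.v ((lphi W.S D).coeff n * (W.S.z ^ (D.a * (n - n)) * W.S.w ^ (D.b * n))) = n := by
    rw [ν.map_mul, ν.unit (by rw [hu]; exact one_ne_zero), Nat.sub_self, hb, mul_zero, pow_zero,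
      one_mul, one_mul, ν.map_pow, h3, zero_add, mul_one]
  have e2 : (n : ℝ≥0∞) < ν.v (∑ l ∈ Finset.range n,
      (lphi W.S D).coeff l * (W.S.z ^ (D.a * (n - l)) * W.S.w ^ (D.b * l))) := by
    refine Finset.sum_induction _ (fun x => (n : ℝ≥0∞) < ν.v x) ?_ ?_ ?_
    · intro x y hx hy
      exact (lt_min hx hy).trans_le (ν.add_ge x y)
    · rw [ν.map_zero]; exact ENNReal.natCast_lt_top _
    · intro l hl
      rw [Finset.mem_range] at hl
      refine lt_of_lt_of_le ?_ (ν.mul_ge _ _)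
      rw [ν.map_mul, ν.map_pow, ν.map_pow, h3, hb, hc, one_mul, one_mul, mul_one]
      have hnl : (n : ℝ≥0∞) = ((n - l : ℕ) : ℝ≥0∞) * 1 + l := by
        rw [mul_one, ← Nat.cast_add]; congr 1; omega
      conv_lhs => rw [hnl]
      refine ENNReal.add_lt_add_right (ENNReal.natCast_ne_top _) ?_
      refine (ENNReal.mul_lt_mul_iff_right ?_ (ENNReal.natCast_ne_top _)).2 h4
      rw [Nat.cast_ne_zero]; omega
  have : Hφ W.S D = (lphi W.S D).coeff n * (W.S.z ^ (D.a * (n - n)) * W.S.w ^ (D.b * n)) +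
      ∑ l ∈ Finset.range n,
      (lphi W.S D).coeff l * (W.S.z ^ (D.a * (n - l)) * W.S.w ^ (D.b * l)) := by
    unfold Hφ Good.H
    rw [Finset.sum_range_succ, add_comm]
  rw [this, ν.add_eq (by rw [e1]; exact e2), e1]

end

end VT

open scoped ENNReal
set_option linter.unusedSectionVars false

namespace VT
open Polynomial

universe u v w x

lemma cv_ext {R : Type*} [CommRing R] [IsLocalRing R] {μ ν : CenteredValn R}
    (h : ∀ f, μ.v f = ν.v f) : μ = ν := by
  cases μ; cases ν
  congr
  exact funext h

lemma cv_coe {R : Type*} [CommRing R] [IsLocalRing R] (ν : CenteredValn R) (f : R) :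
    (((ν.v f).toENNReal : ℝ≥0∞) : EReal) = ν.v f := EReal.coe_toENNReal (ν.nonneg f)

section
variable {R : Type u} [CommRing R] [IsDomain R] [IsLocalRing R] {k : Type w} [Field k]

/-- from extended-real valued to `ℝ≥0∞` valued -/
noncomputable def toC (G : Good R k) (hG : ∀ f, f ∈ IsLocalRing.maximalIdeal R ↔ G.π f = 0)
    (ν : CenteredValn R) (hz : ν.v G.z ≠ ⊤) : CVal G where
  v f := (ν.v f).toENNReal
  map_mul f g := by
    apply EReal.coe_ennreal_injective
    rw [EReal.coe_ennreal_add, cv_coe, cv_coe, cv_coe, ν.map_mul]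
  add_ge f g := by
    rw [min_le_iff, ← EReal.coe_ennreal_le_coe_ennreal_iff, ← EReal.coe_ennreal_le_coe_ennreal_iff,
      cv_coe, cv_coe, cv_coe, ← min_le_iff]
    exact ν.add_ge f g
  map_one := by rw [ν.map_one]; simp
  pos f hf h := by
    have h1 := cv_coe ν f
    rw [h] at h1
    exact (ν.pos f ((hG f).2 hf)).ne (by simpa using h1)
  zfin h := by
    have h1 := cv_coe ν G.z
    rw [h] at h1
    exact hz h1.symm

noncomputable def ofC (G : Good R k) (hG : ∀ f, f ∈ IsLocalRing.maximalIdeal R ↔ G.π f = 0)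
    (μ : CVal G) : CenteredValn R where
  v f := (μ.v f : EReal)
  map_mul f g := by rw [μ.map_mul, EReal.coe_ennreal_add]
  add_ge f g := by
    rw [min_le_iff, EReal.coe_ennreal_le_coe_ennreal_iff, EReal.coe_ennreal_le_coe_ennreal_iff,
      ← min_le_iff]
    exact μ.add_ge f g
  map_one := by rw [μ.map_one]; simp
  nonneg f := EReal.coe_ennreal_nonneg _
  pos f hf := by
    rw [EReal.coe_ennreal_pos]
    exact pos_iff_ne_zero.2 (μ.pos f ((hG f).1 hf))
  proper := ⟨G.z, (hG _).2 G.πz, by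
    rw [Ne, EReal.coe_ennreal_eq_top_iff]; exact μ.zfin⟩

lemma toC_v (G : Good R k) (hG : ∀ f, f ∈ IsLocalRing.maximalIdeal R ↔ G.π f = 0)
    (ν : CenteredValn R) (hz : ν.v G.z ≠ ⊤) (f : R) :
    (((toC G hG ν hz).v f : ℝ≥0∞) : EReal) = ν.v f := cv_coe ν f

lemma ofC_v (G : Good R k) (hG : ∀ f, f ∈ IsLocalRing.maximalIdeal R ↔ G.π f = 0)
    (μ : CVal G) (f : R) : (ofC G hG μ).v f = (μ.v f : EReal) := rfl

lemma ofC_le {G : Good R k} {hG : ∀ f, f ∈ IsLocalRing.maximalIdeal R ↔ G.π f = 0}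
    {G' : Good R k} {hG' : ∀ f, f ∈ IsLocalRing.maximalIdeal R ↔ G'.π f = 0}
    {μ : CVal G} {μ' : CVal G'} {f : R} (h : μ.v f ≤ μ'.v f) :
    (ofC G hG μ).v f ≤ (ofC G' hG' μ').v f := by
  rw [ofC_v, ofC_v, EReal.coe_ennreal_le_coe_ennreal_iff]; exact h

lemma toC_le {G : Good R k} {hG : ∀ f, f ∈ IsLocalRing.maximalIdeal R ↔ G.π f = 0}
    {G' : Good R k} {hG' : ∀ f, f ∈ IsLocalRing.maximalIdeal R ↔ G'.π f = 0}
    {μ ν : CenteredValn R} {h1 : μ.v G.z ≠ ⊤} {h2 : ν.v G'.z ≠ ⊤} {f : R} (h : μ.v f ≤ ν.v f) :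
    (toC G hG μ h1).v f ≤ (toC G' hG' ν h2).v f := by
  rw [← EReal.coe_ennreal_le_coe_ennreal_iff, toC_v, toC_v]; exact h

lemma toC_ofC (G : Good R k) (hG : ∀ f, f ∈ IsLocalRing.maximalIdeal R ↔ G.π f = 0)
    (μ : CVal G) (hz) : toC G hG (ofC G hG μ) hz = μ := by
  apply CVal.ext
  funext f
  apply EReal.coe_ennreal_injective
  rw [toC_v, ofC_v]

lemma ofC_toC (G : Good R k) (hG : ∀ f, f ∈ IsLocalRing.maximalIdeal R ↔ G.π f = 0)
    (ν : CenteredValn R) (hz) : ofC G hG (toC G hG ν hz) = ν :=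
  cv_ext fun f => by rw [ofC_v, toC_v]

lemma Two.hT (W : Two R k) (f : R) : f ∈ IsLocalRing.maximalIdeal R ↔ W.T.π f = 0 := by
  rw [W.hπ]; exact W.hS f

lemma Two.norm (W : Two R k) (ν : CenteredValn R) :
    ν.Normalized ↔ min (ν.v W.S.z) (ν.v W.S.w) = 1 := by
  have : IsLeast {x : EReal | ∃ f ∈ IsLocalRing.maximalIdeal R, ν.v f = x}
      (min (ν.v W.S.z) (ν.v W.S.w)) := by
    constructor
    · rcases min_choice (ν.v W.S.z) (ν.v W.S.w) with h | h <;> rw [h]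
      · exact ⟨_, (W.hS _).2 W.S.πz, rfl⟩
      · exact ⟨_, (W.hS _).2 W.S.πw, rfl⟩
    · rintro _ ⟨f, hf, rfl⟩
      obtain ⟨x, y, rfl⟩ := W.S.ker_exp ((W.hS f).1 hf)
      refine le_trans ?_ (ν.add_ge _ _)
      rw [ν.map_mul, ν.map_mul]
      exact min_le_min (le_add_of_nonneg_right (ν.nonneg x)) (le_add_of_nonneg_right (ν.nonneg y))
  rw [CenteredValn.Normalized, this.csInf_eq]

lemma Two.c1 (W : Two R k) {ν : CenteredValn R} (h : ν.Normalized)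
    (hc : ν.v W.S.z ≤ ν.v W.S.w) : ν.v W.S.z = 1 := by
  rw [W.norm, min_eq_left hc] at h; exact h

lemma Two.c2 (W : Two R k) {ν : CenteredValn R} (h : ν.Normalized)
    (hc : ¬ ν.v W.S.z ≤ ν.v W.S.w) : ν.v W.T.z = 1 := by
  rw [W.norm, min_eq_right (not_le.1 hc).le] at h; rw [W.hz]; exact h

lemma ne_top_of_one {x : EReal} (h : x = 1) : x ≠ ⊤ := by
  rw [h]; exact EReal.coe_ne_top 1

end

section
variable {R : Type u} [CommRing R] [IsDomain R] [IsLocalRing R] {k : Type w} [Field k]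
 {R' : Type v} [CommRing R'] [IsDomain R'] [IsLocalRing R'] (W : Two R k) (W' : Two R' k)

open Classical in
noncomputable def F (ν : CenteredValn R) (h : ν.Normalized) : CenteredValn R' :=
  if hc : ν.v W.S.z ≤ ν.v W.S.w then
    ofC W'.S W'.hS (E W.S W'.S (toC W.S W.hS ν (ne_top_of_one (W.c1 h hc))))
  else ofC W'.T W'.hT (E W.T W'.T (toC W.T W.hT ν (ne_top_of_one (W.c2 h hc))))

lemma F_zw (ν : CenteredValn R) (h : ν.Normalized) :
    (F W W' ν h).v W'.S.z = ν.v W.S.z ∧ (F W W' ν h).v W'.S.w = ν.v W.S.w := by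
  unfold F
  split_ifs with hc
  · rw [ofC_v, ofC_v, E_z, E_w, toC_v, toC_v]; exact ⟨rfl, rfl⟩
  · rw [← W'.hz, ← W'.hw, ofC_v, ofC_v, E_z, E_w, toC_v, toC_v, W.hz, W.hw]; exact ⟨rfl, rfl⟩

lemma F_norm (ν : CenteredValn R) (h : ν.Normalized) : (F W W' ν h).Normalized := by
  rw [W'.norm, (F_zw W W' ν h).1, (F_zw W W' ν h).2, ← W.norm]; exact h

lemma F_inv (ν : CenteredValn R) (h : ν.Normalized) :
    F W' W (F W W' ν h) (F_norm W W' ν h) = ν := by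
  by_cases hc : ν.v W.S.z ≤ ν.v W.S.w
  · have hc' : (F W W' ν h).v W'.S.z ≤ (F W W' ν h).v W'.S.w := by
      rw [(F_zw W W' ν h).1, (F_zw W W' ν h).2]; exact hc
    have h1 : F W' W (F W W' ν h) (F_norm W W' ν h) = _ := dif_pos hc'
    have h2 : F W W' ν h = _ := dif_pos hc
    rw [h1]
    simp only [h2, toC_ofC, E_inv, ofC_toC]
  · have hc' : ¬ (F W W' ν h).v W'.S.z ≤ (F W W' ν h).v W'.S.w := by
      rw [(F_zw W W' ν h).1, (F_zw W W' ν h).2]; exact hc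
    have h1 : F W' W (F W W' ν h) (F_norm W W' ν h) = _ := dif_neg hc'
    have h2 : F W W' ν h = _ := dif_neg hc
    rw [h1]
    simp only [h2, toC_ofC, E_inv, ofC_toC]

lemma toC_one (G : Good R k) (hG : ∀ f, f ∈ IsLocalRing.maximalIdeal R ↔ G.π f = 0)
    (ν : CenteredValn R) (hz : ν.v G.z ≠ ⊤) {f : R} (h : ν.v f = 1) :
    (toC G hG ν hz).v f = 1 := by
  apply EReal.coe_ennreal_injective
  rw [toC_v, h, EReal.coe_ennreal_one]

lemma F_mono (μ ν : CenteredValn R) (hμ : μ.Normalized) (hν : ν.Normalized)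
    (hle : ∀ f, μ.v f ≤ ν.v f) (f : R') : (F W W' μ hμ).v f ≤ (F W W' ν hν).v f := by
  by_cases c1 : μ.v W.S.z ≤ μ.v W.S.w <;> by_cases c2 : ν.v W.S.z ≤ ν.v W.S.w
  · have h1 : F W W' μ hμ = _ := dif_pos c1
    have h2 : F W W' ν hν = _ := dif_pos c2
    rw [h1, h2]
    refine ofC_le (E_mono _ _ _ ?_ (fun f => toC_le (hle f)) f)
    rw [toC_one _ _ _ _ (W.c1 hμ c1), toC_one _ _ _ _ (W.c1 hν c2)]
  · have h1 : F W W' μ hμ = _ := dif_pos c1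
    have h2 : F W W' ν hν = _ := dif_neg c2
    have hz := W.c1 hμ c1
    have hw' := W.c2 hν c2
    rw [W.hz] at hw'
    have hw : μ.v W.S.w = 1 := le_antisymm ((hle _).trans hw'.le) (hz.ge.trans c1)
    rw [h1, h2]
    apply ofC_le
    have hT : (toC W.T W.hT ν (ne_top_of_one (W.c2 hν c2))).v W.S.w = 1 := toC_one _ _ _ _ hw'
    have hT' : 1 < (toC W.T W.hT ν (ne_top_of_one (W.c2 hν c2))).v W.S.z := by
      rw [← hT, ← EReal.coe_ennreal_lt_coe_ennreal_iff, toC_v, toC_v]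
      exact not_le.1 c2
    have a1 := toC_one W.S W.hS μ (ne_top_of_one hz) hz
    have a2 := toC_one W.S W.hS μ (ne_top_of_one hz) hw
    have hn := W.not_class (toC W.S W.hS μ (ne_top_of_one hz)) _ a1 a2 hT hT'
      (fun f => toC_le (hle f))
    rw [E_not _ _ hn]
    change W'.S.mon _ _ f ≤ _
    rw [a1, a2, W'.mon_swap]
    refine CVal.mon_le' _ ?_ ?_ f
    · rw [E_z, W.hz, hT]
    · rw [E_w, W.hw]; exact hT'.le
  · exfalso
    have hz := W.c2 hμ c1
    rw [W.hz] at hz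
    have hz' := W.c1 hν c2
    apply c1
    rw [hz, ← hz']; exact hle _
  · have h1 : F W W' μ hμ = _ := dif_neg c1
    have h2 : F W W' ν hν = _ := dif_neg c2
    rw [h1, h2]
    refine ofC_le (E_mono _ _ _ ?_ (fun f => toC_le (hle f)) f)
    rw [toC_one _ _ _ _ (W.c2 hμ c1), toC_one _ _ _ _ (W.c2 hν c2)]

theorem main_two (W : Two R k) (W' : Two R' k) :
     ∃ e : {ν : CenteredValn R // ν.Normalized} ≃ {ν : CenteredValn R' // ν.Normalized},
      ∀ μ ν : {ν : CenteredValn R // ν.Normalized},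
        (∀ f : R, μ.1.v f ≤ ν.1.v f) ↔ (∀ g : R', (e μ).1.v g ≤ (e ν).1.v g) := by
  refine ⟨⟨fun ν => ⟨F W W' ν.1 ν.2, F_norm W W' ν.1 ν.2⟩,
    fun ν => ⟨F W' W ν.1 ν.2, F_norm W' W ν.1 ν.2⟩,
    fun ν => Subtype.ext (F_inv W W' ν.1 ν.2), fun ν => Subtype.ext (F_inv W' W ν.1 ν.2)⟩, ?_⟩
  intro μ ν
  constructor
  · intro h
    exact F_mono W W' μ.1 ν.1 μ.2 ν.2 h
  · intro h f
    have := F_mono W' W _ _ (F_norm W W' μ.1 μ.2) (F_norm W W' ν.1 ν.2) h f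
    rw [F_inv, F_inv] at this
    exact this

end

end VT

open scoped ENNReal
set_option linter.unusedSectionVars false

namespace VT

open IsLocalRing in
def mkTwo {R : Type*} [CommRing R] [IsDomain R] [IsNoetherianRing R] [IsLocalRing R]
    {k : Type*} [Field k] (π : R →+* k) (hs : Function.Surjective π)
    (hπ : ∀ f, f ∈ maximalIdeal R ↔ π f = 0) (z w : R)
    (hm : maximalIdeal R = Ideal.span {z, w}) (hz0 : z ≠ 0) (hw0 : w ≠ 0)
    (hnd : ∀ d, ¬ z ∣ w ^ d) (hnd' : ∀ d, ¬ w ∣ z ^ d) : Two R k where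
  S := mkGood π hs hπ z w hm hz0 hnd
  T := mkGood π hs hπ w z (by rw [hm, Set.pair_comm]) hw0 hnd'
  hz := rfl
  hw := rfl
  hπ := rfl
  hS := hπ

open IsLocalRing in
lemma dim_ndvd {R : Type*} [CommRing R] [IsDomain R] [IsNoetherianRing R] [IsLocalRing R]
    (hdim : ringKrullDim R = 2) {z w : R} (hm : maximalIdeal R = Ideal.span {z, w}) (d : ℕ) :
    ¬ z ∣ w ^ d := by
  intro h
  have hz : z ∈ maximalIdeal R := by rw [hm]; exact Ideal.subset_span (by simp)
  have hmin : maximalIdeal R ∈ (Ideal.span {z}).minimalPrimes := by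
    refine ⟨⟨inferInstance, by rw [Ideal.span_singleton_le_iff_mem]; exact hz⟩, ?_⟩
    rintro q ⟨hq, hzq⟩ _
    rw [hm, Ideal.span_le]
    have hz' : z ∈ q := hzq (Ideal.mem_span_singleton_self z)
    have hw' : w ∈ q := hq.mem_of_pow_mem d (Ideal.mem_of_dvd _ h hz')
    rintro x (rfl | rfl)
    · exact hz'
    · exact hw'
  have h1 := Ideal.height_le_one_of_isPrincipal_of_mem_minimalPrimes (Ideal.span {z}) _ hmin
  have h2 := IsLocalRing.maximalIdeal_height_eq_ringKrullDim (R := R)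
  rw [hdim] at h2
  have h3 : ((maximalIdeal R).height : WithBot ℕ∞) ≤ 1 := by exact_mod_cast h1
  rw [h2] at h3
  exact absurd h3 (by decide)

open IsLocalRing in
lemma twoR {R : Type*} [CommRing R] [IsDomain R] [IsNoetherianRing R] [IsLocalRing R]
    (hdim : ringKrullDim R = 2) (hreg : ∃ x y : R, maximalIdeal R = Ideal.span {x, y}) :
    Nonempty (Two R (ResidueField R)) := by
  obtain ⟨z, w, hm⟩ := hreg
  have hm' : maximalIdeal R = Ideal.span {w, z} := by rw [hm, Set.pair_comm]
  have h1 := dim_ndvd hdim hm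
  have h2 := dim_ndvd hdim hm'
  refine ⟨mkTwo (residue R) (residue_surjective) (fun f => (residue_eq_zero_iff f).symm) z w hm ?_ ?_ h1 h2⟩
  · rintro rfl; exact h2 1 (by simp)
  · rintro rfl; exact h1 1 (by simp)

open MvPolynomial in
lemma mem_P {k : Type*} [Field k] (P : Ideal (MvPolynomial (Fin 2) k))
    (hP : P = Ideal.span {X 0, X 1}) (f : MvPolynomial (Fin 2) k) :
    f ∈ P ↔ constantCoeff f = 0 := by
  constructor
  · intro h
    rw [hP, Ideal.mem_span_pair] at h
    obtain ⟨a, b, rfl⟩ := h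
    simp
  · intro h
    have hs : f ∈ Ideal.span (Set.range (X : Fin 2 → MvPolynomial (Fin 2) k)) := by
      rw [← Set.image_univ, mem_ideal_span_X_image]
      intro m hm
      by_contra! hcon
      have : m = 0 := by ext i; simpa using hcon i trivial
      rw [this, mem_support_iff] at hm
      exact hm h
    rw [hP]
    refine Ideal.span_mono ?_ hs
    rintro _ ⟨i, rfl⟩
    fin_cases i <;> simp

section
variable {k : Type*} [Field k]
    (P : Ideal (MvPolynomial (Fin 2) k)) [P.IsPrime]
    (hP : P = Ideal.span {MvPolynomial.X 0, MvPolynomial.X 1})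
    (A : Type*) [CommRing A] [IsLocalRing A]
    [Algebra (MvPolynomial (Fin 2) k) A]
    [IsLocalization.AtPrime A P]

include P in
lemma A_inj : Function.Injective (algebraMap (MvPolynomial (Fin 2) k) A) :=
  IsLocalization.injective A (Ideal.primeCompl_le_nonZeroDivisors P)

open MvPolynomial in
lemma A_ndvd (i j : Fin 2) (hij : i ≠ j) (hP : ∀ i, X i ∈ P) (d : ℕ) :
    ¬ algebraMap (MvPolynomial (Fin 2) k) A (X i) ∣ algebraMap (MvPolynomial (Fin 2) k) A (X j) ^ d := by
  rintro ⟨x, hx⟩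
  obtain ⟨a, s, rfl⟩ := IsLocalization.exists_mk'_eq P.primeCompl x
  have h1 : algebraMap (MvPolynomial (Fin 2) k) A (X j ^ d * (s : MvPolynomial (Fin 2) k)) =
      algebraMap (MvPolynomial (Fin 2) k) A (X i * a) := by
    rw [map_mul, map_mul, map_pow, hx, mul_assoc, IsLocalization.mk'_spec]
  have h2 := A_inj P A h1
  have hp : Prime (X i : MvPolynomial (Fin 2) k) := X_prime
  rcases hp.dvd_or_dvd (Dvd.intro _ h2.symm) with h | h
  · have := hp.dvd_of_dvd_pow h
    rw [X_dvd_X] at this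
    simp_all
  · exact s.2 (Ideal.mem_of_dvd _ h (hP i))

open IsLocalRing MvPolynomial in
include hP in
lemma twoA [IsDomain A] : Nonempty (Two A k) := by
  have : IsNoetherianRing A := IsLocalization.isNoetherianRing P.primeCompl A inferInstance
  have hX : ∀ i, X i ∈ P := fun i => by rw [mem_P P hP]; simp
  have hu : ∀ s : P.primeCompl, IsUnit ((constantCoeff : MvPolynomial (Fin 2) k →+* k) s) := by
    intro s
    rw [isUnit_iff_ne_zero, Ne, ← mem_P P hP]
    exact s.2
  let π : A →+* k := IsLocalization.lift hu
  have hπ : ∀ f, π (algebraMap _ A f) = constantCoeff f := fun f => IsLocalization.lift_eq hu f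
  have hs : Function.Surjective π := fun c => ⟨algebraMap _ A (C c), by rw [hπ]; simp⟩
  have hker : RingHom.ker π = maximalIdeal A := by
    have := RingHom.ker_isMaximal_of_surjective π hs
    exact eq_maximalIdeal this
  have hm : maximalIdeal A = Ideal.span {algebraMap (MvPolynomial (Fin 2) k) A (X 0),
      algebraMap (MvPolynomial (Fin 2) k) A (X 1)} := by
    have h := IsLocalization.AtPrime.map_eq_maximalIdeal P A
    rw [← h]
    conv_lhs => rw [hP]
    rw [Ideal.map_span, Set.image_pair]
  refine ⟨mkTwo π hs (fun f => by rw [← hker, RingHom.mem_ker]) _ _ hm ?_ ?_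
    (A_ndvd P A 0 1 (by simp) hX) (A_ndvd P A 1 0 (by simp) hX)⟩
  · rw [Ne, map_eq_zero_iff _ (A_inj P A)]; exact X_ne_zero 0
  · rw [Ne, map_eq_zero_iff _ (A_inj P A)]; exact X_ne_zero 1

end

end VT

/-- Let `(R, 𝔪)` be a regular local ring of Krull dimension 2 with
residue field `k = R/𝔪`, and let `A` be the localization of the polynomial ring
`k[x₁, x₂]` at the maximal ideal `(x₁, x₂)` (a regular local ring of dimension 2).
Then there is an order isomorphism — an order-preserving bijection whose inverse is
order-preserving — between the poset `𝒱(R)` of normalized centered valuations on `R`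
and the poset `𝒱(A)` of normalized centered valuations on `A`. -/
theorem valuations_correspond_to_valuations_of_polynomial_model
    (R : Type*) [CommRing R] [IsDomain R] [IsNoetherianRing R] [IsLocalRing R]
    (hdim : ringKrullDim R = 2)
    (hreg : ∃ x y : R, maximalIdeal R = Ideal.span {x, y})
    (P : Ideal (MvPolynomial (Fin 2) (ResidueField R))) [P.IsPrime]
    (hP : P = Ideal.span {MvPolynomial.X 0, MvPolynomial.X 1})
    (A : Type*) [CommRing A] [IsLocalRing A]
    [Algebra (MvPolynomial (Fin 2) (ResidueField R)) A]
    [IsLocalization.AtPrime A P] :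
    ∃ e : {ν : CenteredValn R // ν.Normalized} ≃ {ν : CenteredValn A // ν.Normalized},
      ∀ μ ν : {ν : CenteredValn R // ν.Normalized},
        (∀ f : R, μ.1.v f ≤ ν.1.v f) ↔ (∀ g : A, (e μ).1.v g ≤ (e ν).1.v g) := by
  have : IsDomain A := IsLocalization.isDomain_of_le_nonZeroDivisors A
    (Ideal.primeCompl_le_nonZeroDivisors P)
  obtain ⟨W⟩ := VT.twoR hdim hreg
  obtain ⟨W'⟩ := VT.twoA P hP A
  exact VT.main_two W W'
end

section
/- Let (R, 𝔪) be a regular local ring of Krull dimension 2 with field of fractions F, and let (R_i, 𝔪_i)_{i∈ℕ} be a simple sequence of local quadratic transforms of R. Assume that for every nonzero f ∈ R there exist i ∈ ℕ, elements x, y ∈ R_i with 𝔪_i = (x, y), natural numbers s, t, and a unit u of R_i such that f = x^s y^t u. Then R̄ := ⋃_{i∈ℕ} R_i is a valuation subring of F which dominates R_i for every i; moreover, any valuation subring of F which dominates R_i for every i is equal to R̄. -/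
open IsLocalRing

variable {F : Type*} [Field F]

/-- The set of nonunits of a subring `S` of `F`; when `S` is a local ring this is
(the image in `F` of) its maximal ideal `𝔪_S`. -/
def mSet (S : Subring F) : Set F :=
  {f : F | ∃ h : f ∈ S, ¬ IsUnit (⟨f, h⟩ : S)}

/-- Membership in `𝔪_S ^ 2`: finite sums of products of two nonunits of `S`. -/
def sqSet (S : Subring F) : Set F :=
  {f : F | ∃ (n : ℕ) (a b : Fin n → F),
    (∀ i, a i ∈ mSet S ∧ b i ∈ mSet S) ∧ f = ∑ i, a i * b i}

/-- The subring of `F` generated by `S` together with the elements `a / x`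
for `a` in the maximal ideal of `S`. -/
def quadT (S : Subring F) (x : F) : Subring F :=
  Subring.closure ((S : Set F) ∪ {f : F | ∃ a ∈ mSet S, f = a / x})

/-- `T'` is a local quadratic transform of `S`: `T' = T_𝔭` where `x ∈ 𝔪_S \ 𝔪_S²`,
`T` is the subring of `F` generated by `S` and the `a/x` (`a ∈ 𝔪_S`), and `𝔭` is a
prime ideal of `T` with `𝔭 ∩ S = 𝔪_S`. -/
def IsLQT (S T' : Subring F) : Prop :=
  ∃ x ∈ mSet S, x ∉ sqSet S ∧
    ∃ 𝔭 : Ideal (quadT S x), 𝔭.IsPrime ∧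
      (∀ (f : F) (hfS : f ∈ S) (hfT : f ∈ quadT S x),
        ((⟨f, hfT⟩ : quadT S x) ∈ 𝔭 ↔ f ∈ mSet S)) ∧
      (T' : Set F) = {f : F | ∃ t s : quadT S x, s ∉ 𝔭 ∧ f = (t : F) / (s : F)}

/-- `S` is a regular local ring of Krull dimension 2: a Noetherian local ring of Krull
dimension 2 whose set of nonunits (= maximal ideal) is generated by two elements. -/
def IsRegLocal2 (S : Subring F) : Prop :=
  IsNoetherianRing S ∧ IsLocalRing S ∧ ringKrullDim S = 2 ∧
    ∃ x y : S, ((Ideal.span {x, y} : Ideal S) : Set S) = {f : S | ¬ IsUnit f}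

/-- `F` is the field of fractions of the subring `S`. -/
def IsFracField (S : Subring F) : Prop :=
  ∀ f : F, ∃ a ∈ S, ∃ b ∈ S, b ≠ 0 ∧ f = a / b

/-- `(Rs i)_{i ∈ ℕ}` is a simple sequence of local quadratic transforms of `R₀`:
`Rs 0 = R₀` and each `Rs (i+1)` is a local quadratic transform of `Rs i` which is
again a regular local ring of Krull dimension 2 with field of fractions `F`. -/
def IsSimpleSeq (R₀ : Subring F) (Rs : ℕ → Subring F) : Prop :=
  Rs 0 = R₀ ∧ ∀ i : ℕ,
    IsLQT (Rs i) (Rs (i + 1)) ∧ IsRegLocal2 (Rs (i + 1)) ∧ IsFracField (Rs (i + 1))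

/-- A subring `A` of `F` dominates a subring `S` of `F` if `S ⊆ A` and
`𝔪_S = S ∩ 𝔪_A` (on nonunit sets). -/
def Dominates (S A : Subring F) : Prop :=
  (S : Set F) ⊆ (A : Set F) ∧ ∀ f ∈ (S : Set F), (f ∈ mSet S ↔ f ∈ mSet A)

/-- A member of a two-element generating set of the maximal ideal is a prime element. -/
theorem prime_of_param {A : Type*} [CommRing A] [IsDomain A] [IsNoetherianRing A] [IsLocalRing A]
    (hd : ringKrullDim A = 2) (x y : A) (hm : maximalIdeal A = Ideal.span {x, y}) : Prime x := by
  have hh : ¬ (maximalIdeal A).height ≤ 1 := by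
    intro h
    rw [← IsLocalRing.maximalIdeal_height_eq_ringKrullDim] at hd
    have h2 : (maximalIdeal A).height = 2 := WithBot.coe_injective hd
    rw [h2] at h
    exact absurd h (by decide)
  have hxm : x ∈ maximalIdeal A := hm ▸ Ideal.subset_span (by simp)
  have hx0 : x ≠ 0 := by
    rintro rfl
    apply hh
    have h1 : maximalIdeal A = Ideal.span {y} := by
      rw [hm]; simp [Ideal.span_insert]
    refine Ideal.height_le_one_of_isPrincipal_of_mem_minimalPrimes (Ideal.span {y}) _ ?_
    rw [h1]
    have : (Ideal.span {y}).IsPrime := h1 ▸ inferInstance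
    rw [Ideal.minimalPrimes_eq_subsingleton_self]
    rfl
  obtain ⟨P, hP, -⟩ := Ideal.exists_minimalPrimes_le
    (show Ideal.span {x} ≤ maximalIdeal A by rwa [Ideal.span_singleton_le_iff_mem])
  have hPp : P.IsPrime := hP.1.1
  have hxP : x ∈ P := hP.1.2 (Ideal.mem_span_singleton_self x)
  have hP1 := Ideal.height_le_one_of_isPrincipal_of_mem_minimalPrimes (Ideal.span {x}) P hP
  have hyP : y ∉ P := by
    intro hy
    apply hh
    have : P = maximalIdeal A := by
      apply le_antisymm (le_maximalIdeal hPp.ne_top)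
      rw [hm, Ideal.span_le]
      rintro z (rfl | rfl) <;> assumption
    rwa [← this]
  have hle : P ≤ Ideal.span {x} := by
    refine Submodule.le_of_le_smul_of_le_jacobson_bot (I := maximalIdeal A)
      (IsNoetherian.noetherian P) (IsLocalRing.maximalIdeal_le_jacobson _) ?_
    intro p hp
    have : p ∈ maximalIdeal A := le_maximalIdeal hPp.ne_top hp
    rw [hm, Ideal.mem_span_pair] at this
    obtain ⟨a, b, rfl⟩ := this
    have hb : b ∈ P := by
      have h1 : b * y ∈ P := by
        have := P.sub_mem hp (P.mul_mem_left a hxP)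
        simpa using this
      exact (hPp.mem_or_mem h1).resolve_right hyP
    refine Submodule.add_mem_sup (Ideal.mul_mem_left _ _ (Ideal.mem_span_singleton_self x)) ?_
    rw [mul_comm, smul_eq_mul]
    exact Ideal.mul_mem_mul (hm ▸ Ideal.subset_span (by simp)) hb
  have hPx : P = Ideal.span {x} := le_antisymm hle hP.1.2
  rw [← Ideal.span_singleton_prime hx0, ← hPx]
  exact hPp

theorem mem_mSet_iff {S : Subring F} {f : F} :
    f ∈ mSet S ↔ f ∈ S ∧ (f = 0 ∨ f⁻¹ ∉ S) := by
  constructor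
  · rintro ⟨h, hu⟩
    refine ⟨h, ?_⟩
    by_contra! hc
    exact hu (IsUnit.of_mul_eq_one ⟨f⁻¹, hc.2⟩ (Subtype.ext (mul_inv_cancel₀ hc.1)))
  · rintro ⟨h, hf⟩
    refine ⟨h, fun hu => ?_⟩
    obtain ⟨⟨g, hg⟩, hfg⟩ := hu.exists_right_inv
    have hfg : f * g = 1 := congrArg Subtype.val hfg
    rcases hf with rfl | hf
    · simp at hfg
    · exact hf (by rwa [inv_eq_of_mul_eq_one_right hfg])

theorem mSet_add {S : Subring F} (hS : IsLocalRing S) {f g : F} (hf : f ∈ mSet S)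
    (hg : g ∈ mSet S) : f + g ∈ mSet S := by
  obtain ⟨hf, hf'⟩ := hf
  obtain ⟨hg, hg'⟩ := hg
  exact ⟨S.add_mem hf hg, IsLocalRing.nonunits_add hf' hg'⟩

theorem mSet_mul {S : Subring F} {f g : F} (hf : f ∈ S)
    (hg : g ∈ mSet S) : f * g ∈ mSet S := by
  obtain ⟨hg, hg'⟩ := hg
  exact ⟨S.mul_mem hf hg, mul_mem_nonunits_right (a := (⟨f, hf⟩ : S)) hg'⟩

/-- The maximal ideal of `S` is generated by `x` and `y`. -/
def Params (S : Subring F) (x y : F) : Prop :=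
  mSet S = {g : F | ∃ a ∈ S, ∃ b ∈ S, g = a * x + b * y}

theorem Params.symm {S : Subring F} {x y : F} (h : Params S x y) : Params S y x := by
  unfold Params at *
  rw [h]
  ext g
  constructor <;>
  · rintro ⟨a, ha, b, hb, rfl⟩
    exact ⟨b, hb, a, ha, by ring⟩

theorem Params.left {S : Subring F} {x y : F} (h : Params S x y) : x ∈ mSet S := by
  rw [h]; exact ⟨1, S.one_mem, 0, S.zero_mem, by ring⟩

theorem Params.prime {S : Subring F} (hS : IsRegLocal2 S) {x y : F} (h : Params S x y)
    (hx : x ∈ S) (hy : y ∈ S) : Prime (⟨x, hx⟩ : S) := by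
  obtain ⟨h1, h2, h3, -⟩ := hS
  refine prime_of_param h3 _ ⟨y, hy⟩ ?_
  ext ⟨g, hg⟩
  rw [Ideal.mem_span_pair]
  have : (⟨g, hg⟩ : S) ∈ maximalIdeal S ↔ g ∈ mSet S := by
    rw [mem_maximalIdeal]
    exact ⟨fun h => ⟨hg, h⟩, fun ⟨_, h⟩ => h⟩
  rw [this, h]
  constructor
  · rintro ⟨a, ha, b, hb, e⟩
    exact ⟨⟨a, ha⟩, ⟨b, hb⟩, Subtype.ext e.symm⟩
  · rintro ⟨a, b, e⟩
    exact ⟨a, a.2, b, b.2, (congrArg Subtype.val e).symm⟩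

theorem lqt_dom {S S' : Subring F} (h : IsLQT S S') : Dominates S S' := by
  obtain ⟨z, hz, -, p, hp, hpS, hS'⟩ := h
  have hST : ∀ f ∈ S, f ∈ quadT S z := fun f hf => Subring.subset_closure (Or.inl hf)
  have hTS' : ∀ f ∈ quadT S z, f ∈ S' := by
    intro f hf
    change f ∈ (S' : Set F)
    rw [hS']
    exact ⟨⟨f, hf⟩, 1, (Ideal.ne_top_iff_one p).mp hp.ne_top, by simp⟩
  refine ⟨fun f hf => hTS' f (hST f hf), fun f hf => ?_⟩
  constructor
  · intro hm
    rw [mem_mSet_iff]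
    refine ⟨hTS' f (hST f hf), ?_⟩
    by_contra! hc
    obtain ⟨hf0, hinv⟩ := hc
    change f⁻¹ ∈ (S' : Set F) at hinv
    rw [hS'] at hinv
    obtain ⟨t, s, hs, e⟩ := hinv
    have hs0 : (s : F) ≠ 0 := by
      intro h0
      exact hs (by rw [show s = 0 from Subtype.ext h0]; exact p.zero_mem)
    have hfp := (hpS f hf (hST f hf)).mpr hm
    apply hs
    have : s = t * ⟨f, hST f hf⟩ := by
      apply Subtype.ext
      change (s : F) = t * f
      field_simp at e
      rw [e, mul_comm]
    rw [this]
    exact p.mul_mem_left _ hfp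
  · rw [mem_mSet_iff, mem_mSet_iff]
    rintro ⟨-, hc⟩
    exact ⟨hf, hc.imp id fun hc hc' => hc (hTS' _ (hST _ hc'))⟩

/-- One chart of the quadratic transform, when `x / z` becomes a unit. -/
theorem lqt_chart {S S' : Subring F} (hloc : IsLocalRing S')
    (hdom : Dominates S S') {x y z : F} (hxy : Params S x y) (hz : z ∈ mSet S) (hz0 : z ≠ 0)
    (hTS' : ∀ f ∈ quadT S z, f ∈ S')
    (hS' : ∀ f ∈ S', ∃ t ∈ quadT S z, ∃ s ∈ quadT S z, s ≠ 0 ∧ s⁻¹ ∈ S' ∧ f = t / s)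
    (hx0 : x ≠ 0) (hu : z / x ∈ S') :
    y / x ∈ S' ∧ (x / y ∈ S' ∧ y ≠ 0 ∨ Params S' x (y / x)) := by
  have hyz : y / z ∈ S' := hTS' _ (Subring.subset_closure (Or.inr ⟨y, hxy.symm.left, rfl⟩))
  have hxz : x / z ∈ S' := hTS' _ (Subring.subset_closure (Or.inr ⟨x, hxy.left, rfl⟩))
  have hyx : y / x ∈ S' := by
    have := S'.mul_mem hyz hu
    rwa [div_mul_div_cancel₀ hz0] at this
  refine ⟨hyx, ?_⟩
  by_cases hy' : x / y ∈ S' ∧ y ≠ 0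
  · exact Or.inl hy'
  right
  have hym : y / x ∈ mSet S' := by
    rw [mem_mSet_iff]
    refine ⟨hyx, ?_⟩
    by_contra! hc
    exact hy' ⟨by simpa using hc.2, fun h => hc.1 (by simp [h])⟩
  have hxm : x ∈ mSet S' := (hdom.2 x (mem_mSet_iff.mp hxy.left).1).mp hxy.left
  have hxS' := (mem_mSet_iff.mp hxm).1
  have hz' := hz
  rw [hxy] at hz'
  obtain ⟨α, hα, β, hβ, hzz⟩ := hz'
  have hαu : α ≠ 0 ∧ α⁻¹ ∈ S := by
    by_contra hc
    have : α ∈ mSet S := by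
      rw [mem_mSet_iff]
      exact ⟨hα, by tauto⟩
    rw [hdom.2 α hα] at this
    have h1 := mSet_add hloc this (mSet_mul (hdom.1 hβ) hym)
    have h2 : α + β * (y / x) = z / x := by
      rw [hzz]; field_simp
    rw [h2, mem_mSet_iff] at h1
    rcases h1.2 with h | h
    · exact div_ne_zero hz0 hx0 h
    · exact h (by simpa using hxz)
  have key : ∀ t ∈ quadT S z, ∃ r ∈ S, ∃ a ∈ S', ∃ b ∈ S', t = r + a * x + b * (y / x) := by
    intro t ht
    unfold quadT at ht
    induction ht using Subring.closure_induction with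
    | mem t ht =>
      rcases ht with ht | ⟨c, hc, rfl⟩
      · exact ⟨t, ht, 0, S'.zero_mem, 0, S'.zero_mem, by ring⟩
      · rw [hxy] at hc
        obtain ⟨γ, hγ, δ, hδ, rfl⟩ := hc
        refine ⟨γ * α⁻¹, S.mul_mem hγ hαu.2, 0, S'.zero_mem,
          δ * (x / z) - γ * α⁻¹ * β * (x / z), ?_, ?_⟩
        · exact S'.sub_mem (S'.mul_mem (hdom.1 hδ) hxz)
            (S'.mul_mem (S'.mul_mem (S'.mul_mem (hdom.1 hγ) (hdom.1 hαu.2)) (hdom.1 hβ)) hxz)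
        · have := hαu.1
          field_simp
          rw [hzz]
          ring
    | zero => exact ⟨0, S.zero_mem, 0, S'.zero_mem, 0, S'.zero_mem, by ring⟩
    | one => exact ⟨1, S.one_mem, 0, S'.zero_mem, 0, S'.zero_mem, by ring⟩
    | add f g _ _ hf hg =>
      obtain ⟨r, hr, a, ha, b, hb, rfl⟩ := hf
      obtain ⟨r', hr', a', ha', b', hb', rfl⟩ := hg
      exact ⟨r + r', S.add_mem hr hr', a + a', S'.add_mem ha ha', b + b', S'.add_mem hb hb',
        by ring⟩
    | neg f _ hf =>
      obtain ⟨r, hr, a, ha, b, hb, rfl⟩ := hf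
      exact ⟨-r, S.neg_mem hr, -a, S'.neg_mem ha, -b, S'.neg_mem hb, by ring⟩
    | mul f g _ _ hf hg =>
      obtain ⟨r, hr, a, ha, b, hb, rfl⟩ := hf
      obtain ⟨r', hr', a', ha', b', hb', rfl⟩ := hg
      have hg : r' + a' * x + b' * (y / x) ∈ S' :=
        S'.add_mem (S'.add_mem (hdom.1 hr') (S'.mul_mem ha' hxS')) (S'.mul_mem hb' hyx)
      exact ⟨r * r', S.mul_mem hr hr', r * a' + a * (r' + a' * x + b' * (y / x)),
        S'.add_mem (S'.mul_mem (hdom.1 hr) ha') (S'.mul_mem ha hg),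
        r * b' + b * (r' + a' * x + b' * (y / x)),
        S'.add_mem (S'.mul_mem (hdom.1 hr) hb') (S'.mul_mem hb hg), by ring⟩
  ext g
  constructor
  · intro hg
    obtain ⟨t, ht, s, hs, hs0, hsi, rfl⟩ := hS' g (mem_mSet_iff.mp hg).1
    have htm : t ∈ mSet S' := by
      have := mSet_mul (hTS' s hs) hg
      rwa [mul_div_cancel₀ _ hs0] at this
    obtain ⟨r, hr, a, ha, b, hb, e⟩ := key t ht
    have hrm : r ∈ mSet S' := by
      have : r = t + ((-a) * x + (-b) * (y / x)) := by rw [e]; ring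
      rw [this]
      exact mSet_add hloc htm (mSet_add hloc (mSet_mul (S'.neg_mem ha) hxm)
        (mSet_mul (S'.neg_mem hb) hym))
    rw [← hdom.2 r hr, hxy] at hrm
    obtain ⟨γ, hγ, δ, hδ, rfl⟩ := hrm
    refine ⟨s⁻¹ * (γ + δ * (y / x) + a), S'.mul_mem hsi (S'.add_mem (S'.add_mem (hdom.1 hγ)
      (S'.mul_mem (hdom.1 hδ) hyx)) ha), s⁻¹ * b, S'.mul_mem hsi hb, ?_⟩
    rw [e]
    field_simp
  · rintro ⟨a, ha, b, hb, rfl⟩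
    exact mSet_add hloc (mSet_mul ha hxm) (mSet_mul hb hym)

theorem lqt_step {S S' : Subring F} (h : IsLQT S S') (hloc : IsLocalRing S')
    {x y : F} (hxy : Params S x y) :
    (x ≠ 0 ∧ y / x ∈ S' ∧ (x / y ∈ S' ∧ y ≠ 0 ∨ Params S' x (y / x))) ∨
    (y ≠ 0 ∧ x / y ∈ S' ∧ (y / x ∈ S' ∧ x ≠ 0 ∨ Params S' y (x / y))) := by
  have hdom := lqt_dom h
  obtain ⟨z, hz, hzsq, p, hp, hpS, hS'⟩ := h
  have hz0 : z ≠ 0 := by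
    rintro rfl
    exact hzsq ⟨0, Fin.elim0, Fin.elim0, fun i => i.elim0, by simp⟩
  have hfr : ∀ t ∈ quadT S z, ∀ s : quadT S z, s ∉ p → t / s ∈ S' := by
    intro t ht s hs
    change _ ∈ (S' : Set F)
    rw [hS']
    exact ⟨⟨t, ht⟩, s, hs, rfl⟩
  have h1p : (1 : quadT S z) ∉ p := (Ideal.ne_top_iff_one p).mp hp.ne_top
  have hTS' : ∀ f ∈ quadT S z, f ∈ S' := by
    intro f hf
    simpa using hfr f hf 1 h1p
  have hne : ∀ s : quadT S z, s ∉ p → (s : F) ≠ 0 := by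
    intro s hs h0
    exact hs (by rw [show s = 0 from Subtype.ext h0]; exact p.zero_mem)
  have hS'' : ∀ f ∈ S', ∃ t ∈ quadT S z, ∃ s ∈ quadT S z, s ≠ 0 ∧ s⁻¹ ∈ S' ∧ f = t / s := by
    intro f hf
    change f ∈ (S' : Set F) at hf
    rw [hS'] at hf
    obtain ⟨t, s, hs, e⟩ := hf
    exact ⟨t, t.2, s, s.2, hne s hs, by simpa using hfr 1 (Subring.one_mem _) s hs, e⟩
  have hyz : y / z ∈ quadT S z := Subring.subset_closure (Or.inr ⟨y, hxy.symm.left, rfl⟩)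
  have hxz : x / z ∈ quadT S z := Subring.subset_closure (Or.inr ⟨x, hxy.left, rfl⟩)
  have hST : ∀ f ∈ S, f ∈ quadT S z := fun f hf => Subring.subset_closure (Or.inl hf)
  have hor : (⟨x / z, hxz⟩ : quadT S z) ∉ p ∨ (⟨y / z, hyz⟩ : quadT S z) ∉ p := by
    by_contra! hc
    have hz' := hz
    rw [hxy] at hz'
    obtain ⟨α, hα, β, hβ, hzz⟩ := hz'
    apply h1p
    have : (1 : quadT S z) = ⟨α, hST α hα⟩ * ⟨x / z, hxz⟩ + ⟨β, hST β hβ⟩ * ⟨y / z, hyz⟩ := by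
      apply Subtype.ext
      change (1 : F) = α * (x / z) + β * (y / z)
      field_simp
      exact hzz
    rw [this]
    exact p.add_mem (p.mul_mem_left _ hc.1) (p.mul_mem_left _ hc.2)
  rcases hor with hn | hn
  · left
    have hx0 : x ≠ 0 := by
      rintro rfl
      exact hne _ hn (by simp)
    have hu : z / x ∈ S' := by simpa using hfr 1 (Subring.one_mem _) _ hn
    exact ⟨hx0, lqt_chart hloc hdom hxy hz hz0 hTS' hS'' hx0 hu⟩
  · right
    have hx0 : y ≠ 0 := by
      rintro rfl
      exact hne _ hn (by simp)
    have hu : z / y ∈ S' := by simpa using hfr 1 (Subring.one_mem _) _ hn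
    exact ⟨hx0, lqt_chart hloc hdom hxy.symm hz hz0 hTS' hS'' hx0 hu⟩

/-- Euclidean algorithm. -/
theorem euclid (Rs : ℕ → Subring F) (hl : ∀ i, IsLQT (Rs i) (Rs (i + 1)))
    (hr : ∀ i, IsLocalRing (Rs i)) (N : ℕ) : ∀ (i m n : ℕ) (x y : F), m + n ≤ N →
    Params (Rs i) x y → x ≠ 0 → y ≠ 0 → ∃ j, i ≤ j ∧ (x ^ m / y ^ n ∈ Rs j ∨ y ^ n / x ^ m ∈ Rs j) := by
  induction N with
  | zero =>
    intro i m n x y h hp hx hy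
    obtain ⟨rfl, rfl⟩ : m = 0 ∧ n = 0 := by omega
    exact ⟨i, le_rfl, by simp [Subring.one_mem]⟩
  | succ N ih =>
    -- one chart
    have aux : ∀ (i m n : ℕ) (x y : F), m + n ≤ N + 1 → 0 < m → 0 < n → Params (Rs i) x y →
        x ≠ 0 → y ≠ 0 → y / x ∈ Rs (i + 1) →
        (x / y ∈ Rs (i + 1) ∧ y ≠ 0 ∨ Params (Rs (i + 1)) x (y / x)) →
        ∃ j, i ≤ j ∧ (x ^ m / y ^ n ∈ Rs j ∨ y ^ n / x ^ m ∈ Rs j) := by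
      intro i m n x y h hm hn hp hx hy hyx hc
      have hxS : x ∈ Rs (i + 1) := (lqt_dom (hl i)).1 (mem_mSet_iff.mp hp.left).1
      rcases le_total m n with hmn | hmn
      · obtain ⟨k, rfl⟩ := Nat.exists_eq_add_of_le hmn
        refine ⟨i + 1, by omega, Or.inr ?_⟩
        have : y ^ (m + k) / x ^ m = x ^ k * (y / x) ^ (m + k) := by
          simp only [div_pow, pow_add]
          field_simp
          try ring
        rw [this]
        exact Subring.mul_mem _ (Subring.pow_mem _ hxS _) (Subring.pow_mem _ hyx _)
      · obtain ⟨k, rfl⟩ := Nat.exists_eq_add_of_le hmn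
        rcases hc with ⟨hxy, -⟩ | hc
        · refine ⟨i + 1, by omega, Or.inl ?_⟩
          have : x ^ (n + k) / y ^ n = x ^ k * (x / y) ^ n := by
            simp only [div_pow, pow_add]
            field_simp
            try ring
          rw [this]
          exact Subring.mul_mem _ (Subring.pow_mem _ hxS _) (Subring.pow_mem _ hxy _)
        · obtain ⟨j, hj, hh⟩ := ih (i + 1) k n x (y / x) (by omega) hc hx (div_ne_zero hy hx)
          refine ⟨j, by omega, ?_⟩
          have e1 : x ^ (n + k) / y ^ n = x ^ k / (y / x) ^ n := by
            simp only [div_pow, pow_add]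
            field_simp
            try ring
          have e2 : y ^ n / x ^ (n + k) = (y / x) ^ n / x ^ k := by
            simp only [div_pow, pow_add]
            field_simp
            try ring
          rwa [e1, e2]
    intro i m n x y h hp hx hy
    have hxS := (mem_mSet_iff.mp hp.left).1
    have hyS := (mem_mSet_iff.mp hp.symm.left).1
    rcases Nat.eq_zero_or_pos m with rfl | hm
    · exact ⟨i, le_rfl, Or.inr (by simpa using Subring.pow_mem _ hyS n)⟩
    rcases Nat.eq_zero_or_pos n with rfl | hn
    · exact ⟨i, le_rfl, Or.inl (by simpa using Subring.pow_mem _ hxS m)⟩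
    rcases lqt_step (hl i) (hr (i + 1)) hp with ⟨-, h1, h2⟩ | ⟨-, h1, h2⟩
    · exact aux i m n x y h hm hn hp hx hy h1 h2
    · obtain ⟨j, hj, hh⟩ := aux i n m y x (by omega) hn hm hp.symm hy hx h1 h2
      exact ⟨j, hj, hh.symm⟩

/-- Factors of a monomial are monomials. -/
theorem factor_monomial {S : Subring F} (hS : IsRegLocal2 S) {x y u a b : F} {s t : ℕ}
    (hp : Params S x y) (ha : a ∈ S) (hb : b ∈ S) (huS : u ∈ S) (hu : IsUnit (⟨u, huS⟩ : S))
    (e : a * b = x ^ s * y ^ t * u) :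
    x ≠ 0 ∧ y ≠ 0 ∧ ∃ s₁ t₁ s₂ t₂ : ℕ, ∃ u₁ u₂ : F, u₁ ≠ 0 ∧ u₂ ≠ 0 ∧
      u₁ ∈ S ∧ u₁⁻¹ ∈ S ∧ u₂ ∈ S ∧ u₂⁻¹ ∈ S ∧
      a = x ^ s₁ * y ^ t₁ * u₁ ∧ b = x ^ s₂ * y ^ t₂ * u₂ := by
  have hxS := (mem_mSet_iff.mp hp.left).1
  have hyS := (mem_mSet_iff.mp hp.symm.left).1
  have px := hp.prime hS hxS hyS
  have py := hp.symm.prime hS hyS hxS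
  refine ⟨fun h => px.ne_zero (Subtype.ext h), fun h => py.ne_zero (Subtype.ext h), ?_⟩
  have e' : (⟨a, ha⟩ : S) * ⟨b, hb⟩ = (⟨u, huS⟩ * ⟨x, hxS⟩ ^ s) * ⟨y, hyS⟩ ^ t := by
    apply Subtype.ext
    change a * b = u * x ^ s * y ^ t
    rw [e]; ring
  obtain ⟨t₁, t₂, c, d, -, h1, h2, h3⟩ := mul_eq_mul_prime_pow py e'
  obtain ⟨s₁, s₂, v, w, -, h4, h5, h6⟩ := mul_eq_mul_prime_pow px h1.symm
  rw [h4, IsUnit.mul_iff] at hu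
  have hunit : ∀ v : S, IsUnit v → (v : F) ≠ 0 ∧ (v : F)⁻¹ ∈ S := by
    intro v hv
    have : (v : F) ∉ mSet S := fun ⟨_, h⟩ => h hv
    rw [mem_mSet_iff] at this
    have hv := v.2
    tauto
  refine ⟨s₁, t₁, s₂, t₂, v, w, (hunit v hu.1).1, (hunit w hu.2).1, v.2, (hunit v hu.1).2,
    w.2, (hunit w hu.2).2, ?_, ?_⟩
  · have := congrArg Subtype.val h2
    rw [h5] at this
    change a = v * x ^ s₁ * y ^ t₁ at this
    rw [this]; ring
  · have := congrArg Subtype.val h3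
    rw [h6] at this
    change b = w * x ^ s₂ * y ^ t₂ at this
    rw [this]; ring

/-- Let `(R, 𝔪)` be a regular local ring of Krull dimension 2 with
field of fractions `F`, and `(R_i, 𝔪_i)_{i∈ℕ}` a simple sequence of local quadratic
transforms of `R`.  Assume that every nonzero `f ∈ R` can be written `f = x^s y^t u`
in some `R_i`, where `(x, y)` generates `𝔪_i` and `u` is a unit of `R_i`.  Then
`R̄ = ⋃ᵢ R_i` is a valuation subring of `F` dominating every `R_i`, and every
valuation subring of `F` dominating all the `R_i` equals `R̄`. -/
theorem union_is_valuation_ring_of_simple_sequence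
    (F : Type*) [Field F] (R : Subring F)
    (hR : IsRegLocal2 R) (hRF : IsFracField R)
    (Rs : ℕ → Subring F) (hseq : IsSimpleSeq R Rs)
    (hmono : ∀ f : F, f ∈ (R : Set F) → f ≠ 0 →
      ∃ (i : ℕ) (x y u : F) (s t : ℕ),
        x ∈ Rs i ∧ y ∈ Rs i ∧
        mSet (Rs i) = {g : F | ∃ a ∈ Rs i, ∃ b ∈ Rs i, g = a * x + b * y} ∧
        (∃ hu : u ∈ Rs i, IsUnit (⟨u, hu⟩ : Rs i)) ∧
        f = x ^ s * y ^ t * u) :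
    ∃ V : ValuationSubring F,
      (V : Set F) = ⋃ i : ℕ, (Rs i : Set F) ∧
      (∀ i : ℕ, Dominates (Rs i) V.toSubring) ∧
      ∀ W : ValuationSubring F, (∀ i : ℕ, Dominates (Rs i) W.toSubring) → W = V := by
  obtain ⟨h0, hs⟩ := hseq
  have hl : ∀ i, IsLQT (Rs i) (Rs (i + 1)) := fun i => (hs i).1
  have hreg : ∀ i, IsRegLocal2 (Rs i) := by
    intro i
    cases i with
    | zero => rwa [h0]
    | succ i => exact (hs i).2.1
  have hr : ∀ i, IsLocalRing (Rs i) := fun i => (hreg i).2.1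
  have hmon : Monotone Rs := monotone_nat_of_le_succ fun i => (lqt_dom (hl i)).1
  have hdom : ∀ i k f, f ∈ mSet (Rs i) → f ∈ mSet (Rs (i + k)) := by
    intro i k f hf
    induction k with
    | zero => exact hf
    | succ k ih => exact ((lqt_dom (hl (i + k))).2 f (mem_mSet_iff.mp ih).1).mp ih
  have hval : ∀ f : F, ∃ j, f ∈ Rs j ∨ f⁻¹ ∈ Rs j := by
    intro f
    obtain ⟨a, ha, b, hb, hb0, rfl⟩ := hRF f
    by_cases ha0 : a = 0
    · exact ⟨0, Or.inl (by simp [ha0, Subring.zero_mem])⟩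
    obtain ⟨i, x, y, u, s, t, -, -, hp, ⟨huS, hu⟩, e⟩ :=
      hmono (a * b) (R.mul_mem ha hb) (mul_ne_zero ha0 hb0)
    have h0i : R ≤ Rs i := h0 ▸ hmon (Nat.zero_le i)
    obtain ⟨hx, hy, s₁, t₁, s₂, t₂, u₁, u₂, hu1, hu2, hu1S, hu1i, hu2S, hu2i, rfl, rfl⟩ :=
      factor_monomial (hreg i) hp (h0i ha) (h0i hb) huS hu e
    have hp : Params (Rs i) x y := hp
    have hxS := (mem_mSet_iff.mp hp.left).1
    have hyS := (mem_mSet_iff.mp hp.symm.left).1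
    rw [inv_div]
    -- it suffices to treat the monomial part
    suffices H : ∃ j, i ≤ j ∧ (x ^ s₁ * y ^ t₁ / (x ^ s₂ * y ^ t₂) ∈ Rs j ∨
        x ^ s₂ * y ^ t₂ / (x ^ s₁ * y ^ t₁) ∈ Rs j) by
      obtain ⟨j, hij, hj⟩ := H
      have hij := hmon hij
      refine ⟨j, hj.imp (fun h => ?_) (fun h => ?_)⟩
      · have := (Rs j).mul_mem h ((Rs j).mul_mem (hij hu1S) (hij hu2i))
        convert this using 1
        field_simp
      · have := (Rs j).mul_mem h ((Rs j).mul_mem (hij hu2S) (hij hu1i))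
        convert this using 1
        field_simp
    have hpow : ∀ m n, x ^ m * y ^ n ∈ Rs i := fun m n =>
      (Rs i).mul_mem ((Rs i).pow_mem hxS _) ((Rs i).pow_mem hyS _)
    rcases le_total s₁ s₂ with h1 | h1 <;> rcases le_total t₁ t₂ with h2 | h2 <;>
      obtain ⟨k, rfl⟩ := Nat.exists_eq_add_of_le h1 <;>
      obtain ⟨l, rfl⟩ := Nat.exists_eq_add_of_le h2
    · refine ⟨i, le_rfl, Or.inr ?_⟩
      convert hpow k l using 1
      field_simp
      try ring
    · obtain ⟨j, hj, h⟩ := euclid Rs hl hr _ i k l x y le_rfl hp hx hy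
      refine ⟨j, hj, h.symm.imp (fun h => ?_) (fun h => ?_)⟩ <;>
      · convert h using 1
        field_simp
        try ring
    · obtain ⟨j, hj, h⟩ := euclid Rs hl hr _ i k l x y le_rfl hp hx hy
      refine ⟨j, hj, h.imp (fun h => ?_) (fun h => ?_)⟩ <;>
      · convert h using 1
        field_simp
        try ring
    · refine ⟨i, le_rfl, Or.inl ?_⟩
      convert hpow k l using 1
      field_simp
      try ring
  have hdir : Directed (· ≤ ·) Rs := hmon.directed_le
  have hmemV : ∀ f : F, f ∈ (⨆ i, Rs i) ↔ ∃ i, f ∈ Rs i := fun f =>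
    Subring.mem_iSup_of_directed hdir
  let V : ValuationSubring F :=
    { (⨆ i, Rs i) with
      mem_or_inv_mem' := by
        intro f
        obtain ⟨j, h | h⟩ := hval f
        · exact Or.inl ((hmemV _).mpr ⟨j, h⟩)
        · exact Or.inr ((hmemV _).mpr ⟨j, h⟩) }
  have hVmem : ∀ f : F, f ∈ V.toSubring ↔ ∃ i, f ∈ Rs i := hmemV
  have hVdom : ∀ i f, f ∈ mSet (Rs i) → f ∈ mSet V.toSubring := by
    intro i f hf
    rw [mem_mSet_iff]
    refine ⟨(hVmem f).mpr ⟨i, (mem_mSet_iff.mp hf).1⟩, ?_⟩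
    by_contra! hc
    obtain ⟨j, hj⟩ := (hVmem _).mp hc.2
    have h1 := (mem_mSet_iff.mp (hdom i j f hf)).2
    exact h1.elim hc.1 (fun h => h (hmon (Nat.le_add_left j i) hj))
  refine ⟨V, ?_, ?_, ?_⟩
  · ext f
    rw [Set.mem_iUnion]
    exact hVmem f
  · intro i
    refine ⟨fun f hf => (hVmem f).mpr ⟨i, hf⟩, fun f hf => ⟨hVdom i f, ?_⟩⟩
    rw [mem_mSet_iff, mem_mSet_iff]
    rintro ⟨-, hc⟩
    exact ⟨hf, hc.imp id fun hc hc' => hc ((hVmem _).mpr ⟨i, hc'⟩)⟩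
  · intro W hW
    ext f
    constructor
    · intro hf
      by_contra hfV
      have hfV' : ∀ i, f ∉ Rs i := fun i hi => hfV ((hVmem f).mpr ⟨i, hi⟩)
      have hf0 : f ≠ 0 := by
        rintro rfl
        exact hfV' 0 (Subring.zero_mem _)
      obtain ⟨j, h | h⟩ := hval f
      · exact hfV' j h
      · have h1 : f⁻¹ ∈ mSet (Rs j) := mem_mSet_iff.mpr ⟨h, Or.inr (by simpa using hfV' j)⟩
        rw [(hW j).2 _ h, mem_mSet_iff] at h1
        rcases h1.2 with h2 | h2
        · exact inv_ne_zero hf0 h2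
        · exact h2 (by simpa using hf)
    · intro hf
      obtain ⟨i, hi⟩ := (hVmem f).mp hf
      exact (hW i).1 hi
end
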